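/- Let ν be a nonempty partition of type 1 with ν₁ ≤ 4, and let μ be a partition with ν ⊆ μ and |μ| = |ν| + 1. Then μ covers ν if and only if μ = ν + (1). -/

import Mathlib

/-- A partition, 0-indexed: `f i` is the `(i+1)`-st part. A partition is a weakly
decreasing, eventually zero function `ℕ → ℕ`. -/
def IsPartition (f : ℕ → ℕ) : Prop := Antitone f ∧ ∃ N, f N = 0

/-- The number of (nonzero) parts of a partition. -/
noncomputable def plen (f : ℕ → ℕ) : ℕ := sInf {n | f n = 0}

/-- The size (weight) of a partition: the sum of its parts. -/
noncomputable def psize (f : ℕ → ℕ) : ℕ := ∑ i ∈ Finset.range (plen f), f i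

/-- Containment of partitions: `subP f g` means `f ⊆ g`, i.e. `f i ≤ g i` for all `i`. -/
def subP (f g : ℕ → ℕ) : Prop := ∀ i, f i ≤ g i

/-- The conjugate partition: `conjP f j = #{i : f i > j}` (0-indexed). -/
noncomputable def conjP (f : ℕ → ℕ) : ℕ → ℕ := fun j => Nat.card {i : ℕ // j < f i}

/-- The square partition `(s^s)`. -/
def squareP (s : ℕ) : ℕ → ℕ := fun j => if j < s then s else 0

/-- The partition `(s^s, 1)`: `s` parts equal to `s` followed by a part equal to `1`. -/
def squareP1 (s : ℕ) : ℕ → ℕ := fun j => if j < s then s else if j = s then 1 else 0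

/-- The complement of `f` in the square `(m^m)`: the `(i+1)`-st part (0-indexed `i < m`)
is `m - f (m - 1 - i)`. -/
def complP (m : ℕ) (f : ℕ → ℕ) : ℕ → ℕ := fun i => if i < m then m - f (m - 1 - i) else 0

/-- `ν + (1)`: add one box at the end of the first row. -/
def addRow1 (f : ℕ → ℕ) : ℕ → ℕ := fun j => if j = 0 then f 0 + 1 else f j

/-- `(ν, 1)`: append a part equal to `1` after the last nonzero part. -/
noncomputable def addPart1 (f : ℕ → ℕ) : ℕ → ℕ :=
  fun j => if j < plen f then f j else if j = plen f then 1 else 0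

/-- Delete the first `k` columns of a partition. -/
def colDel (k : ℕ) (f : ℕ → ℕ) : ℕ → ℕ := fun j => f j - k

/-- Delete the first `s` rows of a partition. -/
def rowDel (s : ℕ) (f : ℕ → ℕ) : ℕ → ℕ := fun j => f (j + s)

/-- The sequence whose first `m` entries are given by `f` and whose subsequent entries
are given by `g`; used to form `(η^{c,m} + γ, σ)`. -/
def appendAfter (m : ℕ) (f g : ℕ → ℕ) : ℕ → ℕ := fun i => if i < m then f i else g (i - m)

/-- The cell in row `r`, column `c` (both 0-indexed) belongs to the skew diagram
`lam/alpha`. -/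
def inShape (lam alpha : ℕ → ℕ) (r c : ℕ) : Prop := alpha r ≤ c ∧ c < lam r

/-- A Littlewood–Richardson tableau of shape `lam/alpha` and content `beta`
(for each `k`, there are `beta k` entries equal to `k + 1`): a semistandard filling of
the skew diagram whose reverse reading word is a lattice permutation.  The lattice
condition is expressed by comparing, in every prefix of the reverse reading word ending
at a cell `(r, c)` (all cells in rows above `r`, together with the cells in row `r`
weakly to the right of column `c`), the number of entries `k + 2` with the number of
entries `k + 1`. -/
structure LRTableau (lam alpha beta : ℕ → ℕ) where
  entry : ℕ → ℕ → ℕ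
  zero_outside : ∀ r c, ¬ inShape lam alpha r c → entry r c = 0
  one_le : ∀ r c, inShape lam alpha r c → 1 ≤ entry r c
  row_weak : ∀ r c₁ c₂, c₁ ≤ c₂ → inShape lam alpha r c₁ → inShape lam alpha r c₂ →
    entry r c₁ ≤ entry r c₂
  col_strict : ∀ r₁ r₂ c, r₁ < r₂ → inShape lam alpha r₁ c → inShape lam alpha r₂ c →
    entry r₁ c < entry r₂ c
  content : ∀ k : ℕ,
    Nat.card {p : ℕ × ℕ // inShape lam alpha p.1 p.2 ∧ entry p.1 p.2 = k + 1} = beta k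
  lattice : ∀ r c k : ℕ, inShape lam alpha r c →
    Nat.card {p : ℕ × ℕ // inShape lam alpha p.1 p.2 ∧
        (p.1 < r ∨ (p.1 = r ∧ c ≤ p.2)) ∧ entry p.1 p.2 = k + 2} ≤
    Nat.card {p : ℕ × ℕ // inShape lam alpha p.1 p.2 ∧
        (p.1 < r ∨ (p.1 = r ∧ c ≤ p.2)) ∧ entry p.1 p.2 = k + 1}

open Classical in
/-- The Littlewood–Richardson coefficient `c^lam_{alpha, beta}`: the number of LR
tableaux of shape `lam/alpha` and content `beta`, or `0` if `alpha ⊄ lam`. -/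
noncomputable def LRcoeff (lam alpha beta : ℕ → ℕ) : ℕ :=
  if subP alpha lam then Nat.card (LRTableau lam alpha beta) else 0

/-- `mu` covers `nu`: for every integer `m ≥ μ₁ + ℓ(μ)` and every partition `lam`,
`c^lam_{ν^{c,m}, ν'} ≤ c^lam_{μ^{c,m}, μ'}`, i.e. `s_{μ'} s_{μ^c} - s_{ν'} s_{ν^c}`
is Schur-positive (complements taken in `(m^m)`). -/
def Covers (mu nu : ℕ → ℕ) : Prop :=
  ∀ m : ℕ, mu 0 + plen mu ≤ m → ∀ lam : ℕ → ℕ, IsPartition lam →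
    LRcoeff lam (complP m nu) (conjP nu) ≤ LRcoeff lam (complP m mu) (conjP mu)

/-- The partition `(i^{s+1}, i, i-1, ..., 2, 1)` (as a 0-indexed function). -/
def betaShape (i s : ℕ) : ℕ → ℕ := fun j => if j ≤ s + 1 then i else i + s + 1 - j

/-- A partition is of type 1 if it contains `(i, i, i-1, ..., 2, 1)` where `i` is its
first part. -/
def Type1 (nu : ℕ → ℕ) : Prop := IsPartition nu ∧ subP (betaShape (nu 0) 0) nu

/-- `nu = beta + (s^s) + alpha` (componentwise) is a type-2 decomposition: `s ≥ 1`,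
`alpha` is a nonempty partition with at most `s` parts, and `beta` is a (possibly empty)
partition containing `(i^{s+1}, i, i-1, ..., 2, 1)` where `i = beta 0`. -/
def IsType2Decomp (nu beta : ℕ → ℕ) (s : ℕ) (alpha : ℕ → ℕ) : Prop :=
  IsPartition beta ∧ IsPartition alpha ∧ 1 ≤ s ∧ alpha 0 ≠ 0 ∧ plen alpha ≤ s ∧
    subP (betaShape (beta 0) s) beta ∧ ∀ j, nu j = beta j + squareP s j + alpha j

/-- A partition is of type 2 if it admits a type-2 decomposition. -/
def Type2 (nu : ℕ → ℕ) : Prop := ∃ beta s alpha, IsType2Decomp nu beta s alpha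

/-- A self-conjugate partition. -/
def SelfConjugate (t : ℕ → ℕ) : Prop := ∀ j, conjP t j = t j

/-- A partition `nu` is corner-symmetric if for every outer corner of `nu` in row
`r + 1 ≥ 2` (1-indexed), i.e. every 0-indexed row `r ≥ 1` with `nu r < nu (r-1)`
(the corner cell lying in 0-indexed column `nu r`), there is a nonempty partition
`η ⊆ nu` such that the skew diagram `nu/η` is, up to translation, the Young diagram of
a self-conjugate partition, contains the cell `(r-1, nu r)` (0-indexed), and contains
no cell in any column of 0-indexed column index `< nu r`. -/
def CornerSymmetric (nu : ℕ → ℕ) : Prop :=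
  ∀ r : ℕ, 1 ≤ r → nu r < nu (r - 1) →
    ∃ η : ℕ → ℕ, IsPartition η ∧ subP η nu ∧ η 0 ≠ 0 ∧
      ∃ t : ℕ → ℕ, ∃ r0 c0 : ℕ, IsPartition t ∧ SelfConjugate t ∧
        (∀ a b : ℕ, (η a ≤ b ∧ b < nu a) ↔ (r0 ≤ a ∧ c0 ≤ b ∧ b - c0 < t (a - r0))) ∧
        η (r - 1) ≤ nu r ∧
        (∀ a b : ℕ, η a ≤ b → b < nu a → nu r ≤ b)

namespace ColumnWord

open Finset MvPolynomial

/-- The number of elements of `T` that are at least `b`. -/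
def upCard {n : ℕ} (T : Finset (Fin n)) (b : ℕ) : ℕ := (T.filter fun x => b ≤ x.val).card

/-- A column with entry set `T` can be placed to the left of a column with entry set `S` whose
bottom cell lies `d` rows higher. -/
def Compat {n : ℕ} (d : ℕ) (S T : Finset (Fin n)) : Prop := ∀ b, upCard T b ≤ upCard S b + d

/-- The indicator vector of a set of letters. -/
def ind {n : ℕ} (T : Finset (Fin n)) : Fin n → ℕ := fun b => if b ∈ T then 1 else 0

open Classical in
/-- Sum of `F` over the final states of all dominant column words with given column lengths and
bottom offsets, starting from the weight `α` and the previous column `S`. -/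
noncomputable def run {n : ℕ} {R : Type*} [AddCommMonoid R] :
    List (ℕ × ℕ) → Finset (Fin n) → (Fin n → ℕ) → (Finset (Fin n) → (Fin n → ℕ) → R) → R
  | [], S, α, F => F S α
  | p :: L, S, α, F =>
      ∑ T : Finset (Fin n) with T.card = p.1 ∧ Compat p.2 S T ∧ Antitone (α + ind T),
        run L T (α + ind T) F

/-- The monomial of a column. -/
noncomputable def mono {n : ℕ} (T : Finset (Fin n)) : MvPolynomial (Fin n) ℤ := ∏ b ∈ T, X b

open Classical in
/-- The generating function of all column words (without dominance). -/
noncomputable def gen {n : ℕ} : List (ℕ × ℕ) → Finset (Fin n) → MvPolynomial (Fin n) ℤ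
  | [], _ => 1
  | p :: L, S => ∑ T : Finset (Fin n) with T.card = p.1 ∧ Compat p.2 S T, mono T * gen L T

section Symmetry

open Classical in
theorem gen_cons {n : ℕ} (p : ℕ × ℕ) (L : List (ℕ × ℕ)) (S : Finset (Fin n)) :
    gen (p :: L) S = ∑ T : Finset (Fin n) with T.card = p.1 ∧ Compat p.2 S T, mono T * gen L T :=
  rfl

variable {n : ℕ}

theorem upCard_val (T : Finset (Fin n)) (x : Fin n) :
    upCard T x.val = upCard T (x.val + 1) + ind T x := by
  unfold upCard ind
  have : (T.filter fun y : Fin n => x.val ≤ y.val) =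
      (T.filter fun y : Fin n => x.val + 1 ≤ y.val) ∪ T.filter fun y => y = x := by
    ext y
    simp only [mem_filter, mem_union]
    constructor
    · rintro ⟨h1, h2⟩
      rcases h2.lt_or_eq with h | h
      · exact Or.inl ⟨h1, h⟩
      · exact Or.inr ⟨h1, Fin.ext h.symm⟩
    · rintro (⟨h1, h2⟩ | ⟨h1, rfl⟩)
      · exact ⟨h1, by omega⟩
      · exact ⟨h1, le_rfl⟩
  rw [this, card_union_of_disjoint]
  · congr 1
    split_ifs with h
    · rw [card_eq_one]
      exact ⟨x, by ext y; simp only [mem_filter, mem_singleton]; constructor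
                   · exact fun h => h.2
                   · rintro rfl; exact ⟨h, rfl⟩⟩
    · rw [card_eq_zero, filter_eq_empty_iff]
      rintro y hy rfl
      exact h hy
  · rw [disjoint_left]
    intro y hy hy'
    simp only [mem_filter] at hy hy'
    have := hy.2
    rw [hy'.2] at this
    omega

theorem upCard_zero (T : Finset (Fin n)) : upCard T 0 = T.card := by
  simp [upCard]

theorem upCard_le_card (T : Finset (Fin n)) (b : ℕ) : upCard T b ≤ T.card :=
  card_le_card (filter_subset _ _)

/-- Exchange the letters `k` and `k'`. -/
def swapCol (k k' : Fin n) (T : Finset (Fin n)) : Finset (Fin n) :=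
  T.map (Equiv.swap k k').toEmbedding

theorem mem_swapCol {k k' x : Fin n} {T : Finset (Fin n)} :
    x ∈ swapCol k k' T ↔ Equiv.swap k k' x ∈ T := by
  unfold swapCol
  rw [Finset.mem_map_equiv, Equiv.symm_swap]

theorem swapCol_swapCol (k k' : Fin n) (T : Finset (Fin n)) :
    swapCol k k' (swapCol k k' T) = T := by
  ext x; simp [mem_swapCol]

theorem card_swapCol (k k' : Fin n) (T : Finset (Fin n)) :
    (swapCol k k' T).card = T.card := by
  simp [swapCol]

theorem rename_mono (k k' : Fin n) (T : Finset (Fin n)) :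
    rename (Equiv.swap k k') (mono T) = mono (swapCol k k' T) := by
  simp [mono, swapCol, map_prod, prod_map]

theorem swapCol_eq_self {k k' : Fin n} {T : Finset (Fin n)} (h : k ∈ T ↔ k' ∈ T) :
    swapCol k k' T = T := by
  ext x
  rw [mem_swapCol]
  by_cases h1 : x = k
  · subst h1; simp [h]
  by_cases h2 : x = k'
  · subst h2; simp [h]
  rw [Equiv.swap_apply_of_ne_of_ne h1 h2]

theorem upCard_swapCol {k k' : Fin n} (hk : k'.val = k.val + 1) (T : Finset (Fin n)) {b : ℕ}
    (hb : b ≠ k'.val) : upCard (swapCol k k' T) b = upCard T b := by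
  unfold upCard swapCol
  rw [filter_map, card_map]
  congr 1
  ext x
  simp only [mem_filter, Function.comp, Equiv.coe_toEmbedding]
  refine and_congr_right fun _ => ?_
  by_cases h1 : x = k
  · subst h1; rw [Equiv.swap_apply_left]; omega
  by_cases h2 : x = k'
  · subst h2; rw [Equiv.swap_apply_right]; omega
  rw [Equiv.swap_apply_of_ne_of_ne h1 h2]

theorem ind_swapCol_right (k k' : Fin n) (T : Finset (Fin n)) :
    ind (swapCol k k' T) k' = ind T k := by
  simp [ind, mem_swapCol]

theorem upCard_swapCol_right {k k' : Fin n} (hk : k'.val = k.val + 1) (T : Finset (Fin n)) :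
    upCard (swapCol k k' T) k'.val = upCard T (k'.val + 1) + ind T k := by
  rw [upCard_val, upCard_swapCol hk T (by omega), ind_swapCol_right]

theorem Compat.swapCol {k k' : Fin n} (hk : k'.val = k.val + 1) {d : ℕ} {S T : Finset (Fin n)}
    (hS : ¬(k ∈ S ∧ k' ∉ S)) (h : Compat d S T) : Compat d S (swapCol k k' T) := by
  intro b
  by_cases hb : b = k'.val
  · subst hb
    rw [upCard_swapCol_right hk]
    have h1 := h k.val
    have h2 := h k'.val
    have h3 := h (k'.val + 1)
    have e1 := upCard_val S k
    have e2 := upCard_val S k'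
    have e3 := upCard_val T k
    have e4 := upCard_val T k'
    rw [hk] at *
    unfold ind at *
    by_cases a1 : k ∈ S <;> by_cases a2 : k' ∈ S <;> by_cases a3 : k ∈ T <;>
      by_cases a4 : k' ∈ T <;> simp [a1, a2, a3, a4] at * <;> omega
  · rw [upCard_swapCol hk T hb]
    exact h b

theorem compat_swapCol_left {k k' : Fin n} (hk : k'.val = k.val + 1) {d : ℕ}
    {S T : Finset (Fin n)} (h1 : k ∈ S) (h2 : k' ∉ S) (h : Compat d S T) :
    Compat d (swapCol k k' S) T := by
  intro b
  by_cases hb : b = k'.val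
  · subst hb
    rw [upCard_swapCol_right hk]
    have := h k'.val
    rw [upCard_val S k'] at this
    simp only [ind, h1, h2, if_true, if_false] at *
    omega
  · rw [upCard_swapCol hk S hb]
    exact h b

theorem mem_of_compat_swapCol_left {k k' : Fin n} (hk : k'.val = k.val + 1) {d : ℕ}
    {S T : Finset (Fin n)} (h1 : k ∈ S) (h2 : k' ∉ S) (h : Compat d (swapCol k k' S) T)
    (hn : ¬Compat d S T) : k' ∈ T ∧ k ∉ T := by
  unfold Compat at hn
  push Not at hn
  obtain ⟨b, hb⟩ := hn
  have hb' : b = k'.val := by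
    by_contra hne
    have := h b
    rw [upCard_swapCol hk S hne] at this
    omega
  subst hb'
  have g1 := h k.val
  have g3 := h (k'.val + 1)
  rw [upCard_swapCol hk S (by omega)] at g1 g3
  have e1 := upCard_val S k
  have e2 := upCard_val S k'
  have e3 := upCard_val T k
  have e4 := upCard_val T k'
  rw [hk] at *
  unfold ind at *
  by_cases a3 : k ∈ T <;> by_cases a4 : k' ∈ T <;> simp [h1, h2, a3, a4] at * <;> omega

theorem rename_sum_eq {k k' : Fin n} {A : Finset (Finset (Fin n))}
    {h : Finset (Fin n) → MvPolynomial (Fin n) ℤ}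
    (hA : ∀ T ∈ A, swapCol k k' T ∈ A)
    (hh : ∀ T, rename (Equiv.swap k k') (h T + h (swapCol k k' T)) = h T + h (swapCol k k' T)) :
    rename (Equiv.swap k k') (∑ T ∈ A, h T) = ∑ T ∈ A, h T := by
  have e : ∑ T ∈ A, h (swapCol k k' T) = ∑ T ∈ A, h T :=
    sum_nbij' (swapCol k k') (swapCol k k') hA hA (fun T _ => swapCol_swapCol k k' T)
      (fun T _ => swapCol_swapCol k k' T) (fun T _ => rfl)
  have e2 : (2 : MvPolynomial (Fin n) ℤ) * ∑ T ∈ A, h T =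
      ∑ T ∈ A, (h T + h (swapCol k k' T)) := by
    rw [sum_add_distrib, e, two_mul]
  have e3 : rename (Equiv.swap k k') ((2 : MvPolynomial (Fin n) ℤ) * ∑ T ∈ A, h T) =
      2 * ∑ T ∈ A, h T := by
    rw [e2, map_sum]
    exact sum_congr rfl fun T _ => hh T
  rw [map_mul, map_ofNat] at e3
  exact mul_left_cancel₀ two_ne_zero e3

theorem gen_swap {k k' : Fin n} (hk : k'.val = k.val + 1) (L : List (ℕ × ℕ)) :
    (∀ S, ¬(k ∈ S ∧ k' ∉ S) → rename (Equiv.swap k k') (gen L S) = gen L S) ∧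
    (∀ S, k ∈ S → k' ∉ S →
      rename (Equiv.swap k k') (mono S * gen L S + mono (swapCol k k' S) * gen L (swapCol k k' S)) =
        mono S * gen L S + mono (swapCol k k' S) * gen L (swapCol k k' S)) := by
  have hkk : k ≠ k' := fun h => by rw [h] at hk; omega
  induction L with
  | nil =>
    refine ⟨fun S _ => by simp [gen], fun S _ _ => ?_⟩
    simp only [gen, mul_one, map_add, rename_mono, swapCol_swapCol]
    rw [add_comm]
  | cons p L ih =>
    obtain ⟨ih1, ih2⟩ := ih
    have hh : ∀ T, rename (Equiv.swap k k')
        (mono T * gen L T + mono (swapCol k k' T) * gen L (swapCol k k' T)) =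
        mono T * gen L T + mono (swapCol k k' T) * gen L (swapCol k k' T) := by
      intro T
      by_cases a1 : k ∈ T <;> by_cases a2 : k' ∈ T
      · have e := swapCol_eq_self (k := k) (k' := k') (T := T) (by simp [a1, a2])
        rw [e, map_add, map_mul, rename_mono, e, ih1 T (by simp [a2])]
      · exact ih2 T a1 a2
      · have := ih2 (swapCol k k' T) (by simp [mem_swapCol, a2]) (by simp [mem_swapCol, a1])
        rw [swapCol_swapCol, add_comm] at this
        exact this
      · have e := swapCol_eq_self (k := k) (k' := k') (T := T) (by simp [a1, a2])
        rw [e, map_add, map_mul, rename_mono, e, ih1 T (by simp [a1])]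
    have key : ∀ S, ¬(k ∈ S ∧ k' ∉ S) →
        rename (Equiv.swap k k') (gen (p :: L) S) = gen (p :: L) S := by
      intro S hS
      refine rename_sum_eq (fun T hT => ?_) hh
      simp only [mem_filter, mem_univ, true_and] at hT ⊢
      exact ⟨by rw [card_swapCol]; exact hT.1, hT.2.swapCol hk hS⟩
    refine ⟨key, fun S h1 h2 => ?_⟩
    classical
    have hS' : ¬(k ∈ swapCol k k' S ∧ k' ∉ swapCol k k' S) := by simp [mem_swapCol, h2]
    have hsplit : gen (p :: L) (swapCol k k' S) = gen (p :: L) S +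
        ∑ T : Finset (Fin n) with (T.card = p.1 ∧ Compat p.2 (swapCol k k' S) T) ∧
          ¬ Compat p.2 S T, mono T * gen L T := by
      rw [gen_cons, gen_cons]
      rw [← sum_filter_add_sum_filter_not (univ.filter fun T : Finset (Fin n) => T.card = p.1 ∧
        Compat p.2 (swapCol k k' S) T) (fun T => Compat p.2 S T), filter_filter, filter_filter]
      congr 1
      refine sum_congr ?_ fun _ _ => rfl
      ext T
      simp only [mem_filter, mem_univ, true_and]
      constructor
      · rintro ⟨⟨a, _⟩, b⟩; exact ⟨a, b⟩
      · rintro ⟨a, b⟩; exact ⟨⟨a, compat_swapCol_left hk h1 h2 b⟩, b⟩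
    have bad : rename (Equiv.swap k k') (mono S *
        ∑ T : Finset (Fin n) with (T.card = p.1 ∧ Compat p.2 (swapCol k k' S) T) ∧
          ¬ Compat p.2 S T, mono T * gen L T) = mono S *
        ∑ T : Finset (Fin n) with (T.card = p.1 ∧ Compat p.2 (swapCol k k' S) T) ∧
          ¬ Compat p.2 S T, mono T * gen L T := by
      rw [mul_sum, map_sum]
      refine sum_congr rfl fun T hT => ?_
      simp only [mem_filter, mem_univ, true_and] at hT
      obtain ⟨a1, a2⟩ := mem_of_compat_swapCol_left hk h1 h2 hT.1.2 hT.2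
      rw [map_mul, map_mul, ih1 T (by simp [a1]), rename_mono, rename_mono, ← mul_assoc,
        ← mul_assoc]
      congr 1
      have x1 : mono S = X k * mono (S.erase k) := by
        unfold mono; rw [mul_prod_erase _ _ h1]
      have x2 : mono T = X k' * mono (T.erase k') := by
        unfold mono; rw [mul_prod_erase _ _ a1]
      have y1 : mono (swapCol k k' S) = X k' * mono (S.erase k) := by
        rw [← rename_mono, x1, map_mul, rename_X, Equiv.swap_apply_left, rename_mono,
          swapCol_eq_self (by simp [h2])]
      have y2 : mono (swapCol k k' T) = X k * mono (T.erase k') := by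
        rw [← rename_mono, x2, map_mul, rename_X, Equiv.swap_apply_right, rename_mono,
          swapCol_eq_self (by simp [a2])]
      rw [x1, x2, y1, y2]
      ring
    set Q := ∑ T : Finset (Fin n) with (T.card = p.1 ∧ Compat p.2 (swapCol k k' S) T) ∧
          ¬ Compat p.2 S T, mono T * gen L T with hQ
    have e : mono S * gen (p :: L) S + mono (swapCol k k' S) * gen (p :: L) (swapCol k k' S) =
        (mono S + mono (swapCol k k' S)) * gen (p :: L) (swapCol k k' S) - mono S * Q := by
      rw [hsplit]; ring
    rw [e, map_sub, bad, map_mul, map_add, rename_mono, rename_mono, swapCol_swapCol, key _ hS']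
    ring

end Symmetry

section Alternant

variable {n : ℕ}

/-- The exponent vector of a weight. -/
noncomputable def expo (a : Fin n → ℕ) : Fin n →₀ ℕ := Finsupp.equivFunOnFinite.symm a

theorem expo_injective : Function.Injective (expo : (Fin n → ℕ) → _) :=
  Finsupp.equivFunOnFinite.symm.injective

/-- The staircase `(n-1, …, 1, 0)`. -/
def stair (c : Fin n) : ℕ := n - 1 - c

/-- The antisymmetrization of a polynomial. -/
noncomputable def alt (f : MvPolynomial (Fin n) ℤ) : MvPolynomial (Fin n) ℤ :=
  ∑ w : Equiv.Perm (Fin n), (Equiv.Perm.sign w : ℤ) • rename w f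

theorem alt_sum {ι : Type*} (s : Finset ι) (f : ι → MvPolynomial (Fin n) ℤ) :
    alt (∑ i ∈ s, f i) = ∑ i ∈ s, alt (f i) := by
  simp only [alt, map_sum, smul_sum]
  exact sum_comm

theorem alt_eq_zero {k k' : Fin n} (hk : k ≠ k') {f : MvPolynomial (Fin n) ℤ}
    (hf : rename (Equiv.swap k k') f = f) : alt f = 0 := by
  have h : alt f = -alt f := by
    conv_lhs => rw [alt, ← Equiv.sum_comp (Equiv.mulRight (Equiv.swap k k'))]
    rw [alt, ← sum_neg_distrib]
    refine sum_congr rfl fun w _ => ?_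
    rw [Equiv.coe_mulRight, Equiv.Perm.sign_mul, Equiv.Perm.sign_swap hk, Equiv.Perm.coe_mul,
      ← rename_rename, hf]
    simp
  exact self_eq_neg.mp h

theorem rename_monomial_expo (w : Equiv.Perm (Fin n)) (a : Fin n → ℕ) :
    rename w (monomial (expo a) (1 : ℤ)) = monomial (expo (a ∘ w.symm)) 1 := by
  rw [rename_monomial]
  congr 2
  ext x
  rw [Finsupp.mapDomain_equiv_apply]
  rfl

theorem monomial_expo_mul_mono (a : Fin n → ℕ) (T : Finset (Fin n)) :
    monomial (expo a) (1 : ℤ) * mono T = monomial (expo (a + ind T)) 1 := by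
  have : mono T = monomial (expo (ind T)) (1 : ℤ) := by
    rw [monomial_eq, Finsupp.prod_fintype _ _ (fun i => by simp), C_1, one_mul, mono]
    simp only [expo, ind, Finsupp.equivFunOnFinite_symm_apply_apply]
    simp [pow_ite]
  rw [this, monomial_mul, one_mul]
  congr 2
  ext x
  rfl

theorem perm_eq_one_of_strictAnti {a b : Fin n → ℕ} (ha : StrictAnti a) (hb : StrictAnti b)
    (w : Equiv.Perm (Fin n)) (h : a ∘ w = b) : w = 1 := by
  have hw : StrictMono w := by
    intro x y hxy
    have := hb hxy
    rw [← h] at this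
    exact ha.lt_iff_gt.mp this
  ext x
  have := Subsingleton.elim (hw.orderIsoOfSurjective w w.surjective) (OrderIso.refl (Fin n))
  exact congrArg Fin.val (DFunLike.congr_fun this x)

theorem strictAnti_add_stair {a : Fin n → ℕ} (ha : Antitone a) : StrictAnti (a + stair) := by
  intro x y hxy
  have h1 := ha hxy.le
  have h2 : x.val < y.val := hxy
  have := y.isLt
  simp only [Pi.add_apply, stair]
  omega

theorem coeff_alt_monomial {a b : Fin n → ℕ} (ha : Antitone a) (hb : Antitone b) :
    coeff (expo (b + stair)) (alt (monomial (expo (a + stair)) (1 : ℤ))) =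
      if a = b then 1 else 0 := by
  simp only [alt, coeff_sum, rename_monomial_expo, coeff_smul, coeff_monomial]
  rw [sum_eq_single (1 : Equiv.Perm (Fin n))]
  · have h : (a + stair) ∘ (Equiv.symm (1 : Equiv.Perm (Fin n))) = a + stair := rfl
    simp [expo_injective.eq_iff, h]
  · intro w _ hw
    rw [if_neg, smul_zero]
    intro h
    have := perm_eq_one_of_strictAnti (strictAnti_add_stair ha) (strictAnti_add_stair hb) w.symm
      (expo_injective h)
    exact hw (by rw [← Equiv.symm_symm w, this]; rfl)
  · simp

theorem exists_descent {a : Fin n → ℕ} (h : ¬ Antitone a) :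
    ∃ k k' : Fin n, k'.val = k.val + 1 ∧ a k < a k' := by
  by_contra hcon
  push Not at hcon
  apply h
  intro x y hxy
  obtain ⟨y, hy⟩ := y
  have hxy' : x.val ≤ y := hxy
  induction y with
  | zero => exact le_of_eq (congrArg a (Fin.ext (by simp at hxy' ⊢; omega)))
  | succ y ih =>
    rcases hxy'.lt_or_eq with h1 | h1
    · exact (hcon ⟨y, by omega⟩ ⟨y + 1, hy⟩ rfl).trans (ih (by omega) (Fin.mk_le_mk.mpr (by omega)) (by omega))
    · exact le_of_eq (congrArg a (Fin.ext h1.symm))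

theorem alt_eq_zero_of_not_antitone {a : Fin n → ℕ} (ha : Antitone a) {T : Finset (Fin n)}
    (hT : ¬ Antitone (a + ind T)) (L : List (ℕ × ℕ)) :
    alt (monomial (expo (a + stair + ind T)) (1 : ℤ) * gen L T) = 0 := by
  obtain ⟨k, k', hk, hlt⟩ := exists_descent hT
  have hkk : k ≠ k' := fun h => by rw [h] at hk; omega
  have h1 : a k' ≤ a k := ha (Fin.le_def.mpr (by omega))
  have h2 : k ∉ T := by
    intro h
    simp only [Pi.add_apply, ind, h, if_true] at hlt
    split_ifs at hlt <;> omega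
  have h3 : k' ∈ T := by
    by_contra h
    simp only [Pi.add_apply, ind, h, h2, if_false] at hlt
    omega
  refine alt_eq_zero hkk ?_
  rw [map_mul, (gen_swap hk L).1 T (by simp [h2]), rename_monomial_expo]
  congr 4
  funext x
  simp only [Function.comp, Equiv.symm_swap, Pi.add_apply, ind, h2, h3, if_true, if_false] at hlt ⊢
  have hk2 := k'.isLt
  by_cases e1 : x = k
  · subst e1
    rw [Equiv.swap_apply_left]
    simp only [stair, h2, h3, if_true, if_false]
    omega
  by_cases e2 : x = k'
  · subst e2
    rw [Equiv.swap_apply_right]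
    simp only [stair, h2, h3, if_true, if_false]
    omega
  rw [Equiv.swap_apply_of_ne_of_ne e1 e2]

theorem run_cons {R : Type*} [AddCommMonoid R] (p : ℕ × ℕ) (L : List (ℕ × ℕ))
    (S : Finset (Fin n)) (a : Fin n → ℕ) (F : Finset (Fin n) → (Fin n → ℕ) → R) [DecidablePred
      fun T : Finset (Fin n) => T.card = p.1 ∧ Compat p.2 S T ∧ Antitone (a + ind T)] :
    run (p :: L) S a F =
      ∑ T : Finset (Fin n) with T.card = p.1 ∧ Compat p.2 S T ∧ Antitone (a + ind T),
        run L T (a + ind T) F := by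
  rw [run]
  congr!

theorem alt_mul_gen (L : List (ℕ × ℕ)) (S : Finset (Fin n)) {a : Fin n → ℕ} (ha : Antitone a) :
    alt (monomial (expo (a + stair)) (1 : ℤ) * gen L S) =
      run L S a fun _ t => alt (monomial (expo (t + stair)) (1 : ℤ)) := by
  classical
  induction L generalizing S a with
  | nil => simp [gen, run]
  | cons p L ih =>
    rw [gen_cons, run_cons, mul_sum, alt_sum]
    rw [← sum_filter_of_ne (p := fun T => Antitone (a + ind T)), filter_filter]
    · refine sum_congr ?_ fun T hT => ?_
      · ext T; simp [and_assoc]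
      · simp only [mem_filter] at hT
        rw [← ih T hT.2.2.2, ← mul_assoc, monomial_expo_mul_mono, add_right_comm]
    · intro T _ hne
      by_contra hcon
      rw [← mul_assoc, monomial_expo_mul_mono] at hne
      exact hne (alt_eq_zero_of_not_antitone ha hcon L)

end Alternant

section Run

variable {n : ℕ} {R : Type*} [AddCommMonoid R]

theorem run_congr {L : List (ℕ × ℕ)} {S : Finset (Fin n)} {a : Fin n → ℕ} (ha : Antitone a)
    {F G : Finset (Fin n) → (Fin n → ℕ) → R} (h : ∀ S t, Antitone t → F S t = G S t) :
    run L S a F = run L S a G := by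
  classical
  induction L generalizing S a with
  | nil => exact h S a ha
  | cons p L ih =>
    rw [run_cons, run_cons]
    exact sum_congr rfl fun T hT => ih (mem_filter.mp hT).2.2.2

theorem map_run {R' : Type*} [AddCommMonoid R'] (φ : R →+ R') (L : List (ℕ × ℕ))
    (S : Finset (Fin n)) (a : Fin n → ℕ) (F : Finset (Fin n) → (Fin n → ℕ) → R) :
    φ (run L S a F) = run L S a fun S t => φ (F S t) := by
  classical
  induction L generalizing S a with
  | nil => rfl
  | cons p L ih =>
    rw [run_cons, run_cons, map_sum]
    exact sum_congr rfl fun T _ => ih _ _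

theorem run_append (L₁ L₂ : List (ℕ × ℕ)) (S : Finset (Fin n)) (a : Fin n → ℕ)
    (F : Finset (Fin n) → (Fin n → ℕ) → R) :
    run (L₁ ++ L₂) S a F = run L₁ S a fun S t => run L₂ S t F := by
  classical
  induction L₁ generalizing S a with
  | nil => rfl
  | cons p L ih =>
    rw [List.cons_append, run_cons, run_cons]
    exact sum_congr rfl fun T _ => ih _ _

theorem run_mono {L : List (ℕ × ℕ)} {S : Finset (Fin n)} {a : Fin n → ℕ} (ha : Antitone a)
    {F G : Finset (Fin n) → (Fin n → ℕ) → ℕ} (h : ∀ S t, Antitone t → F S t ≤ G S t) :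
    run L S a F ≤ run L S a G := by
  classical
  induction L generalizing S a with
  | nil => exact h S a ha
  | cons p L ih =>
    rw [run_cons, run_cons]
    exact sum_le_sum fun T hT => ih (mem_filter.mp hT).2.2.2

/-- The first column of the list puts no condition on the preceding column. -/
def Free : List (ℕ × ℕ) → Prop
  | [] => True
  | p :: _ => p.1 ≤ p.2

theorem compat_of_card_le {d : ℕ} {S T : Finset (Fin n)} (h : T.card ≤ d) : Compat d S T :=
  fun b => ((upCard_le_card T b).trans h).trans (Nat.le_add_left _ _)

theorem Free.run_cons_eq {p : ℕ × ℕ} {L : List (ℕ × ℕ)} (h : Free (p :: L)) (S S' : Finset (Fin n))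
    (a : Fin n → ℕ) (F : Finset (Fin n) → (Fin n → ℕ) → R) :
    run (p :: L) S a F = run (p :: L) S' a F := by
  classical
  rw [run_cons, run_cons]
  refine sum_congr (filter_congr fun T _ => and_congr_right fun hT => and_congr_left fun _ => ?_)
    fun _ _ => rfl
  have h' : T.card ≤ p.2 := hT.trans_le h
  exact iff_of_true (compat_of_card_le h') (compat_of_card_le h')

theorem Free.gen_eq {L : List (ℕ × ℕ)} (h : Free L) (S S' : Finset (Fin n)) :
    gen L S = gen L S' := by
  classical
  cases L with
  | nil => rfl
  | cons p L =>
    rw [gen_cons, gen_cons]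
    refine sum_congr (filter_congr fun T _ => and_congr_right fun hT => ?_) fun _ _ => rfl
    have h' : T.card ≤ p.2 := hT.trans_le h
    exact iff_of_true (compat_of_card_le h') (compat_of_card_le h')

theorem Free.gen_append {L₂ : List (ℕ × ℕ)} (h : Free L₂) (L₁ : List (ℕ × ℕ))
    (S : Finset (Fin n)) : gen (L₁ ++ L₂) S = gen L₁ S * gen L₂ ∅ := by
  classical
  induction L₁ generalizing S with
  | nil => simp only [List.nil_append, gen, one_mul]; exact h.gen_eq _ _
  | cons p L ih =>
    rw [List.cons_append, gen_cons, gen_cons, sum_mul]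
    exact sum_congr rfl fun T _ => by rw [ih, mul_assoc]

open Classical in
/-- The number of dominant column words from weight `a` to weight `b`. -/
noncomputable def cnt (L : List (ℕ × ℕ)) (S : Finset (Fin n)) (a b : Fin n → ℕ) : ℕ :=
  run L S a fun _ t => if t = b then 1 else 0

theorem cnt_eq_coeff (L : List (ℕ × ℕ)) (S : Finset (Fin n)) {a b : Fin n → ℕ} (ha : Antitone a)
    (hb : Antitone b) : (cnt L S a b : ℤ) =
      coeff (expo (b + stair)) (alt (monomial (expo (a + stair)) (1 : ℤ) * gen L S)) := by
  rw [alt_mul_gen L S ha, cnt, ← Nat.coe_castAddMonoidHom, map_run]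
  rw [← lcoeff_apply (R := ℤ), ← LinearMap.toAddMonoidHom_coe, map_run]
  refine run_congr ha fun _ t ht => ?_
  rw [LinearMap.toAddMonoidHom_coe, lcoeff_apply, coeff_alt_monomial ht hb]
  split_ifs <;> rfl

theorem cnt_append_comm {L₁ L₂ : List (ℕ × ℕ)} (h₁ : Free L₁) (h₂ : Free L₂)
    {a b : Fin n → ℕ} (ha : Antitone a) (hb : Antitone b) :
    cnt (L₁ ++ L₂) ∅ a b = cnt (L₂ ++ L₁) ∅ a b := by
  rw [← Int.natCast_inj (m := cnt (L₁ ++ L₂) ∅ a b), cnt_eq_coeff _ _ ha hb, cnt_eq_coeff _ _ ha hb,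
    h₂.gen_append, h₁.gen_append, mul_comm (gen L₁ ∅)]

theorem cnt_append (L₁ L₂ : List (ℕ × ℕ)) (S : Finset (Fin n)) (a b : Fin n → ℕ) :
    cnt (L₁ ++ L₂) S a b = run L₁ S a fun S t => cnt L₂ S t b :=
  run_append _ _ _ _ _

end Run

end ColumnWord

namespace ColumnWord

open Finset

/-- The list `[f (K-1), …, f 1, f 0]`. -/
def cols {β : Type*} (f : ℕ → β) : ℕ → List β
  | 0 => []
  | K + 1 => f K :: cols f K

theorem cols_add {β : Type*} (f : ℕ → β) (K J : ℕ) :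
    cols f (K + J) = cols (fun j => f (K + j)) J ++ cols f K := by
  induction J with
  | zero => rfl
  | succ J ih => rw [← add_assoc, cols, cols, ih]; rfl

theorem cols_congr {β : Type*} {f g : ℕ → β} {K : ℕ} (h : ∀ j < K, f j = g j) :
    cols f K = cols g K := by
  induction K with
  | zero => rfl
  | succ K ih => rw [cols, cols, h K (by omega), ih fun j hj => h j (by omega)]

section Straight

variable {n : ℕ}

/-- The `j`-th column of the Young diagram with rows `t`. -/
def below (t : Fin n → ℕ) (j : ℕ) : Finset (Fin n) := univ.filter fun c => j < t c

theorem mem_below {t : Fin n → ℕ} {j : ℕ} {c : Fin n} : c ∈ below t j ↔ j < t c := by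
  simp [below]

/-- The column specification of a straight shape. -/
def straight (t : Fin n → ℕ) (j : ℕ) : ℕ × ℕ :=
  ((below t j).card, (below t j).card - (below t (j + 1)).card)

theorem isLowerSet_below {t : Fin n → ℕ} (ht : Antitone t) (j : ℕ) :
    IsLowerSet (below t j : Set (Fin n)) := by
  intro x y hxy hx
  simp only [mem_coe, mem_below] at hx ⊢
  exact hx.trans_le (ht hxy)

theorem eq_of_isLowerSet {S T : Finset (Fin n)} (hS : IsLowerSet (S : Set (Fin n)))
    (hT : IsLowerSet (T : Set (Fin n))) (h : S.card = T.card) : S = T := by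
  rcases hS.total hT with h1 | h1
  · exact eq_of_subset_of_card_le (coe_subset.mp h1) h.ge
  · exact (eq_of_subset_of_card_le (coe_subset.mp h1) h.le).symm

theorem mem_iff_of_isLowerSet {S : Finset (Fin n)} (hS : IsLowerSet (S : Set (Fin n)))
    (x : Fin n) : x ∈ S ↔ x.val < S.card := by
  have hle : S.card ≤ n := (card_le_univ S).trans (Fintype.card_fin n).le
  have hL : IsLowerSet ((univ.filter fun y : Fin n => y.val < S.card : Finset (Fin n)) :
      Set (Fin n)) := by
    intro a b hab ha
    simp only [coe_filter, mem_univ, true_and, Set.mem_ofPred_eq] at ha ⊢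
    exact lt_of_le_of_lt hab ha
  have := eq_of_isLowerSet hS hL (by rw [Fin.card_filter_val_lt]; omega)
  conv_lhs => rw [this]
  simp

theorem upCard_add_filter_lt (T : Finset (Fin n)) (b : ℕ) :
    upCard T b + (T.filter fun x => x.val < b).card = T.card := by
  unfold upCard
  rw [← card_filter_add_card_filter_not (s := T) fun x => b ≤ x.val]
  simp

theorem below_mono (t : Fin n → ℕ) {j k : ℕ} (h : j ≤ k) : below t k ⊆ below t j :=
  fun _ hx => mem_below.mpr (lt_of_le_of_lt h (mem_below.mp hx))

theorem compat_below (t : Fin n → ℕ) (j : ℕ) :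
    Compat ((below t j).card - (below t (j + 1)).card) (below t (j + 1)) (below t j) := by
  intro b
  have h1 := upCard_add_filter_lt (below t j) b
  have h2 := upCard_add_filter_lt (below t (j + 1)) b
  have h3 := card_le_card (filter_subset_filter (fun x : Fin n => x.val < b)
    (below_mono t (Nat.le_succ j)))
  have h4 := card_le_card (below_mono t (Nat.le_succ j))
  rw [Nat.succ_eq_add_one] at *
  omega

theorem sub_add_ind_below (t : Fin n → ℕ) (j : ℕ) :
    (fun c => t c - (j + 1)) + ind (below t j) = fun c => t c - j := by
  funext c
  simp only [Pi.add_apply, ind, mem_below]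
  split_ifs <;> omega

theorem eq_below_of_compat {t : Fin n → ℕ} (ht : Antitone t) {j : ℕ} {T : Finset (Fin n)}
    (h1 : T.card = (below t j).card)
    (h2 : Compat ((below t j).card - (below t (j + 1)).card) (below t (j + 1)) T)
    (h3 : Antitone ((fun c => t c - (j + 1)) + ind T)) : T = below t j := by
  refine eq_of_isLowerSet ?_ (isLowerSet_below ht j) h1
  obtain ⟨S, hS⟩ : ∃ S, S = below t (j + 1) := ⟨_, rfl⟩
  have e4 : S.card ≤ (below t j).card := hS ▸ card_le_card (below_mono t (Nat.le_succ j))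
  have hmem := mem_iff_of_isLowerSet (isLowerSet_below ht (j + 1))
  rw [← hS] at hmem h2
  have hST : S ⊆ T := by
    have e1 := upCard_add_filter_lt T S.card
    have e2 := h2 S.card
    have e3 : upCard S S.card = 0 := by
      rw [upCard, card_eq_zero, filter_eq_empty_iff]
      intro x hx
      have := (hmem x).mp hx
      omega
    have sub : (T.filter fun x => x.val < S.card) ⊆ S := by
      intro x hx
      exact (hmem x).mpr (mem_filter.mp hx).2
    have := eq_of_subset_of_card_le sub (by omega)
    rw [← this]
    exact filter_subset _ _
  intro y x hxy hy
  rw [mem_coe] at hy ⊢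
  by_cases hx : x ∈ S
  · exact hST hx
  · rw [hS, mem_below] at hx
    have a1 := h3 hxy
    have a2 := ht hxy
    simp only [Pi.add_apply, ind, hy, if_true] at a1
    by_contra hcon
    rw [if_neg hcon] at a1
    omega

theorem run_straight {R : Type*} [AddCommMonoid R] {t : Fin n → ℕ} (ht : Antitone t) (K : ℕ)
    (F : Finset (Fin n) → (Fin n → ℕ) → R) :
    run (cols (straight t) K) (below t K) (fun c => t c - K) F = F (below t 0) t := by
  classical
  induction K with
  | zero => rfl
  | succ K ih =>
    rw [cols, run_cons, sum_eq_single_of_mem (below t K), sub_add_ind_below, ih]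
    · rw [mem_filter, sub_add_ind_below]
      exact ⟨mem_univ _, rfl, compat_below t K, fun x y h => Nat.sub_le_sub_right (ht h) K⟩
    · intro T hT hne
      rw [mem_filter] at hT
      exact absurd (eq_below_of_compat ht hT.2.1 hT.2.2.1 hT.2.2.2) hne

theorem run_straight_zero {R : Type*} [AddCommMonoid R] {t : Fin n → ℕ} (ht : Antitone t) {K : ℕ}
    (hK : ∀ c, t c ≤ K) (F : Finset (Fin n) → (Fin n → ℕ) → R) :
    run (cols (straight t) K) ∅ 0 F = F (below t 0) t := by
  rw [← run_straight ht K F]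
  congr 1
  · symm
    rw [below, filter_eq_empty_iff]
    exact fun c _ => (hK c).not_gt
  · funext c
    exact (Nat.sub_eq_zero_of_le (hK c)).symm

theorem below_eq_empty {t : Fin n → ℕ} {j : ℕ} (h : ∀ c, t c ≤ j) : below t j = ∅ := by
  rw [below, filter_eq_empty_iff]
  exact fun c _ => (h c).not_gt

theorem free_straight {t : Fin n → ℕ} {K : ℕ} (hK : ∀ c, t c ≤ K) :
    Free (cols (straight t) K) := by
  cases K with
  | zero => trivial
  | succ K =>
    change (below t K).card ≤ _ - (below t (K + 1)).card
    rw [below_eq_empty hK]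
    simp

theorem exists_bound (t : Fin n → ℕ) : ∃ K, ∀ c, t c ≤ K :=
  ⟨univ.sup t, fun c => le_sup (mem_univ c)⟩

theorem cnt_free_eq {D : List (ℕ × ℕ)} (hD : Free D) (S S' : Finset (Fin n)) (a b : Fin n → ℕ) :
    cnt D S a b = cnt D S' a b := by
  cases D with
  | nil => rfl
  | cons p L => exact hD.run_cons_eq _ _ _ _

theorem run_congr_of_le {L : List (ℕ × ℕ)} : ∀ {S : Finset (Fin n)} {a : Fin n → ℕ}
    {F G : Finset (Fin n) → (Fin n → ℕ) → ℕ}, Antitone a →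
    (∀ S t, Antitone t → (∀ c, t c ≤ a c + L.length) → F S t = G S t) →
    run L S a F = run L S a G := by
  classical
  induction L with
  | nil => exact fun ha h => h _ _ ha fun c => le_rfl
  | cons p L ih =>
    intro S a F G ha h
    rw [run_cons, run_cons]
    refine sum_congr rfl fun T hT => ih (mem_filter.mp hT).2.2.2 fun S t ht hb => h S t ht ?_
    intro c
    have := hb c
    simp only [Pi.add_apply, ind, List.length_cons] at this ⊢
    split_ifs at this <;> omega

/-- Moving the starting weight past a free list of columns. -/
theorem cnt_eq_run_straight {D : List (ℕ × ℕ)} (hD : Free D) {a b : Fin n → ℕ} (ha : Antitone a)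
    (hb : Antitone b) :
    cnt D ∅ a b = run (n := n) D ∅ 0 fun _ t => cnt (cols (straight t) D.length) ∅ a b := by
  classical
  obtain ⟨K, hK⟩ := exists_bound a
  have h0 : Antitone (0 : Fin n → ℕ) := fun _ _ _ => le_rfl
  have e1 : cnt D ∅ a b = cnt (cols (straight a) K ++ D) ∅ 0 b := by
    rw [cnt_append, run_straight_zero ha hK]
    exact cnt_free_eq hD _ _ _ _
  rw [e1, cnt_append_comm (free_straight hK) hD h0 hb, cnt_append]
  refine run_congr_of_le h0 fun S t ht hbd => ?_
  have ht' : ∀ c, t c ≤ D.length := fun c => (hbd c).trans (by simp)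
  have e2 := cnt_append_comm (free_straight ht') (free_straight hK) h0 hb
  rw [cnt_append, cnt_append, run_straight_zero ht ht', run_straight_zero ha hK] at e2
  rw [cnt_free_eq (free_straight hK) S (below t 0), e2]
  exact cnt_free_eq (free_straight ht') _ _ _ _

end Straight

section Words

variable {n : ℕ}

/-- `T` is a dominant column word with column specification `f`, starting from the column `S`
and the weight `a` and ending at the weight `b`. Columns are indexed from left to right. -/
structure IsWord (f : ℕ → ℕ × ℕ) (K : ℕ) (S : Finset (Fin n)) (a b : Fin n → ℕ)
    (T : ℕ → Finset (Fin n)) : Prop where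
  outside : ∀ j, K ≤ j → T j = S
  card : ∀ j < K, (T j).card = (f j).1
  compat : ∀ j < K, Compat (f j).2 (T (j + 1)) (T j)
  dominant : ∀ j < K, Antitone (a + ∑ q ∈ Ico j K, ind (T q))
  total : a + ∑ q ∈ range K, ind (T q) = b

theorem isWord_zero {f : ℕ → ℕ × ℕ} {S : Finset (Fin n)} {a b : Fin n → ℕ}
    {T : ℕ → Finset (Fin n)} : IsWord f 0 S a b T ↔ T = (fun _ => S) ∧ a = b := by
  constructor
  · rintro ⟨h1, -, -, -, h5⟩
    exact ⟨funext fun j => h1 j (Nat.zero_le j), by simpa using h5⟩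
  · rintro ⟨rfl, rfl⟩
    exact ⟨fun _ _ => rfl, by simp, by simp, by simp, by simp⟩

theorem isWord_succ {f : ℕ → ℕ × ℕ} {K : ℕ} {S : Finset (Fin n)} {a b : Fin n → ℕ}
    {T : ℕ → Finset (Fin n)} : IsWord f (K + 1) S a b T ↔
      (∀ j, K + 1 ≤ j → T j = S) ∧ ((T K).card = (f K).1 ∧ Compat (f K).2 S (T K) ∧
        Antitone (a + ind (T K))) ∧
        IsWord f K (T K) (a + ind (T K)) b fun j => if j ≤ K then T j else T K := by
  have e1 : ∀ j ≤ K, ∑ q ∈ Ico j (K + 1), ind (T q) = ind (T K) + ∑ q ∈ Ico j K, ind (T q) := by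
    intro j hj
    rw [sum_Ico_succ_top hj, add_comm]
  have e2 : ∀ j ≤ K, ∑ q ∈ Ico j K, ind (if q ≤ K then T q else T K) =
      ∑ q ∈ Ico j K, ind (T q) := fun j _ =>
    sum_congr rfl fun q hq => by rw [if_pos (mem_Ico.mp hq).2.le]
  constructor
  · rintro ⟨h1, h2, h3, h4, h5⟩
    refine ⟨h1, ⟨h2 K (by omega), ?_, ?_⟩, ?_, ?_, ?_, ?_, ?_⟩
    · have := h3 K (by omega)
      rwa [h1 (K + 1) le_rfl] at this
    · have := h4 K (by omega)
      rwa [e1 K le_rfl, Ico_self, sum_empty, add_zero] at this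
    · intro j hj
      rcases hj.lt_or_eq with h | h
      · exact if_neg (by omega)
      · rw [h, ite_self]
    · intro j hj
      rw [if_pos hj.le]; exact h2 j (by omega)
    · intro j hj
      rw [if_pos hj.le, if_pos (by omega)]; exact h3 j (by omega)
    · intro j hj
      rw [e2 j hj.le, add_assoc, ← e1 j hj.le]
      exact h4 j (by omega)
    · rw [range_eq_Ico, e2 0 (Nat.zero_le _), add_assoc, ← e1 0 (Nat.zero_le _), ← range_eq_Ico]
      exact h5
  · rintro ⟨h1, ⟨g1, g2, g3⟩, -, h2, h3, h4, h5⟩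
    refine ⟨h1, ?_, ?_, ?_, ?_⟩
    · intro j hj
      rcases Nat.lt_succ_iff_lt_or_eq.mp hj with h | rfl
      · have := h2 j h
        rwa [if_pos h.le] at this
      · exact g1
    · intro j hj
      rcases Nat.lt_succ_iff_lt_or_eq.mp hj with h | rfl
      · have := h3 j h
        rwa [if_pos h.le, if_pos (by omega)] at this
      · rwa [h1 (j + 1) le_rfl]
    · intro j hj
      rcases Nat.lt_succ_iff_lt_or_eq.mp hj with h | rfl
      · have := h4 j h
        rwa [e2 j h.le, add_assoc, ← e1 j h.le] at this
      · rwa [e1 j le_rfl, Ico_self, sum_empty, add_zero]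
    · rw [range_eq_Ico, e2 0 (Nat.zero_le _), add_assoc, ← e1 0 (Nat.zero_le _),
        ← range_eq_Ico] at h5
      exact h5

/-- Splitting off the first column of a word. -/
def wordEquiv (f : ℕ → ℕ × ℕ) (K : ℕ) (S : Finset (Fin n)) (a b : Fin n → ℕ) :
    {T : ℕ → Finset (Fin n) // IsWord f (K + 1) S a b T} ≃
      Σ U : {U : Finset (Fin n) // U.card = (f K).1 ∧ Compat (f K).2 S U ∧ Antitone (a + ind U)},
        {T : ℕ → Finset (Fin n) // IsWord f K U.1 (a + ind U.1) b T} where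
  toFun T := ⟨⟨T.1 K, (isWord_succ.mp T.2).2.1⟩, ⟨_, (isWord_succ.mp T.2).2.2⟩⟩
  invFun x := ⟨fun j => if j ≤ K then x.2.1 j else S, by
    obtain ⟨⟨U, hU⟩, ⟨T, hT⟩⟩ := x
    have hK : T K = U := hT.outside K le_rfl
    rw [isWord_succ]
    simp only [le_refl, if_true, hK]
    refine ⟨fun j hj => if_neg (by omega), hU, ?_⟩
    convert hT using 1
    funext j
    split_ifs with h
    · rfl
    · exact (hT.outside j (by omega)).symm⟩
  left_inv T := by
    apply Subtype.ext
    funext j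
    dsimp only
    split_ifs with h
    · rfl
    · exact (T.2.outside j (by omega)).symm
  right_inv x := by
    obtain ⟨⟨U, hU⟩, ⟨T, hT⟩⟩ := x
    have hK : T K = U := hT.outside K le_rfl
    subst hK
    refine Sigma.ext (by simp) ?_
    refine (Subtype.heq_iff_coe_eq fun x => by simp).mpr ?_
    funext j
    simp only [le_refl, if_true]
    split_ifs with h
    · rfl
    · exact (hT.outside j (by omega)).symm

theorem finite_word (f : ℕ → ℕ × ℕ) (K : ℕ) (S : Finset (Fin n)) (a b : Fin n → ℕ) :
    Finite {T : ℕ → Finset (Fin n) // IsWord f K S a b T} := by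
  induction K generalizing S a with
  | zero =>
    refine Finite.of_injective (β := Unit) (fun _ => ()) ?_
    rintro ⟨T, hT⟩ ⟨T', hT'⟩ -
    rw [isWord_zero] at hT hT'
    exact Subtype.ext (hT.1.trans hT'.1.symm)
  | succ K ih =>
    have := fun U : Finset (Fin n) => ih U (a + ind U)
    exact Finite.of_equiv _ (wordEquiv f K S a b).symm

theorem cnt_eq_card (f : ℕ → ℕ × ℕ) (K : ℕ) (S : Finset (Fin n)) (a b : Fin n → ℕ) :
    cnt (cols f K) S a b = Nat.card {T : ℕ → Finset (Fin n) // IsWord f K S a b T} := by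
  classical
  induction K generalizing S a with
  | zero =>
    rw [cols, cnt, run]
    split_ifs with h
    · symm
      rw [Nat.card_eq_one_iff_unique]
      refine ⟨⟨?_⟩, ⟨fun _ => S, isWord_zero.mpr ⟨rfl, h⟩⟩⟩
      rintro ⟨T, hT⟩ ⟨T', hT'⟩
      rw [isWord_zero] at hT hT'
      exact Subtype.ext (hT.1.trans hT'.1.symm)
    · symm
      rw [Nat.card_eq_zero]
      left
      exact ⟨fun T => h (isWord_zero.mp T.2).2⟩
  | succ K ih =>
    have := fun U : Finset (Fin n) => finite_word f K U (a + ind U) b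
    rw [Nat.card_congr (wordEquiv f K S a b), Nat.card_sigma, cols, cnt, run_cons]
    rw [sum_subtype (p := fun U : Finset (Fin n) => U.card = (f K).1 ∧ Compat (f K).2 S U ∧
      Antitone (a + ind U)) _ fun U => by simp]
    exact sum_congr rfl fun U _ => ih _ _

end Words

section Transpose

variable {n : ℕ}

/-- Transposition of an `n × n` incidence matrix whose columns are indexed in reverse. -/
def flip (T : ℕ → Finset (Fin n)) (c' : ℕ) : Finset (Fin n) :=
  if h : c' < n then univ.filter fun j : Fin n => (⟨n - 1 - c', by omega⟩ : Fin n) ∈ T j else ∅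

/-- The reverse of `flip`. -/
def unflip (T : ℕ → Finset (Fin n)) (j : ℕ) : Finset (Fin n) :=
  if h : j < n then univ.filter fun c : Fin n => (⟨j, h⟩ : Fin n) ∈ T (n - 1 - c) else ∅

theorem mem_flip {T : ℕ → Finset (Fin n)} {j c : Fin n} :
    j ∈ flip T (n - 1 - c) ↔ c ∈ T j := by
  have h1 : n - 1 - c.val < n := by omega
  have h2 : (⟨n - 1 - (n - 1 - c.val), by omega⟩ : Fin n) = c := Fin.ext (by simp; omega)
  rw [flip, dif_pos h1, mem_filter]
  simp [h2]

theorem flip_unflip {T : ℕ → Finset (Fin n)} (hT : ∀ c', n ≤ c' → T c' = ∅) :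
    flip (unflip T) = T := by
  funext c'
  by_cases h : c' < n
  · ext j
    obtain ⟨c, rfl⟩ : ∃ c : Fin n, c' = n - 1 - c.val := ⟨⟨n - 1 - c', by omega⟩, by simp; omega⟩
    rw [mem_flip, unflip, dif_pos j.isLt]
    simp
  · rw [flip, dif_neg h, hT c' (by omega)]

theorem unflip_flip {T : ℕ → Finset (Fin n)} (hT : ∀ c', n ≤ c' → T c' = ∅) :
    unflip (flip T) = T := by
  funext j
  by_cases h : j < n
  · ext c
    rw [unflip, dif_pos h]
    simp [mem_flip]
  · rw [unflip, dif_neg h, hT j (by omega)]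

theorem ind_sum_eq_card (T : ℕ → Finset (Fin n)) (s : Finset ℕ) (c : Fin n) :
    (∑ q ∈ s, ind (T q)) c = (s.filter fun q => c ∈ T q).card := by
  rw [Finset.sum_apply, card_filter]
  rfl

theorem upCard_flip (T : ℕ → Finset (Fin n)) (c : Fin n) (b : ℕ) :
    upCard (flip T (n - 1 - c)) b = (∑ q ∈ Ico b n, ind (T q)) c := by
  rw [ind_sum_eq_card, upCard]
  refine card_bij (fun j _ => j.val) ?_ ?_ ?_
  · intro j hj
    rw [mem_filter, mem_flip] at hj
    rw [mem_filter, mem_Ico]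
    exact ⟨⟨hj.2, j.isLt⟩, hj.1⟩
  · exact fun j _ k _ h => Fin.ext h
  · intro q hq
    rw [mem_filter, mem_Ico] at hq
    exact ⟨⟨q, hq.1.2⟩, by rw [mem_filter, mem_flip]; exact ⟨hq.2, hq.1.1⟩, rfl⟩

theorem sum_ind_flip (T : ℕ → Finset (Fin n)) (j : Fin n) (b : ℕ) :
    (∑ q ∈ Ico b n, ind (flip T q)) j + upCard (T j) (n - b) = (T j).card := by
  rw [← upCard_add_filter_lt (T j) (n - b), add_comm, ind_sum_eq_card]
  congr 1
  symm
  refine card_bij (fun c _ => n - 1 - c.val) ?_ ?_ ?_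
  · intro c hc
    rw [mem_filter] at hc
    rw [mem_filter, mem_Ico, mem_flip]
    exact ⟨⟨by omega, by omega⟩, hc.1⟩
  · intro c _ c' _ h
    exact Fin.ext (by omega)
  · intro q hq
    rw [mem_filter, mem_Ico] at hq
    refine ⟨⟨n - 1 - q, by omega⟩, ?_, by simp; omega⟩
    rw [mem_filter]
    refine ⟨?_, by simp; omega⟩
    rw [← mem_flip]
    convert hq.2
    simp
    omega

/-- The conjugate of a weight with `n` rows of length at most `n`. -/
def conj (t : Fin n → ℕ) (j : Fin n) : ℕ := (below t j).card

/-- The column specification, from right to left, of the skew shape with column lengths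
`κ c - η c` and whose columns begin at heights `η c`. -/
def spec (κ η : Fin n → ℕ) (c' : ℕ) : ℕ × ℕ :=
  if h : c' < n then
    (κ ⟨n - 1 - c', by omega⟩ - η ⟨n - 1 - c', by omega⟩,
      if n - 1 - c' = 0 then κ ⟨n - 1 - c', by omega⟩
      else η ⟨n - 1 - c' - 1, by omega⟩ - η ⟨n - 1 - c', by omega⟩)
  else (0, 0)

theorem spec_fst (κ η : Fin n → ℕ) (c : Fin n) : (spec κ η (n - 1 - c)).1 = κ c - η c := by
  have h1 : n - 1 - c.val < n := by omega
  have h2 : n - 1 - (n - 1 - c.val) = c := by omega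
  rw [spec, dif_pos h1]
  simp only [h2]

theorem spec_snd_zero (κ η : Fin n → ℕ) (c : Fin n) (hc : c.val = 0) :
    (spec κ η (n - 1 - c)).2 = κ c := by
  have h1 : n - 1 - c.val < n := by omega
  have h2 : n - 1 - (n - 1 - c.val) = c := by omega
  rw [spec, dif_pos h1]
  simp only [h2]
  rw [if_pos hc]

theorem spec_snd_succ (κ η : Fin n → ℕ) {c₀ c : Fin n} (hc : c.val = c₀.val + 1) :
    (spec κ η (n - 1 - c)).2 = η c₀ - η c := by
  have h1 : n - 1 - c.val < n := by omega
  have h2 : n - 1 - (n - 1 - c.val) = c := by omega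
  have h3 : c.val - 1 = c₀ := by omega
  rw [spec, dif_pos h1]
  simp only [h2, h3]
  rw [if_neg (by omega)]

theorem free_spec (κ η : Fin n → ℕ) : Free (cols (spec κ η) n) := by
  cases n with
  | zero => trivial
  | succ n =>
    change (spec κ η n).1 ≤ (spec κ η n).2
    have h := spec_snd_zero κ η 0 rfl
    have h' := spec_fst κ η 0
    simp only [Fin.val_zero, Nat.sub_zero, Nat.add_sub_cancel] at h h'
    rw [h, h']
    exact Nat.sub_le _ _

theorem antitone_of_succ {a : Fin n → ℕ} (h : ∀ k k' : Fin n, k'.val = k.val + 1 → a k' ≤ a k) :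
    Antitone a := by
  by_contra hcon
  obtain ⟨k, k', hk, hlt⟩ := exists_descent hcon
  exact hlt.not_ge (h k k' hk)

theorem isWord_flip {t κ θ : Fin n → ℕ} (hθ : Antitone θ) (hle : θ ≤ κ)
    (ht : ∀ c, t c ≤ n) {T : ℕ → Finset (Fin n)} (hT : ∀ j, n ≤ j → T j = ∅) :
    IsWord (straight t) n ∅ θ κ T ↔ IsWord (spec κ θ) n ∅ 0 (conj t) (flip T) := by
  have hout : ∀ c', n ≤ c' → flip T c' = ∅ := fun c' h => by rw [flip, dif_neg (by omega)]
  have hbn : below t n = ∅ := below_eq_empty ht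
  -- both kinds of words are described by the same two families of conditions
  have hrow : ∀ c : Fin n, (flip T (n - 1 - c)).card = (∑ q ∈ range n, ind (T q)) c := by
    intro c
    rw [← upCard_zero, upCard_flip, range_eq_Ico]
  have hcol : ∀ j : Fin n, (∑ q ∈ range n, ind (flip T q)) j = (T j).card := by
    intro j
    have := sum_ind_flip T j 0
    rw [← range_eq_Ico] at this
    rw [← this, left_eq_add, upCard, card_eq_zero, filter_eq_empty_iff]
    intro x _
    omega
  have hcards : (∀ j < n, (T j).card = (straight t j).1) ↔
      (0 + ∑ q ∈ range n, ind (flip T q) = conj t) := by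
    rw [zero_add, funext_iff]
    refine ⟨fun h j => (hcol j).trans (h j j.isLt), fun h j hj => ?_⟩
    rw [← hcol ⟨j, hj⟩, h ⟨j, hj⟩]
    rfl
  have htot : (∀ c' < n, (flip T c').card = (spec κ θ c').1) ↔
      θ + ∑ q ∈ range n, ind (T q) = κ := by
    rw [funext_iff]
    constructor
    · intro h c
      have h1 := h (n - 1 - c) (by omega)
      rw [hrow, spec_fst] at h1
      have : θ c ≤ κ c := hle c
      rw [Pi.add_apply, h1]
      omega
    · intro h c' hc'
      obtain ⟨c, rfl⟩ : ∃ c : Fin n, c' = n - 1 - c.val :=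
        ⟨⟨n - 1 - c', by omega⟩, by simp; omega⟩
      have := h c
      rw [hrow, spec_fst, ← this, Pi.add_apply, Nat.add_sub_cancel_left]
  have hdom : (∀ c' < n, (flip T c').card = (spec κ θ c').1) →
      ((∀ c' < n, Compat (spec κ θ c').2 (flip T (c' + 1)) (flip T c')) ↔
      ∀ j < n, Antitone (θ + ∑ q ∈ Ico j n, ind (T q))) := by
    intro hc
    constructor
    · intro h j hj
      refine antitone_of_succ fun k k' hk => ?_
      have h1 := h (n - 1 - k') (by omega) j
      have e : n - 1 - k'.val + 1 = n - 1 - k.val := by omega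
      rw [e, upCard_flip, upCard_flip, spec_snd_succ κ θ hk] at h1
      have := hθ (show k ≤ k' from Fin.le_def.mpr (by omega))
      simp only [Pi.add_apply]
      omega
    · intro h c' hc' b
      obtain ⟨c, rfl⟩ : ∃ c : Fin n, c' = n - 1 - c.val :=
        ⟨⟨n - 1 - c', by omega⟩, by simp; omega⟩
      rcases Nat.eq_zero_or_pos c.val with h0 | h0
      · refine compat_of_card_le ?_ b
        rw [hc _ hc', spec_fst, spec_snd_zero κ θ c h0]
        exact Nat.sub_le _ _
      · obtain ⟨k, hk⟩ : ∃ k : Fin n, c.val = k.val + 1 :=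
          ⟨⟨c.val - 1, by omega⟩, by simp; omega⟩
        have e : n - 1 - c.val + 1 = n - 1 - k.val := by omega
        rw [e, upCard_flip, upCard_flip, spec_snd_succ κ θ hk]
        by_cases hb : b < n
        · have h1 := h b hb (show k ≤ c from Fin.le_def.mpr (by omega))
          simp only [Pi.add_apply] at h1
          omega
        · rw [Ico_eq_empty (by omega)]
          simp
  have hcompat : (∀ j < n, (T j).card = (straight t j).1) →
      ((∀ j < n, Compat (straight t j).2 (T (j + 1)) (T j)) ↔
      ∀ c' < n, Antitone (0 + ∑ q ∈ Ico c' n, ind (flip T q))) := by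
    intro hc
    constructor
    · intro h c' hc'
      refine antitone_of_succ fun k k' hk => ?_
      have h1 := h k k.isLt (n - c')
      have e1 := sum_ind_flip T k c'
      have e2 := sum_ind_flip T k' c'
      rw [hc _ k.isLt] at e1
      rw [hc _ k'.isLt] at e2
      rw [← hk] at h1
      simp only [straight, hk] at h1 e1 e2 ⊢
      rw [zero_add]
      have := card_le_card (below_mono t (Nat.le_succ k.val))
      rw [Nat.succ_eq_add_one] at this
      omega
    · intro h j hj b
      rcases Nat.lt_or_ge (j + 1) n with h1 | h1
      · rcases Nat.eq_zero_or_pos b with rfl | hb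
        · rw [upCard_zero, upCard_zero, hc j hj, hc _ h1]
          simp only [straight]
          omega
        · rcases Nat.lt_or_ge n b with hbn | hbn
          · have : upCard (T j) b = 0 := by
              rw [upCard, card_eq_zero, filter_eq_empty_iff]
              intro x _
              omega
            omega
          · have h2 := h (n - b) (by omega)
              (show (⟨j, hj⟩ : Fin n) ≤ ⟨j + 1, h1⟩ from Fin.le_def.mpr (by simp))
            have e1 := sum_ind_flip T ⟨j, hj⟩ (n - b)
            have e2 := sum_ind_flip T ⟨j + 1, h1⟩ (n - b)
            rw [show n - (n - b) = b by omega] at e1 e2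
            rw [zero_add] at h2
            simp only [hc j hj, hc _ h1] at e1 e2
            simp only [straight] at e1 e2 ⊢
            omega
      · refine compat_of_card_le ?_ b
        rw [hc j hj]
        simp only [straight]
        rw [show j + 1 = n by omega, hbn, card_empty, Nat.sub_zero]
  constructor
  · rintro ⟨-, h2, h3, h4, h5⟩
    have h5' := htot.mpr h5
    exact ⟨hout, h5', (hdom h5').mpr h4, (hcompat h2).mp h3, hcards.mp h2⟩
  · rintro ⟨-, h2, h3, h4, h5⟩
    have h5' := hcards.mpr h5
    exact ⟨hT, h5', (hcompat h5').mpr h4, (hdom h2).mp h3, htot.mp h2⟩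

theorem cnt_straight_eq {t κ θ : Fin n → ℕ} (hθ : Antitone θ) (hle : θ ≤ κ)
    (ht : ∀ c, t c ≤ n) :
    cnt (cols (straight t) n) ∅ θ κ = cnt (cols (spec κ θ) n) ∅ 0 (conj t) := by
  rw [cnt_eq_card, cnt_eq_card]
  exact Nat.card_congr
    { toFun := fun T => ⟨flip T.1, (isWord_flip hθ hle ht T.2.outside).mp T.2⟩
      invFun := fun T => ⟨unflip T.1, (isWord_flip hθ hle ht fun j hj => by
        rw [unflip, dif_neg (by omega)]).mpr (by rw [flip_unflip T.2.outside]; exact T.2)⟩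
      left_inv := fun T => Subtype.ext (unflip_flip T.2.outside)
      right_inv := fun T => Subtype.ext (flip_unflip T.2.outside) }

theorem cnt_eq_zero_of_not_le {f : ℕ → ℕ × ℕ} {K : ℕ} {S : Finset (Fin n)} {a b : Fin n → ℕ}
    (h : ¬ a ≤ b) : cnt (cols f K) S a b = 0 := by
  rw [cnt_eq_card, Nat.card_eq_zero]
  exact Or.inl ⟨fun T => h (T.2.total ▸ fun c => Nat.le_add_right _ _)⟩

theorem length_cols {β : Type*} (f : ℕ → β) (K : ℕ) : (cols f K).length = K := by
  induction K with
  | zero => rfl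
  | succ K ih => rw [cols, List.length_cons, ih]

/-- The number of pairs of words with conjugate weights. -/
noncomputable def pairs (κ η θ : Fin n → ℕ) : ℕ :=
  run (n := n) (cols (spec κ η) n) ∅ 0 fun _ t => cnt (n := n) (cols (spec κ θ) n) ∅ 0 (conj t)

theorem cnt_spec_eq_pairs {κ η θ : Fin n → ℕ} (hκ : Antitone κ) (hθ : Antitone θ) (hle : θ ≤ κ) :
    cnt (cols (spec κ η) n) ∅ θ κ = pairs κ η θ := by
  rw [cnt_eq_run_straight (free_spec κ η) hθ hκ, length_cols, pairs]
  refine run_congr_of_le (fun _ _ _ => Nat.le_refl _) fun S t _ hb => cnt_straight_eq hθ hle fun c => ?_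
  simpa [length_cols] using hb c

end Transpose

section Conj

theorem lt_conjP_iff {f : ℕ → ℕ} (hf : IsPartition f) {r j : ℕ} : r < conjP f j ↔ j < f r := by
  have key : ∀ R, (∀ r, r < R ↔ j < f r) → conjP f j = R := by
    intro R hR
    rw [conjP, ← card_range R]
    exact Nat.subtype_card _ fun r => by rw [mem_range, hR]
  have hex : ∃ r, ¬ j < f r := by
    obtain ⟨N, hN⟩ := hf.2
    exact ⟨N, by omega⟩
  classical
  have hR : ∀ r, r < Nat.find hex ↔ j < f r := by
    intro r
    constructor
    · intro h
      exact not_not.mp (Nat.find_min hex h)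
    · intro h
      by_contra hcon
      have h1 := Nat.find_spec hex
      have h2 := hf.1 (not_lt.mp hcon)
      omega
  rw [key _ hR, hR]

theorem conjP_antitone {f : ℕ → ℕ} (hf : IsPartition f) : Antitone (conjP f) := by
  intro j k hjk
  by_contra h
  push Not at h
  have h1 := (lt_conjP_iff hf).mp h
  have h2 := (lt_conjP_iff hf (r := conjP f j) (j := j)).not.mp (lt_irrefl _)
  omega

theorem conjP_le_conjP {f g : ℕ → ℕ} (hf : IsPartition f) (hg : IsPartition g) (h : subP f g)
    (j : ℕ) : conjP f j ≤ conjP g j := by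
  by_contra hcon
  push Not at hcon
  have h1 := (lt_conjP_iff hf).mp hcon
  have h2 := (lt_conjP_iff hg (r := conjP g j) (j := j)).not.mp (lt_irrefl _)
  have := h (conjP g j)
  omega

theorem conjP_eq_of {f : ℕ → ℕ} (hf : IsPartition f) {j R : ℕ} (h : ∀ r, r < R ↔ j < f r) :
    conjP f j = R := by
  refine eq_of_forall_lt_iff fun r => ?_
  rw [lt_conjP_iff hf, h]

theorem conjP_eq_zero {f : ℕ → ℕ} (hf : IsPartition f) {j : ℕ} (h : f 0 ≤ j) : conjP f j = 0 := by
  by_contra hcon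
  have := (lt_conjP_iff hf).mp (Nat.pos_of_ne_zero hcon)
  omega

end Conj

section Filling

variable {lam alpha : ℕ → ℕ} {n : ℕ}

/-- A semistandard filling of a skew shape with entries at most `n`. -/
structure IsFilling (lam alpha : ℕ → ℕ) (n : ℕ) (e : ℕ → ℕ → ℕ) : Prop where
  zero_outside : ∀ r c, ¬ inShape lam alpha r c → e r c = 0
  one_le : ∀ r c, inShape lam alpha r c → 1 ≤ e r c
  le_top : ∀ r c, e r c ≤ n
  row_weak : ∀ r c₁ c₂, c₁ ≤ c₂ → inShape lam alpha r c₁ → inShape lam alpha r c₂ →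
    e r c₁ ≤ e r c₂
  col_strict : ∀ r₁ r₂ c, r₁ < r₂ → inShape lam alpha r₁ c → inShape lam alpha r₂ c →
    e r₁ c < e r₂ c

theorem inShape_iff (hl : IsPartition lam) (ha : IsPartition alpha) {r c : ℕ} :
    inShape lam alpha r c ↔ conjP alpha c ≤ r ∧ r < conjP lam c := by
  rw [inShape, lt_conjP_iff hl, ← not_lt (b := conjP alpha c), lt_conjP_iff ha, not_lt]

open Classical in
/-- The set of entries of a column of a filling, shifted down by one. -/
noncomputable def column (lam alpha : ℕ → ℕ) (n : ℕ) (e : ℕ → ℕ → ℕ) (j : ℕ) : Finset (Fin n) :=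
  univ.filter fun b => ∃ r, inShape lam alpha r j ∧ e r j = b + 1

theorem mem_column {e : ℕ → ℕ → ℕ} {j : ℕ} {b : Fin n} :
    b ∈ column lam alpha n e j ↔ ∃ r, inShape lam alpha r j ∧ e r j = b + 1 := by
  simp [column]

theorem IsFilling.col_inj {e : ℕ → ℕ → ℕ} (h : IsFilling lam alpha n e) {r r' c : ℕ}
    (h1 : inShape lam alpha r c) (h2 : inShape lam alpha r' c) (heq : e r c = e r' c) : r = r' := by
  rcases lt_trichotomy r r' with h3 | h3 | h3
  · have := h.col_strict r r' c h3 h1 h2; omega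
  · exact h3
  · have := h.col_strict r' r c h3 h2 h1; omega

theorem IsFilling.upCard_column {e : ℕ → ℕ → ℕ} (hl : IsPartition lam) (ha : IsPartition alpha)
    (h : IsFilling lam alpha n e) (j b : ℕ) : upCard (column lam alpha n e j) b =
      ((Ico (conjP alpha j) (conjP lam j)).filter fun r => b < e r j).card := by
  symm
  have hsh : ∀ r, r ∈ Ico (conjP alpha j) (conjP lam j) ↔ inShape lam alpha r j := fun r => by
    rw [mem_Ico, inShape_iff hl ha]
  rw [upCard]
  refine card_bij (fun r hr => ⟨e r j - 1, ?_⟩) ?_ ?_ ?_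
  · have h1 := h.one_le r j ((hsh r).mp (mem_filter.mp hr).1)
    have h2 := h.le_top r j
    omega
  · intro r hr
    rw [mem_filter, hsh] at hr
    have h1 := h.one_le r j hr.1
    rw [mem_filter, mem_column]
    exact ⟨⟨r, hr.1, by simp; omega⟩, by simp; omega⟩
  · intro r hr r' hr' heq
    rw [mem_filter, hsh] at hr hr'
    have h1 := h.one_le r j hr.1
    have h2 := h.one_le r' j hr'.1
    have := congrArg Fin.val heq
    simp only at this
    exact h.col_inj hr.1 hr'.1 (by omega)
  · intro x hx
    rw [mem_filter, mem_column] at hx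
    obtain ⟨⟨r, hr, hrx⟩, hb⟩ := hx
    exact ⟨r, by rw [mem_filter, hsh]; exact ⟨hr, by omega⟩, Fin.ext (by simp; omega)⟩

theorem IsFilling.lt_iff {e : ℕ → ℕ → ℕ} (hl : IsPartition lam) (ha : IsPartition alpha)
    (h : IsFilling lam alpha n e) {r j : ℕ} (hr : inShape lam alpha r j) (b : ℕ) :
    b < e r j ↔ conjP lam j ≤ r + upCard (column lam alpha n e j) b := by
  have hsh : ∀ r, inShape lam alpha r j ↔ conjP alpha j ≤ r ∧ r < conjP lam j :=
    fun r => inShape_iff hl ha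
  have hr' := (hsh r).mp hr
  rw [h.upCard_column hl ha]
  constructor
  · intro hb
    have : Ico r (conjP lam j) ⊆
        (Ico (conjP alpha j) (conjP lam j)).filter fun r => b < e r j := by
      intro r' h'
      rw [mem_Ico] at h'
      rw [mem_filter, mem_Ico]
      refine ⟨⟨by omega, h'.2⟩, ?_⟩
      rcases h'.1.lt_or_eq with h2 | h2
      · exact hb.trans (h.col_strict r r' j h2 hr ((hsh r').mpr ⟨by omega, h'.2⟩))
      · rwa [← h2]
    have := card_le_card this
    rw [Nat.card_Ico] at this
    omega
  · intro hb
    by_contra hcon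
    have : ((Ico (conjP alpha j) (conjP lam j)).filter fun r => b < e r j) ⊆
        Ico (r + 1) (conjP lam j) := by
      intro r' h'
      rw [mem_filter, mem_Ico] at h'
      rw [mem_Ico]
      refine ⟨?_, h'.1.2⟩
      by_contra h2
      rcases (show r' ≤ r by omega).lt_or_eq with h3 | h3
      · have := h.col_strict r' r j h3 ((hsh r').mpr h'.1) hr
        omega
      · subst h3; omega
    have := card_le_card this
    rw [Nat.card_Ico] at this
    omega

theorem IsFilling.card_column {e : ℕ → ℕ → ℕ} (hl : IsPartition lam) (ha : IsPartition alpha)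
    (h : IsFilling lam alpha n e) (j : ℕ) :
    (column lam alpha n e j).card = conjP lam j - conjP alpha j := by
  rw [← upCard_zero, h.upCard_column hl ha, filter_true_of_mem, Nat.card_Ico]
  intro r hr
  rw [mem_Ico] at hr
  exact h.one_le r j ((inShape_iff hl ha).mpr hr)

theorem IsFilling.compat_column {e : ℕ → ℕ → ℕ} (hl : IsPartition lam) (ha : IsPartition alpha)
    (h : IsFilling lam alpha n e) (j : ℕ) :
    Compat (conjP lam j - conjP lam (j + 1)) (column lam alpha n e (j + 1))
      (column lam alpha n e j) := by
  intro b
  by_contra hcon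
  push Not at hcon
  have h1 := upCard_le_card (column lam alpha n e j) b
  have h2 := upCard_le_card (column lam alpha n e (j + 1)) b
  rw [h.card_column hl ha] at h1 h2
  have a1 := conjP_antitone hl (Nat.le_succ j)
  have a2 := conjP_antitone ha (Nat.le_succ j)
  rw [Nat.succ_eq_add_one] at a1 a2
  set u := upCard (column lam alpha n e (j + 1)) b with hu
  set v := upCard (column lam alpha n e j) b with hv
  have s1 : inShape lam alpha (conjP lam (j + 1) - u - 1) j :=
    (inShape_iff hl ha).mpr (by omega)
  have s2 : inShape lam alpha (conjP lam (j + 1) - u - 1) (j + 1) :=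
    (inShape_iff hl ha).mpr (by omega)
  have e1 := (h.lt_iff hl ha s1 b).mpr (by omega)
  have e2 := (h.lt_iff hl ha s2 b).mp (e1.trans_le (h.row_weak _ _ _ (Nat.le_succ j) s1 s2))
  omega

theorem upCard_anti (T : Finset (Fin n)) {b b' : ℕ} (h : b ≤ b') : upCard T b' ≤ upCard T b :=
  card_le_card (monotone_filter_right _ fun _ _ hx => le_trans h hx)

/-- The filling whose columns have the given entry sets. -/
noncomputable def fillingOf (lam alpha : ℕ → ℕ) (T : ℕ → Finset (Fin n)) (r c : ℕ) : ℕ :=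
  if conjP alpha c ≤ r ∧ r < conjP lam c then
    ((range n).filter fun b => conjP lam c ≤ r + upCard (T c) b).card else 0

theorem lt_fillingOf_iff (hl : IsPartition lam) (ha : IsPartition alpha) {T : ℕ → Finset (Fin n)}
    {r c : ℕ} (h : inShape lam alpha r c) (b : ℕ) :
    b < fillingOf lam alpha T r c ↔ conjP lam c ≤ r + upCard (T c) b := by
  have h' := (inShape_iff hl ha).mp h
  rw [fillingOf, if_pos h']
  constructor
  · intro hb
    by_contra hcon
    have : ((range n).filter fun b => conjP lam c ≤ r + upCard (T c) b) ⊆ range b := by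
      intro x hx
      rw [mem_filter] at hx
      rw [mem_range]
      by_contra hx'
      have := upCard_anti (T c) (not_lt.mp hx')
      omega
    have := card_le_card this
    rw [card_range] at this
    omega
  · intro hb
    have hn : upCard (T c) n = 0 := by
      rw [upCard, card_eq_zero, filter_eq_empty_iff]
      intro x _
      omega
    have : range (b + 1) ⊆ (range n).filter fun b => conjP lam c ≤ r + upCard (T c) b := by
      intro x hx
      rw [mem_range] at hx
      have := upCard_anti (T c) (show x ≤ b by omega)
      rw [mem_filter, mem_range]
      refine ⟨?_, by omega⟩
      by_contra hx'
      have := upCard_anti (T c) (not_lt.mp hx')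
      omega
    have := card_le_card this
    rw [card_range] at this
    omega

theorem inShape_of_between (hl : IsPartition lam) (ha : IsPartition alpha) {r r' c c' : ℕ}
    (h : inShape lam alpha r c) (h' : inShape lam alpha r' c') {x y : ℕ} (hx : r ≤ x) (hx' : x ≤ r')
    (hy : c ≤ y) (hy' : y ≤ c') : inShape lam alpha x y := by
  have h1 := ha.1 hx
  have h2 := hl.1 hx'
  exact ⟨h1.trans (h.1.trans hy), lt_of_le_of_lt hy' (h'.2.trans_le h2)⟩

theorem isFilling_fillingOf (hl : IsPartition lam) (ha : IsPartition alpha)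
    {T : ℕ → Finset (Fin n)} (hcard : ∀ j, (T j).card = conjP lam j - conjP alpha j)
    (hcompat : ∀ j, Compat (conjP lam j - conjP lam (j + 1)) (T (j + 1)) (T j)) :
    IsFilling lam alpha n (fillingOf lam alpha T) where
  zero_outside r c h := by
    rw [inShape_iff hl ha] at h
    exact if_neg h
  one_le r c h := by
    have h' := (inShape_iff hl ha).mp h
    rw [Nat.one_le_iff_ne_zero, ← Nat.pos_iff_ne_zero, lt_fillingOf_iff hl ha h, upCard_zero, hcard]
    omega
  le_top r c := by
    rw [fillingOf]
    split_ifs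
    · exact (card_filter_le _ _).trans (card_range n).le
    · exact Nat.zero_le _
  row_weak r c₁ c₂ h h1 h2 := by
    induction c₂, h using Nat.le_induction with
    | base => exact le_rfl
    | succ c hc ih =>
      have h3 : inShape lam alpha r c :=
        inShape_of_between hl ha h1 h2 le_rfl le_rfl hc (Nat.le_succ c)
      refine (ih h3).trans ?_
      by_contra hcon
      push Not at hcon
      rw [lt_fillingOf_iff hl ha h3] at hcon
      have h4 := (lt_fillingOf_iff hl ha (T := T) h2 (fillingOf lam alpha T r (c + 1))).not.mp
        (lt_irrefl _)
      have h5 := hcompat c (fillingOf lam alpha T r (c + 1))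
      have h6 := conjP_antitone hl (Nat.le_succ c)
      rw [Nat.succ_eq_add_one] at h6
      have h7 := ((inShape_iff hl ha).mp h2).2
      omega
  col_strict r₁ r₂ c h h1 h2 := by
    have g1 : 0 < fillingOf lam alpha T r₁ c := by
      rw [lt_fillingOf_iff hl ha h1, upCard_zero, hcard]
      have h' := (inShape_iff hl ha).mp h1
      omega
    obtain ⟨b, hb⟩ : ∃ b, fillingOf lam alpha T r₁ c = b + 1 := ⟨_, (Nat.succ_pred g1.ne').symm⟩
    rw [hb, lt_fillingOf_iff hl ha h2]
    have h3 := (lt_fillingOf_iff hl ha (T := T) h1 b).mp (by omega)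
    have h4 := (lt_fillingOf_iff hl ha (T := T) h1 (b + 1)).not.mp (by omega)
    by_cases hbn : b < n
    · have h5 := upCard_val (T c) ⟨b, hbn⟩
      have h6 : ind (T c) ⟨b, hbn⟩ ≤ 1 := by unfold ind; split_ifs <;> omega
      simp only at h5
      omega
    · have hn : upCard (T c) b = 0 := by
        rw [upCard, card_eq_zero, filter_eq_empty_iff]
        intro x _
        omega
      have h' := (inShape_iff hl ha).mp h1
      omega

theorem column_fillingOf (hl : IsPartition lam) (ha : IsPartition alpha)
    {T : ℕ → Finset (Fin n)} (hcard : ∀ j, (T j).card = conjP lam j - conjP alpha j) :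
    column lam alpha n (fillingOf lam alpha T) = T := by
  funext j
  ext b
  rw [mem_column]
  have h0 := upCard_val (T j) b
  have h1 := upCard_le_card (T j) b
  rw [hcard] at h1
  constructor
  · rintro ⟨r, hr, he⟩
    have h2 := (lt_fillingOf_iff hl ha (T := T) hr b).mp (by omega)
    have h3 := (lt_fillingOf_iff hl ha (T := T) hr (b + 1)).not.mp (by omega)
    by_contra hb
    rw [ind, if_neg hb] at h0
    omega
  · intro hb
    rw [ind, if_pos hb] at h0
    have hr : inShape lam alpha (conjP lam j - upCard (T j) b) j :=
      (inShape_iff hl ha).mpr (by omega)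
    refine ⟨_, hr, ?_⟩
    have h2 := (lt_fillingOf_iff hl ha (T := T) hr b).mpr (by omega)
    have h3 := (lt_fillingOf_iff hl ha (T := T) hr (b + 1)).not.mpr (by omega)
    omega

theorem fillingOf_column {e : ℕ → ℕ → ℕ} (hl : IsPartition lam) (ha : IsPartition alpha)
    (h : IsFilling lam alpha n e) : fillingOf lam alpha (column lam alpha n e) = e := by
  funext r c
  by_cases hr : inShape lam alpha r c
  · refine eq_of_forall_lt_iff fun b => ?_
    rw [lt_fillingOf_iff hl ha hr, h.lt_iff hl ha hr]
  · rw [h.zero_outside r c hr]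
    rw [inShape_iff hl ha] at hr
    exact if_neg hr

end Filling

section Lattice

variable {lam alpha : ℕ → ℕ} {n : ℕ}

open Classical in
/-- The cells with entry `k` that satisfy `P`, inside a box. -/
noncomputable def cells (lam alpha : ℕ → ℕ) (N J : ℕ) (e : ℕ → ℕ → ℕ) (P : ℕ × ℕ → Prop) (k : ℕ) :
    Finset (ℕ × ℕ) :=
  (range N ×ˢ range J).filter fun p : ℕ × ℕ => inShape lam alpha p.1 p.2 ∧ P p ∧ e p.1 p.2 = k

theorem mem_cells (hl : IsPartition lam) {N J : ℕ} (hN : lam N = 0) (hJ : lam 0 ≤ J)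
    {e : ℕ → ℕ → ℕ} {P : ℕ × ℕ → Prop} {k : ℕ} {p : ℕ × ℕ} :
    p ∈ cells lam alpha N J e P k ↔ inShape lam alpha p.1 p.2 ∧ P p ∧ e p.1 p.2 = k := by
  classical
  rw [cells, mem_filter, mem_product, mem_range, mem_range, and_iff_right_iff_imp]
  rintro ⟨h, -, -⟩
  have h1 := h.2
  have h2 := hl.1 (Nat.zero_le p.1)
  refine ⟨?_, by omega⟩
  by_contra hcon
  have := hl.1 (not_lt.mp hcon)
  omega

theorem natCard_cells (hl : IsPartition lam) {N J : ℕ} (hN : lam N = 0) (hJ : lam 0 ≤ J)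
    (e : ℕ → ℕ → ℕ) (P : ℕ × ℕ → Prop) (k : ℕ) :
    Nat.card {p : ℕ × ℕ // inShape lam alpha p.1 p.2 ∧ P p ∧ e p.1 p.2 = k} =
      (cells lam alpha N J e P k).card :=
  Nat.subtype_card _ fun _ => mem_cells hl hN hJ

theorem card_cells_columns (hl : IsPartition lam) {N J : ℕ} (hN : lam N = 0) (hJ : lam 0 ≤ J)
    {e : ℕ → ℕ → ℕ} (h : IsFilling lam alpha n e) (c : ℕ) (k : Fin n) :
    (cells lam alpha N J e (fun p => c ≤ p.2) (k + 1)).card =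
      (∑ q ∈ Ico c J, ind (column lam alpha n e q)) k := by
  rw [ind_sum_eq_card]
  refine card_bij (fun p _ => p.2) ?_ ?_ ?_
  · intro p hp
    rw [mem_cells hl hN hJ] at hp
    have := hl.1 (Nat.zero_le p.1)
    have := hp.1.2
    rw [mem_filter, mem_Ico, mem_column]
    exact ⟨⟨hp.2.1, by omega⟩, p.1, hp.1, hp.2.2⟩
  · intro p hp q hq heq
    rw [mem_cells hl hN hJ] at hp hq
    refine Prod.ext ?_ heq
    rw [← heq] at hq
    exact h.col_inj hp.1 hq.1 (hp.2.2.trans hq.2.2.symm)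
  · intro q hq
    rw [mem_filter, mem_Ico, mem_column] at hq
    obtain ⟨⟨h1, h2⟩, r, h3, h4⟩ := hq
    exact ⟨(r, q), (mem_cells hl hN hJ).mpr ⟨h3, h1, h4⟩, rfl⟩

theorem lattice_of_dominant (hl : IsPartition lam) (ha : IsPartition alpha) {N J : ℕ}
    (hN : lam N = 0) (hJ : lam 0 ≤ J) {e : ℕ → ℕ → ℕ} (h : IsFilling lam alpha n e) {k : ℕ}
    (hdom : ∀ c, (cells lam alpha N J e (fun p => c ≤ p.2) (k + 2)).card ≤
      (cells lam alpha N J e (fun p => c ≤ p.2) (k + 1)).card) (r c : ℕ) :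
    (cells lam alpha N J e (fun p => p.1 < r ∨ (p.1 = r ∧ c ≤ p.2)) (k + 2)).card ≤
      (cells lam alpha N J e (fun p => p.1 < r ∨ (p.1 = r ∧ c ≤ p.2)) (k + 1)).card := by
  set A := cells lam alpha N J e (fun p => p.1 < r ∨ (p.1 = r ∧ c ≤ p.2)) (k + 2) with hA
  rcases A.eq_empty_or_nonempty with h0 | h0
  · rw [h0, card_empty]; exact Nat.zero_le _
  obtain ⟨p₀, hp₀, hmax⟩ := exists_max_image A (fun p => p.1) h0
  obtain ⟨p₁, hp₁, hmin⟩ := exists_min_image (A.filter fun p => p.1 = p₀.1) (fun p => p.2)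
    ⟨p₀, mem_filter.mpr ⟨hp₀, rfl⟩⟩
  rw [mem_filter] at hp₁
  have s1 := (mem_cells hl hN hJ).mp hp₁.1
  refine le_trans (card_le_card ?_) ((hdom p₁.2).trans (card_le_card ?_))
  · intro p hp
    have s := (mem_cells hl hN hJ).mp hp
    refine (mem_cells hl hN hJ).mpr ⟨s.1, ?_, s.2.2⟩
    have hle : p.1 ≤ p₀.1 := hmax p hp
    by_contra hcon
    rw [← hp₁.2] at hle
    rcases hle.lt_or_eq with hlt | heq
    · have s2 : inShape lam alpha p.1 p₁.2 :=
        inShape_of_between hl ha s.1 s1.1 le_rfl hle (by omega) le_rfl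
      have e1 := h.row_weak _ _ _ (by omega) s.1 s2
      have e2 := h.col_strict _ _ _ hlt s2 s1.1
      omega
    · have := hmin p (mem_filter.mpr ⟨hp, by omega⟩)
      omega
  · intro p hp
    have s := (mem_cells hl hN hJ).mp hp
    refine (mem_cells hl hN hJ).mpr ⟨s.1, ?_, s.2.2⟩
    have hlt : p.1 < p₁.1 := by
      by_contra hcon
      push Not at hcon
      have hc : p₁.2 ≤ p.2 := s.2.1
      have s2 : inShape lam alpha p₁.1 p.2 :=
        inShape_of_between hl ha s1.1 s.1 le_rfl hcon hc le_rfl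
      have e1 := h.row_weak _ _ _ hc s1.1 s2
      rcases hcon.lt_or_eq with h1 | h1
      · have e2 := h.col_strict _ _ _ h1 s2 s.1
        omega
      · rw [h1] at e1 s1
        omega
    have := s1.2.1
    left
    omega

theorem dominant_of_lattice (hl : IsPartition lam) (ha : IsPartition alpha) {N J : ℕ}
    (hN : lam N = 0) (hJ : lam 0 ≤ J) {e : ℕ → ℕ → ℕ} (h : IsFilling lam alpha n e) {k : ℕ}
    (hlat : ∀ r c, inShape lam alpha r c →
      (cells lam alpha N J e (fun p => p.1 < r ∨ (p.1 = r ∧ c ≤ p.2)) (k + 2)).card ≤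
      (cells lam alpha N J e (fun p => p.1 < r ∨ (p.1 = r ∧ c ≤ p.2)) (k + 1)).card) (c : ℕ) :
    (cells lam alpha N J e (fun p => c ≤ p.2) (k + 2)).card ≤
      (cells lam alpha N J e (fun p => c ≤ p.2) (k + 1)).card := by
  classical
  set A := cells lam alpha N J e (fun p => c ≤ p.2) (k + 2) with hA
  rcases A.eq_empty_or_nonempty with h0 | h0
  · rw [h0, card_empty]; exact Nat.zero_le _
  obtain ⟨p₀, hp₀, hmax⟩ := exists_max_image A (fun p => p.1) h0
  have s0 := (mem_cells hl hN hJ).mp hp₀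
  have hc0 : c ≤ p₀.2 := s0.2.1
  set B := cells lam alpha N J e (fun p => p.1 = p₀.1) (k + 2) with hB
  have hp₀B : p₀ ∈ B := (mem_cells hl hN hJ).mpr ⟨s0.1, rfl, s0.2.2⟩
  obtain ⟨p₁, hp₁, hmin⟩ := exists_min_image B (fun p => p.2) ⟨p₀, hp₀B⟩
  have s1 := (mem_cells hl hN hJ).mp hp₁
  have hrow : p₁.1 = p₀.1 := s1.2.1
  have hmain := hlat p₁.1 p₁.2 s1.1
  set C := B.filter fun p => p.2 < c with hC
  have hlow : A.card + C.card ≤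
      (cells lam alpha N J e (fun p => p.1 < p₁.1 ∨ (p.1 = p₁.1 ∧ p₁.2 ≤ p.2)) (k + 2)).card := by
    rw [← card_union_of_disjoint]
    · refine card_le_card ?_
      intro p hp
      rcases mem_union.mp hp with hp | hp
      · have s := (mem_cells hl hN hJ).mp hp
        refine (mem_cells hl hN hJ).mpr ⟨s.1, ?_, s.2.2⟩
        have : p.1 ≤ p₀.1 := hmax p hp
        rcases this.lt_or_eq with h1 | h1
        · left; omega
        · right
          exact ⟨by omega, hmin p ((mem_cells hl hN hJ).mpr ⟨s.1, h1, s.2.2⟩)⟩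
      · have hpB := (mem_filter.mp hp).1
        have s := (mem_cells hl hN hJ).mp hpB
        have h1 : p.1 = p₀.1 := s.2.1
        exact (mem_cells hl hN hJ).mpr ⟨s.1, Or.inr ⟨by omega, hmin p hpB⟩, s.2.2⟩
    · rw [disjoint_left]
      intro p hp hp'
      have h1 : c ≤ p.2 := ((mem_cells hl hN hJ).mp hp).2.1
      have h2 := (mem_filter.mp hp').2
      omega
  have hup : (cells lam alpha N J e (fun p => p.1 < p₁.1 ∨ (p.1 = p₁.1 ∧ p₁.2 ≤ p.2)) (k + 1)).card ≤
      (cells lam alpha N J e (fun p => c ≤ p.2) (k + 1)).card + C.card := by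
    rw [← card_filter_add_card_filter_not (s := cells lam alpha N J e _ (k + 1)) fun p => c ≤ p.2]
    have hrows : ∀ p ∈ cells lam alpha N J e
        (fun p => p.1 < p₁.1 ∨ (p.1 = p₁.1 ∧ p₁.2 ≤ p.2)) (k + 1), p.1 < p₁.1 := by
      intro p hp
      have s := (mem_cells hl hN hJ).mp hp
      rcases s.2.1 with h1 | ⟨h1, h2⟩
      · exact h1
      · have s' := s.1
        rw [h1] at s'
        have := h.row_weak _ _ _ h2 s1.1 s'
        have := s.2.2
        rw [h1] at this
        omega
    refine Nat.add_le_add (card_le_card ?_) ?_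
    · intro p hp
      rw [mem_filter] at hp
      have s := (mem_cells hl hN hJ).mp hp.1
      exact (mem_cells hl hN hJ).mpr ⟨s.1, hp.2, s.2.2⟩
    · refine card_le_card_of_injOn (fun p => (p₁.1, p.2)) ?_ ?_
      · intro p hp
        rw [mem_coe, mem_filter] at hp
        have s := (mem_cells hl hN hJ).mp hp.1
        have hlt := hrows p hp.1
        have hcp : p.2 < c := not_le.mp hp.2
        have s0' := s0.1
        rw [← hrow] at s0'
        have s2 : inShape lam alpha p₁.1 p.2 :=
          inShape_of_between hl ha s.1 s0' hlt.le le_rfl le_rfl (by omega)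
        have e1 := h.row_weak _ _ _ (by omega) s2 s0'
        have e2 := h.col_strict _ _ _ hlt s.1 s2
        have e3 := s0.2.2
        have e4 := s.2.2
        rw [← hrow] at e3
        rw [mem_coe, mem_filter]
        exact ⟨(mem_cells hl hN hJ).mpr ⟨s2, hrow, by simp only; omega⟩, hcp⟩
      · intro p hp q hq heq
        have hp' := (mem_cells hl hN hJ).mp (mem_filter.mp (mem_coe.mp hp)).1
        have hq' := (mem_cells hl hN hJ).mp (mem_filter.mp (mem_coe.mp hq)).1
        have e2 := congrArg Prod.snd heq
        simp only at e2
        refine Prod.ext ?_ e2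
        rw [← e2] at hq'
        exact h.col_inj hp'.1 hq'.1 (hp'.2.2.trans hq'.2.2.symm)
  omega

theorem isWord_of_tableau (hl : IsPartition lam) (ha : IsPartition alpha) {J : ℕ}
    (hJ : lam 0 ≤ J) {beta : ℕ → ℕ} {e : ℕ → ℕ → ℕ} (h : IsFilling lam alpha n e)
    (hcont : ∀ k : ℕ, Nat.card {p : ℕ × ℕ // inShape lam alpha p.1 p.2 ∧ e p.1 p.2 = k + 1} =
      beta k)
    (hlat : ∀ r c k : ℕ, inShape lam alpha r c →
      Nat.card {p : ℕ × ℕ // inShape lam alpha p.1 p.2 ∧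
        (p.1 < r ∨ (p.1 = r ∧ c ≤ p.2)) ∧ e p.1 p.2 = k + 2} ≤
      Nat.card {p : ℕ × ℕ // inShape lam alpha p.1 p.2 ∧
        (p.1 < r ∨ (p.1 = r ∧ c ≤ p.2)) ∧ e p.1 p.2 = k + 1}) :
    IsWord (n := n) (fun j => (conjP lam j - conjP alpha j, conjP lam j - conjP lam (j + 1))) J ∅ 0
      (fun k => beta k) (column lam alpha n e) := by
  obtain ⟨N, hN⟩ := hl.2
  refine ⟨?_, fun j _ => h.card_column hl ha j, fun j _ => h.compat_column hl ha j, ?_, ?_⟩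
  · intro j hj
    rw [← card_eq_zero, h.card_column hl ha, conjP_eq_zero hl (hJ.trans hj), Nat.zero_sub]
  · intro j _
    refine antitone_of_succ fun k k' hk => ?_
    rw [zero_add, ← card_cells_columns hl hN hJ h, ← card_cells_columns hl hN hJ h, hk]
    refine dominant_of_lattice hl ha hN hJ h (fun r c hr => ?_) j
    rw [← natCard_cells hl hN hJ, ← natCard_cells hl hN hJ]
    exact hlat r c k hr
  · funext k
    rw [zero_add, range_eq_Ico, ← card_cells_columns hl hN hJ h, ← natCard_cells hl hN hJ,
      ← hcont]
    simp

theorem tableau_of_isWord (hl : IsPartition lam) (ha : IsPartition alpha) {J : ℕ}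
    (hJ : lam 0 ≤ J) {beta : ℕ → ℕ} (hb : ∀ k, n ≤ k → beta k = 0) {e : ℕ → ℕ → ℕ}
    (h : IsFilling lam alpha n e)
    (hw : IsWord (n := n) (fun j => (conjP lam j - conjP alpha j, conjP lam j - conjP lam (j + 1)))
      J ∅ 0 (fun k => beta k) (column lam alpha n e)) :
    (∀ k : ℕ, Nat.card {p : ℕ × ℕ // inShape lam alpha p.1 p.2 ∧ e p.1 p.2 = k + 1} = beta k) ∧
    ∀ r c k : ℕ, inShape lam alpha r c →
      Nat.card {p : ℕ × ℕ // inShape lam alpha p.1 p.2 ∧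
        (p.1 < r ∨ (p.1 = r ∧ c ≤ p.2)) ∧ e p.1 p.2 = k + 2} ≤
      Nat.card {p : ℕ × ℕ // inShape lam alpha p.1 p.2 ∧
        (p.1 < r ∨ (p.1 = r ∧ c ≤ p.2)) ∧ e p.1 p.2 = k + 1} := by
  obtain ⟨N, hN⟩ := hl.2
  have hempty : ∀ P k, n < k → cells lam alpha N J e P k = ∅ := by
    intro P k hk
    rw [eq_empty_iff_forall_notMem]
    intro p hp
    have := h.le_top p.1 p.2
    have := ((mem_cells hl hN hJ).mp hp).2.2
    omega
  constructor
  · intro k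
    have e1 : Nat.card {p : ℕ × ℕ // inShape lam alpha p.1 p.2 ∧ e p.1 p.2 = k + 1} =
        (cells lam alpha N J e (fun p => 0 ≤ p.2) (k + 1)).card := by
      rw [← natCard_cells hl hN hJ]
      simp
    rw [e1]
    by_cases hk : k < n
    · have := congrFun hw.total ⟨k, hk⟩
      rw [zero_add, range_eq_Ico, ← card_cells_columns hl hN hJ h] at this
      exact this
    · rw [hempty _ _ (by omega), card_empty, hb k (by omega)]
  · intro r c k _
    rw [natCard_cells hl hN hJ, natCard_cells hl hN hJ]
    by_cases hk : k + 1 < n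
    · refine lattice_of_dominant hl ha hN hJ h (fun c => ?_) r c
      have e1 := card_cells_columns hl hN hJ h c ⟨k, by omega⟩
      have e2 := card_cells_columns hl hN hJ h c ⟨k + 1, hk⟩
      simp only at e1 e2
      rw [e1, show k + 2 = k + 1 + 1 from rfl, e2]
      by_cases hc : c < J
      · have := hw.dominant c hc (show (⟨k, by omega⟩ : Fin n) ≤ ⟨k + 1, hk⟩ from
          Fin.le_def.mpr (by simp))
        rwa [zero_add] at this
      · rw [Ico_eq_empty (by omega)]
        simp
    · rw [hempty _ _ (by omega), card_empty]
      exact Nat.zero_le _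

theorem card_LRTableau (hl : IsPartition lam) (ha : IsPartition alpha) {J : ℕ}
    (hJ : lam 0 ≤ J) {beta : ℕ → ℕ} (hb : ∀ k, n ≤ k → beta k = 0) :
    Nat.card (LRTableau lam alpha beta) =
      cnt (n := n) (cols (fun j => (conjP lam j - conjP alpha j,
        conjP lam j - conjP lam (j + 1))) J) ∅ 0 (fun k => beta k) := by
  rw [cnt_eq_card]
  obtain ⟨N, hN⟩ := hl.2
  have hfill : ∀ t : LRTableau lam alpha beta, IsFilling lam alpha n t.entry := by
    intro t
    refine ⟨t.zero_outside, t.one_le, fun r c => ?_, t.row_weak, t.col_strict⟩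
    by_contra hcon
    have hr : inShape lam alpha r c := by
      by_contra h
      rw [t.zero_outside r c h] at hcon
      omega
    obtain ⟨k, hk⟩ : ∃ k, t.entry r c = k + 1 := ⟨t.entry r c - 1, by omega⟩
    have h1 := t.content k
    have e1 : Nat.card {p : ℕ × ℕ // inShape lam alpha p.1 p.2 ∧ t.entry p.1 p.2 = k + 1} =
        (cells lam alpha N J t.entry (fun _ => True) (k + 1)).card := by
      rw [← natCard_cells hl hN hJ]
      simp
    rw [e1, hb k (by omega), card_eq_zero] at h1
    have : (r, c) ∈ cells lam alpha N J t.entry (fun _ => True) (k + 1) :=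
      (mem_cells hl hN hJ).mpr ⟨hr, trivial, hk⟩
    rw [h1] at this
    exact absurd this (notMem_empty _)
  have hword : ∀ T, IsWord (n := n) (fun j => (conjP lam j - conjP alpha j,
      conjP lam j - conjP lam (j + 1))) J ∅ 0 (fun k => beta k) T →
      (∀ j, (T j).card = conjP lam j - conjP alpha j) ∧
      ∀ j, Compat (conjP lam j - conjP lam (j + 1)) (T (j + 1)) (T j) := by
    intro T hT
    have h0 : ∀ j, J ≤ j → T j = ∅ := hT.outside
    refine ⟨fun j => ?_, fun j => ?_⟩
    · rcases Nat.lt_or_ge j J with h | h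
      · exact hT.card j h
      · rw [h0 j h, card_empty, conjP_eq_zero hl (hJ.trans h), Nat.zero_sub]
    · rcases Nat.lt_or_ge j J with h | h
      · exact hT.compat j h
      · refine compat_of_card_le ?_
        rw [h0 j h, card_empty]
        exact Nat.zero_le _
  refine Nat.card_congr
    { toFun := fun t => ⟨column lam alpha n t.entry,
        isWord_of_tableau hl ha hJ (hfill t) t.content t.lattice⟩
      invFun := fun T =>
        have hf := isFilling_fillingOf hl ha (hword T.1 T.2).1 (hword T.1 T.2).2
        have ht := tableau_of_isWord hl ha hJ hb hf
          (by rw [column_fillingOf hl ha (hword T.1 T.2).1]; exact T.2)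
        ⟨fillingOf lam alpha T.1, hf.zero_outside, hf.one_le, hf.row_weak, hf.col_strict, ht.1, ht.2⟩
      left_inv := ?_
      right_inv := ?_ }
  · intro t
    have := fillingOf_column hl ha (hfill t)
    cases t
    simp only [LRTableau.mk.injEq]
    exact this
  · intro T
    exact Subtype.ext (column_fillingOf hl ha (hword T.1 T.2).1)

end Lattice

end ColumnWord

namespace ColumnWord

/-! ### A certified enumeration, written with bare recursors so that the kernel evaluates it fast -/

/-- `f x`, where the recursor forces the kernel to reduce `x` to a literal first. -/
noncomputable def strict {α : Type} (x : ℕ) (f : ℕ → α) : α :=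
  Nat.rec (f 0) (fun k _ => f (Nat.succ k)) x

noncomputable def sel {α : Type} (c : Bool) (x y : α) : α := Bool.rec y x c

noncomputable def forceBools {α : Type} (l : List Bool) : (List Bool → α) → α :=
  List.rec (fun k => k [])
    (fun b _ ih k => sel b (ih fun l => k (true :: l)) (ih fun l => k (false :: l))) l

noncomputable def forceNats {α : Type} (l : List ℕ) : (List ℕ → α) → α :=
  List.rec (fun k => k []) (fun x _ ih k => strict x fun x => ih fun l => k (x :: l)) l

noncomputable def strips {α : Type} (t : List ℕ) :
    ℕ → ℕ → (List Bool → α → (α → Bool) → Bool) → α → (α → Bool) → Bool :=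
  List.rec (fun _ s g acc f => sel (Nat.beq s 0) (g [] acc f) (f acc))
    (fun x _ ih p s g acc f => strict x fun x =>
      ih x s (fun T => g (false :: T)) acc fun acc =>
        Nat.rec (f acc) (fun s' _ => sel (Nat.ble (Nat.succ x) p)
          (strict (Nat.succ x) fun x' => ih x' s' (fun T => g (true :: T)) acc f) (f acc)) s) t

noncomputable def addCol (t : List ℕ) : List Bool → List ℕ :=
  List.rec (fun _ => [])
    (fun x _ ih T => List.rec [] (fun b T _ => sel b (Nat.succ x) x :: ih T) T) t

noncomputable def need (S : List Bool) : List Bool → ℕ → ℕ → ℕ → ℕ :=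
  List.rec (fun _ _ _ m => m)
    (fun s _ ih T a b m => List.rec m (fun t T _ =>
      strict (sel s (Nat.succ a) a) fun a => strict (sel t (Nat.succ b) b) fun b =>
      strict (Nat.sub a b) fun d => sel (Nat.ble d m) (ih T a b m) (ih T a b d)) T) S

noncomputable def chains {α : Type} (g : ℕ → List Bool → List ℕ → α → (α → Bool) → Bool)
    (L : List ℕ) : ℕ → List Bool → List ℕ → α → (α → Bool) → Bool :=
  List.rec g (fun s _ ih r S t acc f => strips t 100 s (fun T acc f =>
    forceBools T fun T => strict (Nat.add (Nat.mul 8 r) (need S T 0 0 0)) fun r =>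
    forceNats (addCol t T) fun t => ih r T t acc f) acc f) L

noncomputable def parts {α : Type} (n : ℕ) :
    ℕ → ℕ → (List ℕ → α → (α → Bool) → Bool) → α → (α → Bool) → Bool :=
  Nat.rec (fun _ s g acc f => sel (Nat.beq s 0) (g [] acc f) (f acc))
    (fun _ ih p s g => Nat.rec (ih 0 s fun t => g (0 :: t))
      (fun p' ihp acc f => strict (Nat.succ p') fun p => sel (Nat.ble p s)
        (strict (Nat.sub s p) fun s' =>
          ih p s' (fun t => g (p :: t)) acc fun acc => ihp acc f) (ihp acc f)) p) n

noncomputable def countGt (j : ℕ) (t : List ℕ) : ℕ → ℕ :=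
  List.rec (fun c => c) (fun x _ ih c => sel (Nat.ble (Nat.succ j) x) (strict (Nat.succ c) ih) (ih c)) t

noncomputable def cnj (t : List ℕ) (n : ℕ) : ℕ → List ℕ :=
  Nat.rec (fun _ => []) (fun _ ih j => countGt j t 0 :: ih (Nat.succ j)) n

noncomputable def code (t : List ℕ) : ℕ := List.rec 0 (fun x _ c => Nat.add x (Nat.mul 8 c)) t

noncomputable def look (c : ℕ) (l : List (ℕ × ℕ)) : ℕ :=
  List.rec 0 (fun x _ ih => sel (Nat.beq c x.1) x.2 ih) l

noncomputable def index (c : ℕ) (l : List ℕ) : ℕ → ℕ :=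
  List.rec (fun k => k) (fun x _ ih k => sel (Nat.beq c x) k (strict (Nat.succ k) ih)) l

noncomputable def allB {α : Type} (p : α → Bool) (l : List α) : Bool :=
  List.rec true (fun x _ ih => sel (p x) ih false) l

noncomputable def memB (a : ℕ) (l : List ℕ) : Bool :=
  List.rec false (fun x _ ih => sel (Nat.beq a x) true ih) l

noncomputable def mapK {α β : Type} (g : α → (β → Bool) → Bool) (l : List α) :
    List β → (List β → Bool) → Bool :=
  List.rec (fun acc f => f acc) (fun x _ ih acc f => g x fun y => ih (y :: acc) f) l

noncomputable def filterK {α : Type} (p : α → Bool) (l : List α) :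
    List α → (List α → Bool) → Bool :=
  List.rec (fun acc f => f acc) (fun x _ ih acc f => sel (p x) (ih (x :: acc) f) (ih acc f)) l

noncomputable def filterKK {α : Type} (p : α → Bool) (l : List (List α)) :
    List (List α) → (List (List α) → Bool) → Bool :=
  List.rec (fun acc f => f acc) (fun x _ ih acc f => filterK p x [] fun y =>
    List.rec (ih acc f) (fun _ _ _ => ih (y :: acc) f) y) l

noncomputable def sumK (l : List (ℕ × ℕ)) : ℕ → (ℕ → Bool) → Bool :=
  List.rec (fun a f => f a) (fun x _ ih a f => strict (Nat.add x.2 a) fun a => ih a f) l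

noncomputable def packs (l : List (List (ℕ × ℕ))) : List ℕ → (List ℕ → Bool) → Bool :=
  List.rec (fun acc f => f acc) (fun x _ ih acc f =>
    sumK x 0 fun a => sel (memB a acc) (ih acc f) (ih (a :: acc) f)) l

noncomputable def digit (K P : ℕ) : ℕ :=
  Nat.mod (Nat.div P (Nat.pow 1100003 K)) 1100003

noncomputable def pairOk (a b : ℕ) : Bool :=
  strict (Nat.mul a b) fun P => Nat.ble (digit 240 P) (digit 384 P)

noncomputable def pairsOk (l : List ℕ) : Bool :=
  List.rec true (fun x xs ih => sel (allB (fun y => pairOk x y) (x :: xs)) ih false) l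

noncomputable def go (i c : ℕ) : ℕ → ℕ → List (List (ℕ × ℕ)) → Bool :=
  Nat.rec (fun _ _ Fs => packs Fs [] pairsOk)
    (fun c ih m σ Fs => allB (fun e => strict e fun e => sel (Nat.ble (Nat.sub (Nat.succ i) c) (Nat.add σ e))
      (filterKK (fun r => Nat.ble (Nat.mod (Nat.div r.1 m) 8) e) Fs [] fun Gs =>
        strict (Nat.mul m 8) fun m => strict (Nat.add σ e) fun σ => ih m σ Gs) true)
      (List.range (Nat.succ i))) c

noncomputable def record (d : ℕ) (tab tab' : List (ℕ × ℕ)) (r : ℕ) (S : List Bool) (t : List ℕ)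
    (acc : List (ℕ × ℕ)) (f : List (ℕ × ℕ) → Bool) : Bool :=
  strict (look (code t) tab) fun w => sel (Nat.ble 1 w)
    (strips t 100 1 (fun T acc f => sel (Nat.ble (Nat.succ (need S T 0 0 0)) d)
      (strict (Nat.add acc (look (code (addCol t T)) tab')) f) (f acc)) w
      fun w => f ((r, w) :: acc)) false

noncomputable def family (i d : ℕ) (tab tab' : List (ℕ × ℕ)) (l : List ℕ)
    (f : List (ℕ × ℕ) → Bool) : Bool :=
  chains (record d tab tab') (l ++ [d]) 0 (List.replicate (i + 1) false)
    (List.replicate (i + 1) 0) [] fun F =>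
      sel (Nat.ble (Nat.mul F.length (2 * i + 4)) 1023) (f F) false

def sizesOf : ℕ → ℕ → ℕ → List (List ℕ)
  | 0, _, s => bif s.beq 0 then [[]] else []
  | k + 1, i, s => (List.range (i + 1)).flatMap fun x =>
      bif x.ble s then (sizesOf k i (s - x)).map (List.cons x) else []

noncomputable def entry (o : ℕ) (n : ℕ) (C : List ℕ) (t : List ℕ) : ℕ :=
  Nat.add (Nat.pow 1100003 (o + index (code t) C 0))
    (Nat.pow 1100003 (240 + o - index (code (cnj t n 0)) C 0))

noncomputable def goodRow (n : ℕ) (t : List ℕ) : Bool :=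
  sel (Nat.beq t.length n) (sel (allB (fun x => Nat.ble x 7) t)
    (Nat.beq (code (cnj (cnj t n 0) n 0)) (code t)) false) false

noncomputable def mkTable (n o : ℕ) (C : List ℕ) (L : List (List ℕ)) :
    List (ℕ × ℕ) → (List (ℕ × ℕ) → Bool) → Bool :=
  List.rec (fun acc f => f acc) (fun t _ ih acc f => sel (goodRow n t)
    (strict (code t) fun c => strict (entry o n C t) fun v => ih ((c, v) :: acc) f) false) L

noncomputable def table (n s o : ℕ) (f : List (ℕ × ℕ) → Bool) : Bool :=
  parts n n s (fun t acc f => forceNats t fun t => f (t :: acc)) [] fun L =>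
    mapK (fun t f => strict (code t) f) L [] fun C =>
      sel (Nat.ble C.length 36) (mkTable n o C L [] f) false

noncomputable def checkSize (i d s : ℕ) : Bool :=
  table (i + 1) (s + d) 0 fun tab => table (i + 1) (s + d + 1) 72 fun tab' =>
    mapK (fun l => family i d tab tab' l) (sizesOf (i - 1) i s) [] fun Fs => go i (i - 1) 1 d Fs

noncomputable def checkLast (i d : ℕ) : Bool :=
  allB (fun s => strict s fun s => checkSize i d s) (List.range ((i - 1) * i + 1))

theorem checkLast_two_two : checkLast 2 2 = true := by decide +kernel
theorem checkLast_three_two : checkLast 3 2 = true := by decide +kernel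
theorem checkLast_three_three : checkLast 3 3 = true := by decide +kernel

theorem checkLast_four_two : checkLast 4 2 = true := by decide +kernel
theorem checkLast_four_three : checkLast 4 3 = true := by decide +kernel
theorem checkLast_four_four : checkLast 4 4 = true := by decide +kernel

@[simp] theorem strict_eq {α : Type} (x : ℕ) (f : ℕ → α) : strict x f = f x := by
  cases x <;> rfl

@[simp] theorem sel_true {α : Type} (x y : α) : sel true x y = x := rfl

@[simp] theorem sel_false {α : Type} (x y : α) : sel false x y = y := rfl

theorem sel_eq_ite {α : Type} (c : Bool) (x y : α) : sel c x y = if c then x else y := by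
  cases c <;> rfl

@[simp] theorem forceBools_eq {α : Type} (l : List Bool) (k : List Bool → α) :
    forceBools l k = k l := by
  induction l generalizing k with
  | nil => rfl
  | cons b l ih =>
    change sel b (forceBools l fun l => k (true :: l)) (forceBools l fun l => k (false :: l)) = _
    cases b <;> simp [ih]

@[simp] theorem forceNats_eq {α : Type} (l : List ℕ) (k : List ℕ → α) :
    forceNats l k = k l := by
  induction l generalizing k with
  | nil => rfl
  | cons b l ih =>
    change strict b (fun x => forceNats l fun l => k (x :: l)) = _
    simp [ih]

theorem allB_iff {α : Type} {p : α → Bool} {l : List α} :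
    allB p l = true ↔ ∀ x ∈ l, p x = true := by
  induction l with
  | nil => simp [allB]
  | cons x l ih =>
    change sel (p x) (allB p l) false = true ↔ _
    cases h : p x <;> simp [h, ih]

theorem memB_iff {a : ℕ} {l : List ℕ} : memB a l = true ↔ a ∈ l := by
  induction l with
  | nil => simp [memB]
  | cons x l ih =>
    change sel (Nat.beq a x) true (memB a l) = true ↔ _
    cases h : Nat.beq a x
    · have : a ≠ x := fun hh => by simp [hh] at h
      simp [ih, this]
    · simp [Nat.eq_of_beq_eq_true h]

/-- Run the steps `h x`, for `x ∈ l`, one after the other. -/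
def seqK {α β : Type} (l : List β) (h : β → α → (α → Bool) → Bool) (acc : α)
    (f : α → Bool) : Bool :=
  match l with
  | [] => f acc
  | x :: l => h x acc fun acc => seqK l h acc f

theorem seqK_append {α β : Type} (l₁ l₂ : List β) (h : β → α → (α → Bool) → Bool) (acc : α)
    (f : α → Bool) :
    seqK (l₁ ++ l₂) h acc f = seqK l₁ h acc fun acc => seqK l₂ h acc f := by
  induction l₁ generalizing acc with
  | nil => rfl
  | cons x l ih => simp [seqK, ih]

theorem seqK_map {α β γ : Type} (l : List γ) (u : γ → β) (h : β → α → (α → Bool) → Bool)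
    (acc : α) (f : α → Bool) : seqK (l.map u) h acc f = seqK l (fun x => h (u x)) acc f := by
  induction l generalizing acc with
  | nil => rfl
  | cons x l ih => simp [seqK, ih]

theorem seqK_flatMap {α β γ : Type} (l : List γ) (u : γ → List β)
    (h : β → α → (α → Bool) → Bool) (acc : α) (f : α → Bool) :
    seqK (l.flatMap u) h acc f = seqK l (fun x => seqK (u x) h) acc f := by
  induction l generalizing acc with
  | nil => rfl
  | cons x l ih => simp [seqK, seqK_append, ih]

/-- The vertical strips with `s` cells that may be added to the weight `t`. -/
def stripList : List ℕ → ℕ → ℕ → List (List Bool)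
  | [], _, s => if s = 0 then [[]] else []
  | x :: t, p, s => (stripList t x s).map (List.cons false) ++
      if 0 < s ∧ x < p then (stripList t (x + 1) (s - 1)).map (List.cons true) else []

theorem strips_eq {α : Type} (t : List ℕ) (p s : ℕ) (g : List Bool → α → (α → Bool) → Bool)
    (acc : α) (f : α → Bool) : strips t p s g acc f = seqK (stripList t p s) g acc f := by
  induction t generalizing p s g acc f with
  | nil =>
    change sel (Nat.beq s 0) (g [] acc f) (f acc) = _
    cases s with
    | zero => rfl
    | succ s => simp [stripList, seqK]; rfl
  | cons x t ih =>
    change strict x (fun x => strips t x s (fun T => g (false :: T)) acc fun acc =>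
        Nat.rec (f acc) (fun s' _ => sel (Nat.ble (Nat.succ x) p)
          (strict (Nat.succ x) fun x' => strips t x' s' (fun T => g (true :: T)) acc f) (f acc)) s) = _
    simp only [strict_eq, stripList, seqK_append, seqK_map, ih]
    congr 1
    funext acc
    cases s with
    | zero => simp [seqK]
    | succ s =>
      by_cases hx : x < p
      · have : Nat.ble (Nat.succ x) p = true := Nat.ble_eq_true_of_le hx
        simp [this, hx, seqK_map]
      · have : Nat.ble (Nat.succ x) p = false := by
          rw [← Bool.not_eq_true, Nat.ble_eq]; omega
        simp [this, hx, seqK]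

theorem addCol_nil (T : List Bool) : addCol [] T = [] := rfl

theorem addCol_cons (x : ℕ) (t : List ℕ) (b : Bool) (T : List Bool) :
    addCol (x :: t) (b :: T) = (if b then x + 1 else x) :: addCol t T := by
  cases b <;> rfl

theorem need_cons (s t : Bool) (S T : List Bool) (a b m : ℕ) :
    need (s :: S) (t :: T) a b m =
      need S T (if s then a + 1 else a) (if t then b + 1 else b)
        (max m ((if s then a + 1 else a) - (if t then b + 1 else b))) := by
  change strict (sel s (Nat.succ a) a) (fun a => strict (sel t (Nat.succ b) b) fun b =>
      strict (Nat.sub a b) fun d => sel (Nat.ble d m) (need S T a b m) (need S T a b d)) = _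
  simp only [strict_eq, sel_eq_ite, Nat.ble_eq, Nat.succ_eq_add_one, Nat.sub_eq]
  split_ifs with h1 h2 h3 <;> first
    | rw [max_eq_left ‹_›]
    | rw [max_eq_right (by omega)]

theorem need_nil (T : List Bool) (a b m : ℕ) : need [] T a b m = m := rfl

/-- The sequences of vertical strips of the given sizes, starting from the weight `t`: each is
recorded by the requirements on the offsets as octal digits, its last strip, and its weight. -/
noncomputable def chainList : List ℕ → ℕ → List Bool → List ℕ → List (ℕ × List Bool × List ℕ)
  | [], r, S, t => [(r, S, t)]
  | s :: L, r, S, t => (stripList t 100 s).flatMap fun T =>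
      chainList L (8 * r + need S T 0 0 0) T (addCol t T)

theorem chains_eq {α : Type} (g : ℕ → List Bool → List ℕ → α → (α → Bool) → Bool) (L : List ℕ)
    (r : ℕ) (S : List Bool) (t : List ℕ) (acc : α) (f : α → Bool) :
    chains g L r S t acc f =
      seqK (chainList L r S t) (fun x => g x.1 x.2.1 x.2.2) acc f := by
  induction L generalizing r S t acc f with
  | nil => simp [chainList, seqK]; rfl
  | cons s L ih =>
    change strips t 100 s (fun T acc f =>
      forceBools T fun T => strict (Nat.add (Nat.mul 8 r) (need S T 0 0 0)) fun r =>
      forceNats (addCol t T) fun t => chains g L r T t acc f) acc f = _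
    simp only [strips_eq, forceBools_eq, strict_eq, forceNats_eq, chainList, seqK_flatMap, ih]
    rfl

theorem parts_sound {α : Type} (n p s : ℕ) (g : List ℕ → α → (α → Bool) → Bool)
    (hg : ∀ t acc f, g t acc f = true → ∃ acc', f acc' = true) (acc : α) (f : α → Bool)
    (h : parts n p s g acc f = true) : ∃ acc', f acc' = true := by
  induction n generalizing p s g acc f with
  | zero =>
    change sel (Nat.beq s 0) (g [] acc f) (f acc) = true at h
    cases hs : Nat.beq s 0 <;> rw [hs] at h
    · exact ⟨_, h⟩
    · exact hg _ _ _ h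
  | succ n ih =>
    induction p generalizing acc f with
    | zero => exact ih 0 s _ (fun t => hg (0 :: t)) acc f h
    | succ p ihp =>
      change strict (Nat.succ p) (fun q => sel (Nat.ble q s)
        (strict (Nat.sub s q) fun s' =>
          parts n q s' (fun t => g (q :: t)) acc fun acc => parts (n + 1) p s g acc f)
          (parts (n + 1) p s g acc f)) = true at h
      simp only [strict_eq] at h
      cases hs : Nat.ble (Nat.succ p) s <;> rw [hs] at h
      · exact ihp _ _ h
      · obtain ⟨acc', h'⟩ := ih _ _ _ (fun t => hg _) acc _ h
        exact ihp _ _ h'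

theorem mapK_eq {α β : Type} (u : α → β) (g : α → (β → Bool) → Bool) (l : List α)
    (hg : ∀ x f, g x f = f (u x)) (acc : List β) (f : List β → Bool) :
    mapK g l acc f = f ((l.map u).reverse ++ acc) := by
  induction l generalizing acc with
  | nil => rfl
  | cons x l ih =>
    change g x (fun y => mapK g l (y :: acc) f) = _
    simp [hg, ih]

theorem filterK_eq {α : Type} (p : α → Bool) (l acc : List α) (f : List α → Bool) :
    filterK p l acc f = f ((l.filter p).reverse ++ acc) := by
  induction l generalizing acc with
  | nil => rfl
  | cons x l ih =>
    change sel (p x) (filterK p l (x :: acc) f) (filterK p l acc f) = _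
    cases h : p x <;> simp [h, ih]

theorem filterKK_eq {α : Type} (p : α → Bool) (l acc : List (List α)) (f : List (List α) → Bool) :
    filterKK p l acc f =
      f (((l.map fun x => (x.filter p).reverse).filter fun x => !x.isEmpty).reverse ++ acc) := by
  induction l generalizing acc with
  | nil => rfl
  | cons x l ih =>
    change filterK p x [] (fun y =>
      List.rec (filterKK p l acc f) (fun _ _ _ => filterKK p l (y :: acc) f) y) = _
    rw [filterK_eq, List.append_nil]
    cases h : (x.filter p).reverse with
    | nil => simp [h, ih]
    | cons a y => simp [h, ih]

theorem sumK_eq (l : List (ℕ × ℕ)) (a : ℕ) (f : ℕ → Bool) :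
    sumK l a f = f ((l.map Prod.snd).sum + a) := by
  induction l generalizing a with
  | nil => simp [sumK]
  | cons x l ih =>
    change strict (Nat.add x.2 a) (fun a => sumK l a f) = _
    simp only [strict_eq, ih, List.map_cons, List.sum_cons]
    congr 1
    change _ + (x.2 + a) = _
    omega

theorem packs_sound (l : List (List (ℕ × ℕ))) (acc : List ℕ) (f : List ℕ → Bool)
    (h : packs l acc f = true) :
    ∃ r, f r = true ∧ (∀ a ∈ acc, a ∈ r) ∧ ∀ x ∈ l, (x.map Prod.snd).sum ∈ r := by
  induction l generalizing acc with
  | nil => exact ⟨acc, h, fun a ha => ha, by simp⟩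
  | cons x l ih =>
    change sumK x 0 (fun a => sel (memB a acc) (packs l acc f) (packs l (a :: acc) f)) = true at h
    rw [sumK_eq, add_zero] at h
    cases hm : memB (x.map Prod.snd).sum acc <;> rw [hm] at h
    · obtain ⟨r, h1, h2, h3⟩ := ih _ h
      exact ⟨r, h1, fun a ha => h2 a (List.mem_cons_of_mem _ ha),
        List.forall_mem_cons.2 ⟨h2 _ List.mem_cons_self, h3⟩⟩
    · obtain ⟨r, h1, h2, h3⟩ := ih _ h
      exact ⟨r, h1, h2, List.forall_mem_cons.2 ⟨h2 _ (memB_iff.1 hm), h3⟩⟩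

theorem pairOk_comm (a b : ℕ) : pairOk a b = pairOk b a := by
  simp only [pairOk, strict_eq, Nat.mul_eq, Nat.mul_comm]

theorem pairsOk_sound {l : List ℕ} (h : pairsOk l = true) : ∀ x ∈ l, ∀ y ∈ l, pairOk x y = true := by
  induction l with
  | nil => simp
  | cons a l ih =>
    change sel (allB (fun y => pairOk a y) (a :: l)) (pairsOk l) false = true at h
    cases hm : allB (fun y => pairOk a y) (a :: l) <;> rw [hm] at h
    · simp at h
    · have h1 := allB_iff.1 hm
      intro x hx y hy
      rcases List.mem_cons.1 hx with hx' | hx'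
      · exact hx' ▸ h1 _ hy
      · rcases List.mem_cons.1 hy with hy' | hy'
        · rw [pairOk_comm]; exact hy' ▸ h1 _ hx
        · exact ih h x hx' y hy'

/-- The octal digits of `r / m`, starting from the last, are bounded by `es`. -/
def digitsLE : ℕ → List ℕ → ℕ → Bool
  | _, [], _ => true
  | m, e :: es, r => decide (r / m % 8 ≤ e) && digitsLE (m * 8) es r

/-- The tail sums of `es`, read from its end, are large. -/
def TailLarge (i : ℕ) : ℕ → ℕ → List ℕ → Prop
  | 0, _, es => es = []
  | c + 1, σ, es => ∃ e es', es = e :: es' ∧ e ≤ i ∧ i + 1 - c ≤ σ + e ∧ TailLarge i c (σ + e) es'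

theorem go_sound {i c m σ : ℕ} {Fs : List (List (ℕ × ℕ))} (h : go i c m σ Fs = true)
    {es : List ℕ} (hes : TailLarge i c σ es) {X Y : List (ℕ × ℕ)} (hX : X ∈ Fs) (hY : Y ∈ Fs)
    (hX0 : (X.filter fun x => digitsLE m es x.1) ≠ [])
    (hY0 : (Y.filter fun x => digitsLE m es x.1) ≠ []) :
    pairOk ((X.filter fun x => digitsLE m es x.1).map Prod.snd).sum
      ((Y.filter fun x => digitsLE m es x.1).map Prod.snd).sum = true := by
  induction c generalizing m σ Fs es X Y with
  | zero =>
    obtain rfl : es = [] := hes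
    obtain ⟨r, h1, -, h3⟩ := packs_sound _ _ _ (show packs Fs [] pairsOk = true from h)
    simpa [digitsLE] using pairsOk_sound h1 _ (h3 _ hX) _ (h3 _ hY)
  | succ c ih =>
    obtain ⟨e, es', rfl, hei, hσ, hes'⟩ := hes
    have h1 := allB_iff.1 (show allB (fun e => strict e fun e =>
      sel (Nat.ble (Nat.sub (Nat.succ i) c) (Nat.add σ e))
      (filterKK (fun r => Nat.ble (Nat.mod (Nat.div r.1 m) 8) e) Fs [] fun Gs =>
        strict (Nat.mul m 8) fun m => strict (Nat.add σ e) fun σ => go i c m σ Gs) true)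
      (List.range (Nat.succ i)) = true from h) e (List.mem_range.2 (by omega))
    have h2 : Nat.ble (Nat.sub (Nat.succ i) c) (σ + e) = true := Nat.ble_eq_true_of_le hσ
    simp only [strict_eq, filterKK_eq, List.append_nil, Nat.mul_eq, Nat.add_eq] at h1
    rw [h2, sel_true] at h1
    have key : ∀ Z : List (ℕ × ℕ), (((Z.filter fun r =>
        Nat.ble (Nat.mod (Nat.div r.1 m) 8) e).reverse).filter fun x => digitsLE (m * 8) es' x.1) =
        (Z.filter fun x => digitsLE m (e :: es') x.1).reverse := by
      intro Z
      rw [List.filter_reverse, List.filter_filter]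
      congr 1
      apply List.filter_congr
      intro x _
      rw [Bool.eq_iff_iff]
      simp only [digitsLE, Bool.and_eq_true, decide_eq_true_eq, Nat.ble_eq]
      exact and_comm
    have mem : ∀ Z ∈ Fs, (Z.filter fun x => digitsLE m (e :: es') x.1) ≠ [] →
        (Z.filter fun r => Nat.ble (Nat.mod (Nat.div r.1 m) 8) e).reverse ∈
        ((Fs.map fun x => (x.filter fun r => Nat.ble (Nat.mod (Nat.div r.1 m) 8) e).reverse).filter
          fun x => !x.isEmpty).reverse := by
      intro Z hZ h0
      rw [List.mem_reverse, List.mem_filter]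
      refine ⟨List.mem_map.2 ⟨Z, hZ, rfl⟩, ?_⟩
      simp only [Bool.not_eq_eq_eq_not, Bool.not_true, List.isEmpty_eq_false_iff]
      intro hh
      apply h0
      have := key Z
      rw [hh] at this
      simpa using this.symm
    have h3 := ih h1 hes' (mem X hX hX0) (mem Y hY hY0) (by rw [key]; simpa using hX0)
      (by rw [key]; simpa using hY0)
    simpa [key, List.sum_reverse] using h3

theorem sum_pow_div_mod_eq_count {B : ℕ} (K : ℕ) {X : List ℕ} (hX : X.length < B) :
    (X.map (B ^ ·)).sum / B ^ K % B = X.count K := by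
  have hB : 0 < B := by omega
  obtain ⟨lo, hi, hs, hlo⟩ : ∃ lo hi, (X.map (B ^ ·)).sum =
      lo + X.count K * B ^ K + B ^ (K + 1) * hi ∧ lo * B ≤ X.length * B ^ K := by
    clear hX
    induction X with
    | nil => exact ⟨0, 0, by simp, by simp⟩
    | cons x X ih =>
      obtain ⟨lo, hi, hs, hlo⟩ := ih
      rcases lt_trichotomy x K with h | h | h
      · refine ⟨lo + B ^ x, hi, ?_, ?_⟩
        · rw [List.map_cons, List.sum_cons, hs, List.count_cons_of_ne h.ne]; ring
        · have : B ^ x * B ≤ B ^ K := by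
            rw [← pow_succ]; exact Nat.pow_le_pow_right hB h
          rw [List.length_cons]; linarith
      · subst h
        refine ⟨lo, hi, ?_, ?_⟩
        · rw [List.map_cons, List.sum_cons, hs, List.count_cons_self]; ring
        · rw [List.length_cons]; nlinarith [Nat.zero_le (B ^ x)]
      · refine ⟨lo, hi + B ^ (x - (K + 1)), ?_, ?_⟩
        · rw [List.map_cons, List.sum_cons, hs, List.count_cons_of_ne h.ne', mul_add, ← pow_add,
            Nat.add_sub_cancel' h]; ring
        · rw [List.length_cons]; nlinarith [Nat.zero_le (B ^ K)]
  have hK : 0 < B ^ K := Nat.pow_pos hB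
  have hlt : lo < B ^ K := by
    by_contra hc
    push Not at hc
    have h1 : B ^ K * B ≤ lo * B := Nat.mul_le_mul_right _ hc
    have h2 : X.length * B ^ K < B * B ^ K := Nat.mul_lt_mul_of_pos_right hX hK
    nlinarith
  have hc : X.count K < B := lt_of_le_of_lt List.count_le_length hX
  have h1 : (X.map (B ^ ·)).sum / B ^ K = X.count K + B * hi := by
    rw [hs, show lo + X.count K * B ^ K + B ^ (K + 1) * hi = lo + (X.count K + B * hi) * B ^ K by
      ring, Nat.add_mul_div_right _ _ hK, Nat.div_eq_of_lt hlt, zero_add]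
  rw [h1, Nat.add_mul_mod_self_left, Nat.mod_eq_of_lt hc]

/-- The number of pairs with sum `K`. -/
def hits (K : ℕ) (E F : List ℕ) : ℕ :=
  (E.map fun e => (F.map fun f => if e + f = K then 1 else 0).sum).sum

theorem count_eq_sum (K : ℕ) (F : List ℕ) :
    F.count K = (F.map fun f => if f = K then 1 else 0).sum := by
  induction F with
  | nil => simp
  | cons x F ih => rw [List.count_cons, ih, List.map_cons, List.sum_cons, add_comm]; simp

theorem hits_eq_count (K : ℕ) (E F : List ℕ) :
    hits K E F = (E.flatMap fun e => F.map (e + ·)).count K := by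
  induction E with
  | nil => simp [hits]
  | cons e E ih =>
    rw [List.flatMap_cons, List.count_append, ← ih, count_eq_sum]
    simp [hits, Function.comp_def]

theorem sum_map_pow_mul (B : ℕ) (E F : List ℕ) :
    (E.map (B ^ ·)).sum * (F.map (B ^ ·)).sum =
      ((E.flatMap fun e => F.map (e + ·)).map (B ^ ·)).sum := by
  induction E with
  | nil => simp
  | cons e E ih =>
    simp only [List.map_cons, List.sum_cons, List.flatMap_cons, List.map_append, List.sum_append,
      add_mul, ih, List.map_map]
    congr 1
    rw [← List.sum_map_mul_left]
    congr 1
    apply List.map_congr_left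
    intro f _
    simp [pow_add]

theorem hits_le_of_pairOk {E F : List ℕ} (hE : E.length ≤ 1023) (hF : F.length ≤ 1023)
    (h : pairOk (E.map (1100003 ^ ·)).sum (F.map (1100003 ^ ·)).sum = true) :
    hits 240 E F ≤ hits 384 E F := by
  have hlen : (E.flatMap fun e => F.map (e + ·)).length < 1100003 := by
    have : (E.flatMap fun e => F.map (e + ·)).length = E.length * F.length := by simp
    rw [this]
    calc _ ≤ 1023 * 1023 := Nat.mul_le_mul hE hF
      _ < _ := by norm_num
  have key : ∀ K, digit K ((E.map (1100003 ^ ·)).sum * (F.map (1100003 ^ ·)).sum) = hits K E F := by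
    intro K
    rw [hits_eq_count, ← sum_pow_div_mod_eq_count K hlen, ← sum_map_pow_mul]
    rfl
  rw [pairOk, strict_eq] at h
  have := Nat.le_of_ble_eq_true h
  rwa [Nat.mul_eq, key, key] at this

theorem hits_append_left (K : ℕ) (E E' F : List ℕ) :
    hits K (E ++ E') F = hits K E F + hits K E' F := by simp [hits]

theorem hits_append_right (K : ℕ) (E F F' : List ℕ) :
    hits K E (F ++ F') = hits K E F + hits K E F' := by
  simp [hits, List.sum_map_add]

theorem hits_flatMap {α β : Type} (K : ℕ) (X : List α) (Y : List β) (E : α → List ℕ)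
    (F : β → List ℕ) : hits K (X.flatMap E) (Y.flatMap F) =
      (X.map fun x => (Y.map fun y => hits K (E x) (F y)).sum).sum := by
  induction X with
  | nil => simp [hits]
  | cons x X ih =>
    rw [List.flatMap_cons, hits_append_left, ih, List.map_cons, List.sum_cons]
    congr 1
    clear ih
    induction Y with
    | nil => simp [hits]
    | cons y Y ihY => rw [List.flatMap_cons, hits_append_right, ihY, List.map_cons, List.sum_cons]

theorem hits_eq_zero {K : ℕ} {E F : List ℕ} (h : ∀ e ∈ E, ∀ f ∈ F, e + f ≠ K) :
    hits K E F = 0 := by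
  rw [hits_eq_count, List.count_eq_zero]
  simp only [List.mem_flatMap, List.mem_map, not_exists, not_and]
  exact fun e he f hf => h e he f hf

/-- Weights with `n` entries that are octal digits. -/
def Row (n : ℕ) (t : List ℕ) : Prop := t.length = n ∧ ∀ x ∈ t, x ≤ 7

theorem code_injective {n : ℕ} {t t' : List ℕ} (h : Row n t) (h' : Row n t')
    (he : code t = code t') : t = t' := by
  induction t generalizing n t' with
  | nil =>
    obtain rfl : n = 0 := h.1.symm
    exact (List.length_eq_zero_iff.1 h'.1).symm
  | cons x t ih =>
    cases t' with
    | nil => have h1 := h.1; have h2 := h'.1; simp at h1 h2; omega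
    | cons x' t' =>
      change x + 8 * code t = x' + 8 * code t' at he
      have h1 := h.2 x (by simp)
      have h2 := h'.2 x' (by simp)
      have hc : code t = code t' := by omega
      have hx : x = x' := by omega
      rw [hx, ih (n := n - 1) ⟨by have := h.1; simp at this; omega, fun y hy => h.2 y (by simp [hy])⟩
        ⟨by have := h'.1; simp at this; omega, fun y hy => h'.2 y (by simp [hy])⟩ hc]

theorem countGt_eq (j : ℕ) (t : List ℕ) (c : ℕ) :
    countGt j t c = c + t.countP fun x => decide (j < x) := by
  induction t generalizing c with
  | nil => rfl
  | cons x t ih =>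
    change sel (Nat.ble (Nat.succ j) x) (strict (Nat.succ c) (countGt j t)) (countGt j t c) = _
    rw [strict_eq, sel_eq_ite, ih, ih, List.countP_cons]
    simp only [Nat.ble_eq, Nat.succ_eq_add_one, Nat.succ_le_iff, decide_eq_true_eq]
    split_ifs <;> omega

theorem cnj_succ (t : List ℕ) (n j : ℕ) :
    cnj t (n + 1) j = (t.countP fun x => decide (j < x)) :: cnj t n (j + 1) := by
  change countGt j t 0 :: cnj t n (j + 1) = _
  rw [countGt_eq, zero_add]

theorem cnj_eq (t : List ℕ) (n j : ℕ) :
    cnj t n j = (List.range n).map fun k => t.countP fun x => decide (j + k < x) := by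
  induction n generalizing j with
  | zero => rfl
  | succ n ih =>
    rw [cnj_succ, ih, List.range_succ_eq_map, List.map_cons, List.map_map]
    simp [Function.comp_def, Nat.add_assoc, Nat.add_comm 1]

theorem row_cnj {n : ℕ} (hn : n ≤ 7) {t : List ℕ} (ht : Row n t) : Row n (cnj t n 0) := by
  rw [cnj_eq]
  refine ⟨by simp, fun x hx => ?_⟩
  obtain ⟨k, -, rfl⟩ := List.mem_map.1 hx
  exact List.countP_le_length.trans (ht.1.trans_le hn)

theorem look_cases (c : ℕ) (l : List (ℕ × ℕ)) :
    look c l = 0 ∨ ∃ p ∈ l, p.1 = c ∧ look c l = p.2 := by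
  induction l with
  | nil => exact Or.inl rfl
  | cons x l ih =>
    have hl : look c (x :: l) = sel (Nat.beq c x.1) x.2 (look c l) := rfl
    cases h : Nat.beq c x.1 <;> rw [h] at hl
    · rcases ih with h0 | ⟨p, hp, h1, h2⟩
      · exact Or.inl (hl.trans h0)
      · exact Or.inr ⟨p, List.mem_cons_of_mem _ hp, h1, hl.trans h2⟩
    · exact Or.inr ⟨x, List.mem_cons_self, (Nat.eq_of_beq_eq_true h).symm, hl⟩

theorem index_eq (c : ℕ) (l : List ℕ) (k : ℕ) : index c l k = k + l.idxOf c := by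
  induction l generalizing k with
  | nil => rfl
  | cons x l ih =>
    change sel (Nat.beq c x) k (strict (Nat.succ k) (index c l)) = _
    rw [strict_eq, ih, sel_eq_ite, List.idxOf_cons]
    by_cases h : c = x
    · subst h; simp
    · have h1 : Nat.beq c x = false := by
        rw [← Bool.not_eq_true]; exact fun hh => h (Nat.eq_of_beq_eq_true hh)
      have h2 : (x == c) = false := by simpa using fun hh => h hh.symm
      simp only [h1, h2, cond_false, Bool.false_eq_true, if_false]
      omega

structure IsTable (n o : ℕ) (C : List ℕ) (tab : List (ℕ × ℕ)) : Prop where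
  length_le : C.length ≤ 36
  exists_row : ∀ p ∈ tab, ∃ t, Row n t ∧ cnj (cnj t n 0) n 0 = t ∧ code t ∈ C ∧
    p = (code t, entry o n C t)

theorem mkTable_sound {n : ℕ} (hn : n ≤ 7) {o : ℕ} {C : List ℕ} {L : List (List ℕ)}
    (hL : ∀ t ∈ L, code t ∈ C) {acc : List (ℕ × ℕ)} {f : List (ℕ × ℕ) → Bool}
    (hC : C.length ≤ 36) (hacc : IsTable n o C acc) (h : mkTable n o C L acc f = true) :
    ∃ tab, IsTable n o C tab ∧ f tab = true := by
  induction L generalizing acc with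
  | nil => exact ⟨acc, hacc, h⟩
  | cons t L ih =>
    change sel (goodRow n t) (strict (code t) fun c => strict (entry o n C t) fun v =>
      mkTable n o C L ((c, v) :: acc) f) false = true at h
    cases hg : goodRow n t <;> rw [hg] at h
    · simp at h
    · simp only [strict_eq, sel_true] at h
      rw [goodRow, sel_eq_ite, sel_eq_ite] at hg
      split_ifs at hg with h1 h2
      have hrow : Row n t :=
        ⟨Nat.eq_of_beq_eq_true h1, fun x hx => Nat.le_of_ble_eq_true (allB_iff.1 h2 x hx)⟩
      refine ih (fun t ht => hL t (List.mem_cons_of_mem _ ht)) ⟨hC, ?_⟩ h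
      refine List.forall_mem_cons.2 ⟨⟨t, hrow, ?_, hL t List.mem_cons_self, rfl⟩, hacc.2⟩
      exact code_injective (row_cnj hn (row_cnj hn hrow)) hrow (Nat.eq_of_beq_eq_true hg)

theorem table_sound {n : ℕ} (hn : n ≤ 7) {s o : ℕ} {f : List (ℕ × ℕ) → Bool}
    (h : table n s o f = true) : ∃ C tab, IsTable n o C tab ∧ f tab = true := by
  obtain ⟨L, hL⟩ := parts_sound n n s _ (fun t acc f h => ⟨t :: acc, by simpa using h⟩) _ _ h
  rw [mapK_eq code (fun t f => strict (code t) f) L (fun x f => strict_eq _ _)] at hL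
  set C := (L.map code).reverse ++ [] with hC
  cases hc : Nat.ble C.length 36 <;> rw [hc] at hL
  · simp at hL
  · have hc' := Nat.le_of_ble_eq_true hc
    obtain ⟨tab, h1, h2⟩ := mkTable_sound hn (fun t ht => by simp [hC]; exact ⟨t, ht, rfl⟩) hc'
      ⟨hc', by simp⟩ hL
    exact ⟨C, tab, h1, h2⟩

theorem IsTable.look_eq {n o : ℕ} {C : List ℕ} {tab : List (ℕ × ℕ)} (h : IsTable n o C tab)
    {t : List ℕ} (ht : Row n t) (h0 : look (code t) tab ≠ 0) :
    cnj (cnj t n 0) n 0 = t ∧ code t ∈ C ∧ look (code t) tab =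
      1100003 ^ (o + C.idxOf (code t)) + 1100003 ^ (240 + o - C.idxOf (code (cnj t n 0))) := by
  obtain h1 | ⟨p, hp, h1, h2⟩ := look_cases (code t) tab
  · exact absurd h1 h0
  · obtain ⟨t', hr, hcc, hm, rfl⟩ := h.2 p hp
    obtain rfl := code_injective hr ht h1
    refine ⟨hcc, hm, h2.trans ?_⟩
    simp only [entry, index_eq, zero_add]
    rfl

theorem length_of_mem_stripList {t : List ℕ} {p s : ℕ} {T : List Bool}
    (h : T ∈ stripList t p s) : T.length = t.length := by
  induction t generalizing p s T with
  | nil =>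
    simp only [stripList] at h
    split_ifs at h <;> simp_all
  | cons x t ih =>
    simp only [stripList, List.mem_append, List.mem_map] at h
    rcases h with ⟨T', h, rfl⟩ | h
    · simp [ih h]
    · split_ifs at h
      · obtain ⟨T', h', rfl⟩ := List.mem_map.1 h
        simp [ih h']
      · simp at h

theorem length_stripList_zero (t : List ℕ) (p : ℕ) : (stripList t p 0).length ≤ 1 := by
  induction t generalizing p with
  | nil => simp [stripList]
  | cons x t ih => simpa [stripList] using ih x

theorem length_stripList_one (t : List ℕ) (p : ℕ) : (stripList t p 1).length ≤ t.length := by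
  induction t generalizing p with
  | nil => simp [stripList]
  | cons x t ih =>
    simp only [stripList, List.length_append, List.length_map, List.length_cons]
    refine Nat.add_le_add (ih x) ?_
    split_ifs
    · simpa using length_stripList_zero t (x + 1)
    · simp

theorem length_addCol {t : List ℕ} {T : List Bool} (h : T.length = t.length) :
    (addCol t T).length = t.length := by
  induction t generalizing T with
  | nil => simp [addCol_nil]
  | cons x t ih =>
    cases T with
    | nil => simp at h
    | cons b T => rw [addCol_cons]; simp at h ⊢; exact ih h

theorem addCol_le {t : List ℕ} {T : List Bool} (h : T.length = t.length) {k : ℕ}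
    (hk : ∀ x ∈ t, x ≤ k) : ∀ x ∈ addCol t T, x ≤ k + 1 := by
  induction t generalizing T with
  | nil => simp [addCol_nil]
  | cons x t ih =>
    cases T with
    | nil => simp at h
    | cons b T =>
      rw [addCol_cons]
      have := hk x (by simp)
      refine List.forall_mem_cons.2 ⟨by split_ifs <;> omega, ih (by simpa using h) fun y hy =>
        hk y (List.mem_cons_of_mem _ hy)⟩

theorem bounded_of_mem_chainList {L : List ℕ} {r : ℕ} {S : List Bool} {t : List ℕ} {k : ℕ}
    (hk : ∀ x ∈ t, x ≤ k) {x : ℕ × List Bool × List ℕ} (hx : x ∈ chainList L r S t) :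
    x.2.2.length = t.length ∧ ∀ y ∈ x.2.2, y ≤ k + L.length := by
  induction L generalizing r S t k with
  | nil => simp only [chainList, List.mem_singleton] at hx; subst hx; simpa using hk
  | cons s L ih =>
    simp only [chainList, List.mem_flatMap] at hx
    obtain ⟨T, hT, hx⟩ := hx
    have hl := length_of_mem_stripList hT
    obtain ⟨h1, h2⟩ := ih (addCol_le hl hk) hx
    refine ⟨h1.trans (length_addCol hl), fun y hy => (h2 y hy).trans ?_⟩
    rw [List.length_cons]; omega

/-- The weights obtained by adding one more letter `b` to `t`, where `b` may stand right of the
strip `S`, pushed down by at most `d - 1`. -/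
noncomputable def exts (d : ℕ) (S : List Bool) (t : List ℕ) : List (List ℕ) :=
  ((stripList t 100 1).filter fun T => decide (need S T 0 0 0 + 1 ≤ d)).map (addCol t)

theorem length_exts (d : ℕ) (S : List Bool) (t : List ℕ) : (exts d S t).length ≤ t.length := by
  rw [exts, List.length_map]
  exact (List.length_filter_le _ _).trans (length_stripList_one t 100)

theorem bounded_of_mem_exts {d : ℕ} {S : List Bool} {t u : List ℕ} (hu : u ∈ exts d S t) {k : ℕ}
    (hk : ∀ x ∈ t, x ≤ k) : u.length = t.length ∧ ∀ x ∈ u, x ≤ k + 1 := by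
  obtain ⟨T, hT, rfl⟩ := List.mem_map.1 hu
  have hl := length_of_mem_stripList (List.mem_filter.1 hT).1
  exact ⟨length_addCol hl, addCol_le hl hk⟩

/-- The weight recorded for a chain. -/
noncomputable def recorded (d : ℕ) (tab tab' : List (ℕ × ℕ)) (x : ℕ × List Bool × List ℕ) : ℕ :=
  look (code x.2.2) tab + ((exts d x.2.1 x.2.2).map fun u => look (code u) tab').sum

theorem record_sound {d : ℕ} {tab tab' : List (ℕ × ℕ)} {r : ℕ} {S : List Bool} {t : List ℕ}
    {acc : List (ℕ × ℕ)} {f : List (ℕ × ℕ) → Bool} (h : record d tab tab' r S t acc f = true) :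
    look (code t) tab ≠ 0 ∧ f ((r, recorded d tab tab' (r, S, t)) :: acc) = true := by
  rw [record, strict_eq, strips_eq] at h
  cases hw : Nat.ble 1 (look (code t) tab) <;> rw [hw] at h
  · simp at h
  · rw [sel_true] at h
    have hw' := Nat.le_of_ble_eq_true hw
    refine ⟨by omega, ?_⟩
    have key : ∀ (Z : List (List Bool)) (a : ℕ) (f : ℕ → Bool),
        seqK Z (fun T acc f => sel (Nat.ble (Nat.succ (need S T 0 0 0)) d)
          (strict (Nat.add acc (look (code (addCol t T)) tab')) f) (f acc)) a f =
        f (a + (((Z.filter fun T => decide (need S T 0 0 0 + 1 ≤ d)).map (addCol t)).map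
          fun u => look (code u) tab').sum) := by
      intro Z
      induction Z with
      | nil => intro a f; simp [seqK]
      | cons T Z ih =>
        intro a f
        rw [seqK]
        by_cases hd : need S T 0 0 0 + 1 ≤ d
        · have : Nat.ble (Nat.succ (need S T 0 0 0)) d = true := Nat.ble_eq_true_of_le hd
          rw [this, sel_true, strict_eq, ih, List.filter_cons_of_pos (by simpa using hd)]
          simp only [List.map_cons, List.sum_cons, Nat.add_eq, Nat.add_assoc]
        · have : Nat.ble (Nat.succ (need S T 0 0 0)) d = false := by
            rw [← Bool.not_eq_true, Nat.ble_eq]; exact hd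
          simp only [this, sel_false, ih]
          rw [List.filter_cons_of_neg (by simpa using hd)]
    rw [key] at h
    exact h

theorem family_sound {i d : ℕ} {tab tab' : List (ℕ × ℕ)} {l : List ℕ}
    {f : List (ℕ × ℕ) → Bool} (h : family i d tab tab' l f = true) :
    ∀ C, C = chainList (l ++ [d]) 0 (List.replicate (i + 1) false) (List.replicate (i + 1) 0) →
    (C.length * (2 * i + 4) ≤ 1023 ∧ ∀ x ∈ C, look (code x.2.2) tab ≠ 0) ∧
      f (C.map fun x => (x.1, recorded d tab tab' x)).reverse = true := by
  rintro C hC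
  rw [family, chains_eq, ← hC] at h
  have key : ∀ (Z : List (ℕ × List Bool × List ℕ)) (a : List (ℕ × ℕ)) (f : List (ℕ × ℕ) → Bool),
      seqK Z (fun x => record d tab tab' x.1 x.2.1 x.2.2) a f = true →
      (∀ x ∈ Z, look (code x.2.2) tab ≠ 0) ∧
        f ((Z.map fun x => (x.1, recorded d tab tab' x)).reverse ++ a) = true := by
    intro Z
    induction Z with
    | nil => intro a f h; exact ⟨by simp, h⟩
    | cons x Z ih =>
      intro a f h
      rw [seqK] at h
      obtain ⟨h1, h2⟩ := record_sound h
      obtain ⟨h3, h4⟩ := ih _ _ h2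
      exact ⟨List.forall_mem_cons.2 ⟨h1, h3⟩, by simpa using h4⟩
  obtain ⟨h1, h2⟩ := key _ _ _ h
  rw [List.append_nil] at h2
  cases hb : Nat.ble (Nat.mul (C.map fun x => (x.1, recorded d tab tab' x)).reverse.length
    (2 * i + 4)) 1023 <;> rw [hb] at h2
  · simp at h2
  · have := Nat.le_of_ble_eq_true hb
    rw [List.length_reverse, List.length_map] at this
    exact ⟨⟨this, h1⟩, h2⟩

theorem mapK_sound {α β : Type} {P : α → Prop} {u : α → β} {g : α → (β → Bool) → Bool}
    (hg : ∀ x f, g x f = true → P x ∧ f (u x) = true) {l : List α} {acc : List β}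
    {f : List β → Bool} (h : mapK g l acc f = true) :
    (∀ x ∈ l, P x) ∧ f ((l.map u).reverse ++ acc) = true := by
  induction l generalizing acc with
  | nil => exact ⟨by simp, h⟩
  | cons x l ih =>
    obtain ⟨h1, h2⟩ := hg x _ (show g x (fun y => mapK g l (y :: acc) f) = true from h)
    obtain ⟨h3, h4⟩ := ih h2
    exact ⟨List.forall_mem_cons.2 ⟨h1, h3⟩, by simpa using h4⟩


theorem hits_pair {K : ℕ} (a b c d : ℕ) : hits K [a, b] [c, d] =
    ((if a + c = K then 1 else 0) + if a + d = K then 1 else 0) +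
    ((if b + c = K then 1 else 0) + if b + d = K then 1 else 0) := by
  simp [hits]

theorem hits_nil_left (K : ℕ) (F : List ℕ) : hits K [] F = 0 := by simp [hits]

theorem hits_nil_right (K : ℕ) (E : List ℕ) : hits K E [] = 0 := by simp [hits]

/-- The exponents that record the weight `t` with offset `o`. -/
noncomputable def slots (n o : ℕ) (C t : List ℕ) : List ℕ :=
  [o + C.idxOf (code t), 240 + o - C.idxOf (code (cnj t n 0))]

/-- The exponents of the weights `u` of the second table. -/
noncomputable def slots' (n : ℕ) (C : List ℕ) (tab : List (ℕ × ℕ)) (u : List ℕ) : List ℕ :=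
  if look (code u) tab = 0 then [] else slots n 72 C u

theorem IsTable.hits_slots {n : ℕ} {C : List ℕ} {tab : List (ℕ × ℕ)} (h : IsTable n 0 C tab)
    {t t' : List ℕ} (ht : Row n t) (ht0 : look (code t) tab ≠ 0) :
    2 * (if t' = cnj t n 0 then 1 else 0) ≤ hits 240 (slots n 0 C t) (slots n 0 C t') := by
  split_ifs with he
  · obtain ⟨h1, -, -⟩ := h.look_eq ht ht0
    subst he
    have hl := h.length_le
    have h2 : C.idxOf (code t) ≤ C.length := List.idxOf_le_length
    have h3 : C.idxOf (code (cnj t n 0)) ≤ C.length := List.idxOf_le_length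
    simp only [slots, hits_pair, h1]
    rw [if_pos (show 0 + C.idxOf (code t) + (240 + 0 - C.idxOf (code t)) = 240 by omega),
      if_pos (show 240 + 0 - C.idxOf (code (cnj t n 0)) + (0 + C.idxOf (code (cnj t n 0))) = 240
        by omega)]
    omega
  · omega

theorem IsTable.hits_slots' {n : ℕ} (hn : n ≤ 7) {C : List ℕ} {tab : List (ℕ × ℕ)}
    (h : IsTable n 72 C tab) {t t' : List ℕ} (ht : Row n t) (ht' : Row n t') :
    hits 384 (slots' n C tab t) (slots' n C tab t') ≤ 2 * if t' = cnj t n 0 then 1 else 0 := by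
  unfold slots'
  by_cases h0 : look (code t) tab = 0
  · simp [h0, hits_nil_left]
  by_cases h0' : look (code t') tab = 0
  · simp [h0', hits_nil_right]
  rw [if_neg h0, if_neg h0']
  obtain ⟨h1, hm, -⟩ := h.look_eq ht h0
  obtain ⟨h1', hm', -⟩ := h.look_eq ht' h0'
  clear h0 h0'
  have hl := h.length_le
  have h2 : C.idxOf (code t) < C.length := List.idxOf_lt_length_iff.2 hm
  have h2' : C.idxOf (code t') < C.length := List.idxOf_lt_length_iff.2 hm'
  have h3 : C.idxOf (code (cnj t n 0)) ≤ C.length := List.idxOf_le_length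
  have h3' : C.idxOf (code (cnj t' n 0)) ≤ C.length := List.idxOf_le_length
  simp only [slots, hits_pair]
  by_cases hne : t' = cnj t n 0
  · rw [if_pos hne, if_neg (by omega)]
    split_ifs <;> omega
  · rw [if_neg hne, if_neg (by omega), if_neg, if_neg, if_neg (by omega)]
    · intro he
      have he' : C.idxOf (code t') = C.idxOf (code (cnj t n 0)) := by omega
      exact hne (code_injective ht' (row_cnj hn ht) ((List.idxOf_inj hm').1 he'))
    · intro he
      have he' : C.idxOf (code t) = C.idxOf (code (cnj t' n 0)) := by omega
      have := code_injective ht (row_cnj hn ht') ((List.idxOf_inj hm).1 he')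
      rw [this, h1'] at hne
      exact hne rfl


theorem sum_map_le_sum_map {α : Type} {X : List α} {f g : α → ℕ} (h : ∀ x ∈ X, f x ≤ g x) :
    (X.map f).sum ≤ (X.map g).sum := List.sum_le_sum h

/-- The exponents recorded for a chain. -/
noncomputable def chainSlots (n d : ℕ) (C C' : List ℕ) (tab' : List (ℕ × ℕ))
    (x : ℕ × List Bool × List ℕ) : List ℕ :=
  slots n 0 C x.2.2 ++ (exts d x.2.1 x.2.2).flatMap (slots' n C' tab')

theorem mem_slots {n o : ℕ} {C t : List ℕ} (hC : C.length ≤ 36) {e : ℕ} (he : e ∈ slots n o C t) :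
    o ≤ e ∧ e ≤ o + 36 ∨ 204 + o ≤ e ∧ e ≤ 240 + o := by
  have h2 : C.idxOf (code t) ≤ C.length := List.idxOf_le_length
  have h3 : C.idxOf (code (cnj t n 0)) ≤ C.length := List.idxOf_le_length
  simp only [slots, List.mem_cons, List.not_mem_nil, or_false] at he
  omega

theorem mem_flatMap_slots' {n : ℕ} {C : List ℕ} {tab : List (ℕ × ℕ)} {U : List (List ℕ)}
    (hC : C.length ≤ 36) {e : ℕ} (he : e ∈ U.flatMap (slots' n C tab)) :
    72 ≤ e ∧ e ≤ 108 ∨ 276 ≤ e ∧ e ≤ 312 := by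
  obtain ⟨u, -, he⟩ := List.mem_flatMap.1 he
  unfold slots' at he
  split_ifs at he
  · simp at he
  · exact mem_slots hC he

theorem length_chainSlots (n d : ℕ) (C C' : List ℕ) (tab' : List (ℕ × ℕ))
    (x : ℕ × List Bool × List ℕ) :
    (chainSlots n d C C' tab' x).length ≤ 2 + 2 * x.2.2.length := by
  have h : ∀ U : List (List ℕ), (U.flatMap (slots' n C' tab')).length ≤ 2 * U.length := by
    intro U
    induction U with
    | nil => simp
    | cons u U ih =>
      rw [List.flatMap_cons, List.length_append, List.length_cons]
      have : (slots' n C' tab' u).length ≤ 2 := by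
        unfold slots'; split_ifs <;> simp [slots]
      omega
  rw [chainSlots, List.length_append]
  have h1 := h (exts d x.2.1 x.2.2)
  have h2 := length_exts d x.2.1 x.2.2
  have h3 : (slots n 0 C x.2.2).length = 2 := rfl
  omega

theorem sum_pow_chainSlots {n d : ℕ} {C C' : List ℕ} {tab tab' : List (ℕ × ℕ)}
    (h : IsTable n 0 C tab) (h' : IsTable n 72 C' tab') {x : ℕ × List Bool × List ℕ}
    (hx : x.2.2.length = n ∧ ∀ y ∈ x.2.2, y ≤ 6) (h0 : look (code x.2.2) tab ≠ 0) :
    ((chainSlots n d C C' tab' x).map (1100003 ^ ·)).sum = recorded d tab tab' x := by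
  rw [chainSlots, List.map_append, List.sum_append, recorded,
    (h.look_eq ⟨hx.1, fun y hy => (hx.2 y hy).trans (by norm_num)⟩ h0).2.2]
  refine congrArg₂ _ ?_ ?_
  · simp [slots]
  · have key : ∀ U : List (List ℕ), (∀ u ∈ U, Row n u) →
        ((U.flatMap (slots' n C' tab')).map (1100003 ^ ·)).sum =
          (U.map fun u => look (code u) tab').sum := by
      intro U hU
      induction U with
      | nil => simp
      | cons u U ih =>
        rw [List.flatMap_cons, List.map_append, List.sum_append, List.map_cons, List.sum_cons,
          ih fun u hu => hU u (List.mem_cons_of_mem _ hu)]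
        congr 1
        unfold slots'
        split_ifs with h0
        · simp [h0]
        · rw [(h'.look_eq (hU u List.mem_cons_self) h0).2.2]
          simp [slots]
    refine key _ fun u hu => ?_
    obtain ⟨h1, h2⟩ := bounded_of_mem_exts hu hx.2
    exact ⟨h1.trans hx.1, h2⟩

theorem hits_chainSlots {n d : ℕ} (hn : n ≤ 6) {C C' : List ℕ} {tab tab' : List (ℕ × ℕ)}
    (h : IsTable n 0 C tab) (h' : IsTable n 72 C' tab') {x y : ℕ × List Bool × List ℕ}
    (hx : x.2.2.length = n ∧ ∀ z ∈ x.2.2, z ≤ 6) (hy : y.2.2.length = n ∧ ∀ z ∈ y.2.2, z ≤ 6)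
    (h0 : look (code x.2.2) tab ≠ 0) :
    2 * (if y.2.2 = cnj x.2.2 n 0 then 1 else 0) ≤
      hits 240 (chainSlots n d C C' tab' x) (chainSlots n d C C' tab' y) ∧
    hits 384 (chainSlots n d C C' tab' x) (chainSlots n d C C' tab' y) ≤
      2 * ((exts d x.2.1 x.2.2).map fun u => ((exts d y.2.1 y.2.2).map fun v =>
        if v = cnj u n 0 then 1 else 0).sum).sum := by
  have hC := h.length_le
  have hC' := h'.length_le
  have e1 := @mem_slots n 0 C x.2.2 hC
  have e2 := @mem_slots n 0 C y.2.2 hC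
  have e3 := @mem_flatMap_slots' n C' tab' (exts d x.2.1 x.2.2) hC'
  have e4 := @mem_flatMap_slots' n C' tab' (exts d y.2.1 y.2.2) hC'
  simp only [chainSlots, hits_append_left, hits_append_right]
  constructor
  · have := h.hits_slots (t' := y.2.2) ⟨hx.1, fun y hy => (hx.2 y hy).trans (by norm_num)⟩ h0
    omega
  · rw [hits_eq_zero (E := slots n 0 C x.2.2) (F := slots n 0 C y.2.2), hits_eq_zero
      (E := slots n 0 C x.2.2) (F := (exts d y.2.1 y.2.2).flatMap (slots' n C' tab')), hits_eq_zero
      (E := (exts d x.2.1 x.2.2).flatMap (slots' n C' tab')) (F := slots n 0 C y.2.2), hits_flatMap]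
    · simp only [zero_add, add_zero, ← List.sum_map_mul_left]
      refine sum_map_le_sum_map fun u hu => sum_map_le_sum_map fun v hv =>
        h'.hits_slots' (by omega) ?_ ?_
      · obtain ⟨h1, h2⟩ := bounded_of_mem_exts hu hx.2
        exact ⟨h1.trans hx.1, h2⟩
      · obtain ⟨h1, h2⟩ := bounded_of_mem_exts hv hy.2
        exact ⟨h1.trans hy.1, h2⟩
    · intro e he f hf
      have := e3 he
      have := e2 hf
      omega
    · intro e he f hf
      have := e1 he
      have := e4 hf
      omega
    · intro e he f hf
      have := e1 he
      have := e2 hf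
      omega

/-- The chains with the given sizes and offsets. -/
noncomputable def chainsIn (i d : ℕ) (es l : List ℕ) : List (ℕ × List Bool × List ℕ) :=
  (chainList (l ++ [d]) 0 (List.replicate (i + 1) false) (List.replicate (i + 1) 0)).filter
    fun x => digitsLE 1 es x.1

theorem length_of_mem_sizesOf {k i s : ℕ} {l : List ℕ} (h : l ∈ sizesOf k i s) : l.length = k := by
  induction k generalizing s l with
  | zero =>
    rw [sizesOf] at h
    cases hs : s.beq 0 <;> simp_all
  | succ k ih =>
    rw [sizesOf, List.mem_flatMap] at h
    obtain ⟨x, -, h⟩ := h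
    cases hs : x.ble s <;> rw [hs] at h
    · simp at h
    · obtain ⟨l', h', rfl⟩ := List.mem_map.1 h
      simp [ih h']

theorem sum_chainsIn_le {i d s : ℕ} (hi : i ≤ 5) (h1 : 1 ≤ i) (h : checkSize i d s = true)
    {l m es : List ℕ} (hl : l ∈ sizesOf (i - 1) i s) (hm : m ∈ sizesOf (i - 1) i s)
    (hes : TailLarge i (i - 1) d es) :
    ((chainsIn i d es l).map fun x => ((chainsIn i d es m).map fun y =>
      if y.2.2 = cnj x.2.2 (i + 1) 0 then 1 else 0).sum).sum ≤
    ((chainsIn i d es l).map fun x => ((chainsIn i d es m).map fun y =>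
      ((exts d x.2.1 x.2.2).map fun u => ((exts d y.2.1 y.2.2).map fun v =>
        if v = cnj u (i + 1) 0 then 1 else 0).sum).sum).sum).sum := by
  by_cases hX0 : chainsIn i d es l = []
  · simp [hX0]
  by_cases hY0 : chainsIn i d es m = []
  · simp [hY0]
  obtain ⟨C, tab, ht, h⟩ := table_sound (by omega) h
  obtain ⟨C', tab', ht', h⟩ := table_sound (by omega) h
  obtain ⟨hP, hgo⟩ := mapK_sound
    (P := fun l => ∀ C, C = chainList (l ++ [d]) 0 (List.replicate (i + 1) false)
      (List.replicate (i + 1) 0) → C.length * (2 * i + 4) ≤ 1023 ∧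
        ∀ x ∈ C, look (code x.2.2) tab ≠ 0)
    (u := fun l => ((chainList (l ++ [d]) 0 (List.replicate (i + 1) false)
      (List.replicate (i + 1) 0)).map fun x => (x.1, recorded d tab tab' x)).reverse)
    (g := fun l f => family i d tab tab' l f)
    (fun l f h => ⟨fun C hC => (family_sound h C hC).1, (family_sound h _ rfl).2⟩) h
  rw [List.append_nil] at hgo
  set R : List ℕ → List (ℕ × ℕ) := fun l => ((chainList (l ++ [d]) 0
    (List.replicate (i + 1) false) (List.replicate (i + 1) 0)).map
      fun x => (x.1, recorded d tab tab' x)).reverse with hR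
  have hfil : ∀ l, (R l).filter (fun x => digitsLE 1 es x.1) =
      ((chainsIn i d es l).map fun x => (x.1, recorded d tab tab' x)).reverse := by
    intro l
    rw [hR, chainsIn, List.filter_reverse, List.filter_map]
    rfl
  have hmem : ∀ l ∈ sizesOf (i - 1) i s, R l ∈ ((sizesOf (i - 1) i s).map R).reverse :=
    fun l hl => List.mem_reverse.2 (List.mem_map_of_mem hl)
  have hok := go_sound hgo hes (hmem l hl) (hmem m hm) (by rw [hfil]; simpa using hX0)
    (by rw [hfil]; simpa using hY0)
  simp only [hfil, List.map_reverse, List.sum_reverse, List.map_map] at hok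
  have hbd : ∀ l ∈ sizesOf (i - 1) i s, ∀ x ∈ chainsIn i d es l,
      (x.2.2.length = i + 1 ∧ ∀ y ∈ x.2.2, y ≤ 6) ∧ look (code x.2.2) tab ≠ 0 := by
    intro l hl x hx
    have hx' := List.mem_of_mem_filter hx
    obtain ⟨h2, h3⟩ := bounded_of_mem_chainList (k := 0)
      (fun x hx => (List.eq_of_mem_replicate hx).le) hx'
    refine ⟨⟨by simpa using h2, fun y hy => (h3 y hy).trans ?_⟩, (hP l hl _ rfl).2 x hx'⟩
    rw [List.length_append, length_of_mem_sizesOf hl, List.length_singleton]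
    omega
  have hsum : ∀ l ∈ sizesOf (i - 1) i s,
      ((chainsIn i d es l).map (Prod.snd ∘ fun x => (x.1, recorded d tab tab' x))).sum =
      (((chainsIn i d es l).flatMap (chainSlots (i + 1) d C C' tab')).map (1100003 ^ ·)).sum := by
    intro l hl
    have hb := hbd l hl
    generalize chainsIn i d es l = X at hb
    induction X with
    | nil => simp
    | cons x X ih =>
      rw [List.map_cons, List.sum_cons, List.flatMap_cons, List.map_append, List.sum_append,
        ih fun x hx => hb x (List.mem_cons_of_mem _ hx),
        sum_pow_chainSlots ht ht' (hb x List.mem_cons_self).1 (hb x List.mem_cons_self).2]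
      rfl
  have hlen : ∀ l ∈ sizesOf (i - 1) i s,
      ((chainsIn i d es l).flatMap (chainSlots (i + 1) d C C' tab')).length ≤ 1023 := by
    intro l hl
    refine le_trans ?_ (hP l hl _ rfl).1
    refine le_trans ?_ (Nat.mul_le_mul_right _ (List.length_filter_le (fun x => digitsLE 1 es x.1) _))
    change _ ≤ (chainsIn i d es l).length * _
    have hb := hbd l hl
    generalize chainsIn i d es l = X at hb
    induction X with
    | nil => simp
    | cons x X ih =>
      rw [List.flatMap_cons, List.length_append, List.length_cons, add_mul]
      have h2 := ih fun x hx => hb x (List.mem_cons_of_mem _ hx)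
      have h3 := length_chainSlots (i + 1) d C C' tab' x
      rw [(hb x List.mem_cons_self).1.1] at h3
      omega
  rw [hsum l hl, hsum m hm] at hok
  have key := hits_le_of_pairOk (hlen l hl) (hlen m hm) hok
  rw [hits_flatMap, hits_flatMap] at key
  refine Nat.le_of_mul_le_mul_left ?_ Nat.two_pos
  simp only [← List.sum_map_mul_left]
  refine le_trans (sum_map_le_sum_map fun x hx => sum_map_le_sum_map fun y hy => ?_) (key.trans
    (sum_map_le_sum_map fun x hx => sum_map_le_sum_map fun y hy => ?_))
  · exact (hits_chainSlots (by omega) ht ht' (hbd l hl x hx).1 (hbd m hm y hy).1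
      (hbd l hl x hx).2).1
  · refine (hits_chainSlots (by omega) ht ht' (hbd l hl x hx).1 (hbd m hm y hy).1
      (hbd l hl x hx).2).2.trans_eq ?_
    simp only [← List.sum_map_mul_left]

end ColumnWord

namespace ColumnWord

open Finset

section Bridge

/-- The set of positions of `true`. -/
def toSet (n : ℕ) (T : List Bool) : Finset (Fin n) := univ.filter fun c => T.getD c false = true

/-- The function listed by `t`. -/
def toFun (n : ℕ) (t : List ℕ) (c : Fin n) : ℕ := t.getD c 0

theorem toSet_injOn {n : ℕ} {T T' : List Bool} (h : T.length = n) (h' : T'.length = n)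
    (he : toSet n T = toSet n T') : T = T' := by
  refine List.ext_getElem (h.trans h'.symm) fun k h1 h2 => ?_
  have := Finset.ext_iff.1 he ⟨k, h ▸ h1⟩
  simp only [toSet, mem_filter, mem_univ, true_and, List.getD_eq_getElem _ _ h1,
    List.getD_eq_getElem _ _ h2] at this
  exact Bool.eq_iff_iff.2 this

theorem exists_toSet {n : ℕ} (T : Finset (Fin n)) : ∃ L : List Bool, L.length = n ∧ toSet n L = T := by
  classical
  refine ⟨List.ofFn fun c => decide (c ∈ T), by simp, ?_⟩
  ext c
  simp [toSet]

theorem upCard_toSet {n : ℕ} {T : List Bool} (h : T.length = n) (b : ℕ) :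
    upCard (toSet n T) b = (T.drop b).count true := by
  have : upCard (toSet n T) b =
      ∑ c ∈ range n, if T.getD c false = true ∧ b ≤ c then 1 else 0 := by
    rw [upCard, toSet, filter_filter, card_filter]
    exact Fin.sum_univ_eq_sum_range (fun c => if T.getD c false = true ∧ b ≤ c then 1 else 0) n
  rw [this]
  clear this
  induction T generalizing n b with
  | nil => subst h; simp
  | cons x T ih =>
    subst h
    rw [List.length_cons, sum_range_succ']
    cases b with
    | zero =>
      have := ih rfl 0
      simp only [Nat.zero_le, and_true, List.drop_zero] at this ⊢
      simp only [List.getD_cons_succ, List.getD_cons_zero, this]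
      cases x <;> simp
    | succ b =>
      have := ih rfl b
      simpa using this

theorem card_toSet {n : ℕ} {T : List Bool} (h : T.length = n) :
    (toSet n T).card = T.count true := by
  simpa [upCard_zero] using upCard_toSet h 0

theorem toFun_addCol {n : ℕ} {t : List ℕ} {T : List Bool} (h : T.length = t.length) :
    toFun n (addCol t T) = toFun n t + ind (toSet n T) := by
  funext c
  simp only [toFun, Pi.add_apply, ind, toSet, mem_filter, mem_univ, true_and]
  generalize c.val = k
  induction t generalizing T k with
  | nil =>
    obtain rfl := List.length_eq_zero_iff.1 h
    simp [addCol_nil]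
  | cons x t ih =>
    obtain _ | ⟨b, T⟩ := T
    · simp at h
    rw [addCol_cons]
    cases k with
    | zero => cases b <;> simp
    | succ k => simpa using ih (by simpa using h) k

theorem antitone_toFun {n : ℕ} {t : List ℕ} (h : t.length = n) :
    Antitone (toFun n t) ↔ t.IsChain (· ≥ ·) := by
  rw [List.isChain_iff_getElem]
  constructor
  · intro ha k hk
    have := @ha ⟨k, by omega⟩ ⟨k + 1, by omega⟩ (by simp)
    simpa [toFun, List.getD_eq_getElem, hk, Nat.lt_of_succ_lt hk] using this
  · intro hc
    refine antitone_of_succ fun k k' hk => ?_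
    have := hc k (by omega)
    have h1 : k.val < t.length := by omega
    have h2 : k'.val < t.length := by omega
    simp only [toFun, List.getD_eq_getElem, h1, h2]
    simpa only [hk] using this

theorem mem_stripList {t : List ℕ} {p s : ℕ} (ht : (p :: t).IsChain (· ≥ ·)) {T : List Bool} :
    T ∈ stripList t p s ↔
      T.length = t.length ∧ T.count true = s ∧ (p :: addCol t T).IsChain (· ≥ ·) := by
  induction t generalizing p s T with
  | nil =>
    rw [stripList]
    constructor
    · intro h
      split_ifs at h with hs
      · obtain rfl := List.mem_singleton.1 h
        simp [hs, addCol_nil]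
      · simp at h
    · rintro ⟨h1, h2, -⟩
      obtain rfl := List.length_eq_zero_iff.1 h1
      simp at h2
      simp [← h2]
  | cons x t ih =>
    rw [List.isChain_cons_cons] at ht
    have ht1 : ((x + 1) :: t).IsChain (· ≥ ·) := by
      cases t with
      | nil => simp
      | cons y t =>
        rw [List.isChain_cons_cons] at ht ⊢
        exact ⟨by omega, ht.2.2⟩
    rw [stripList, List.mem_append, List.mem_map]
    obtain _ | ⟨b, T⟩ := T
    · constructor
      · rintro (⟨_, -, h⟩ | h)
        · simp at h
        · split_ifs at h <;> simp at h
      · rintro ⟨h, -⟩; simp at h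
    rw [addCol_cons, List.isChain_cons_cons]
    cases b with
    | false =>
      have : (∃ a ∈ stripList t x s, false :: a = false :: T) ↔ T ∈ stripList t x s := by simp
      rw [this, ih ht.2]
      constructor
      · rintro (h | h)
        · simpa using ⟨h.1, h.2.1, ht.1, h.2.2⟩
        · split_ifs at h <;> simp at h
      · intro h
        exact Or.inl (by simpa [ht.1] using h)
    | true =>
      simp only [reduceCtorEq, List.cons.injEq, false_and, and_false, exists_false, false_or]
      split_ifs with h
      · have : (true :: T ∈ List.map (List.cons true) (stripList t (x + 1) (s - 1))) ↔
            T ∈ stripList t (x + 1) (s - 1) := by simp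
        rw [this, ih ht1]
        simp only [List.length_cons, List.count_cons_self, Nat.add_right_cancel_iff]
        refine and_congr_right fun _ => ?_
        constructor
        · rintro ⟨h1, h2⟩
          exact ⟨by omega, by omega, h2⟩
        · rintro ⟨h1, h2, h3⟩
          exact ⟨by omega, h3⟩
      · simp only [List.not_mem_nil, false_iff, List.count_cons_self]
        rintro ⟨-, h2, h3, -⟩
        exact h ⟨by omega, h3⟩

theorem nodup_stripList (t : List ℕ) (p s : ℕ) : (stripList t p s).Nodup := by
  induction t generalizing p s with
  | nil => rw [stripList]; split_ifs <;> simp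
  | cons x t ih =>
    rw [stripList, List.nodup_append]
    refine ⟨(ih _ _).map (List.cons_injective), ?_, ?_⟩
    · split_ifs
      · exact (ih _ _).map (List.cons_injective)
      · simp
    · rintro a ha b hb rfl
      split_ifs at hb
      · obtain ⟨u, -, rfl⟩ := List.mem_map.1 ha
        simp at hb
      · simp at hb

theorem sum_stripList {n : ℕ} {t : List ℕ} (hn : t.length = n) (ht : t.IsChain (· ≥ ·))
    (hb : ∀ x ∈ t, x < 100) (s : ℕ) (G : Finset (Fin n) → ℕ)
    [DecidablePred fun T : Finset (Fin n) => T.card = s ∧ Antitone (toFun n t + ind T)] :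
    ((stripList t 100 s).map fun T => G (toSet n T)).sum =
      ∑ T : Finset (Fin n) with T.card = s ∧ Antitone (toFun n t + ind T), G T := by
  have hc : ∀ u : List ℕ, (∀ x ∈ u, x ≤ 100) → u.IsChain (· ≥ ·) →
      (100 :: u).IsChain (· ≥ ·) := by
    intro u hu h
    cases u with
    | nil => simp
    | cons y u => exact List.isChain_cons_cons.2 ⟨hu y (by simp), h⟩
  have hm : ∀ T, T ∈ stripList t 100 s ↔ T.length = n ∧ T.count true = s ∧
      Antitone (toFun n t + ind (toSet n T)) := by
    intro T
    rw [mem_stripList (hc t (fun x hx => (hb x hx).le) ht), hn]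
    refine and_congr_right fun hT => and_congr_right fun _ => ?_
    have hT' : T.length = t.length := by rw [hT, hn]
    rw [← toFun_addCol hT', antitone_toFun (by rw [length_addCol hT', hn])]
    constructor
    · intro h
      exact h.tail
    · refine fun h => hc _ (fun x hx => ?_) h
      exact addCol_le (k := 99) hT' (fun x hx => by have := hb x hx; omega) x hx
  rw [← List.sum_toFinset _ (nodup_stripList t 100 s)]
  refine sum_nbij (toSet n) ?_ ?_ ?_ fun _ _ => rfl
  · intro T hT
    rw [List.mem_toFinset, hm] at hT
    rw [mem_filter, card_toSet hT.1]
    exact ⟨mem_univ _, hT.2⟩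
  · intro T hT T' hT' he
    simp only [List.coe_toFinset, Set.mem_ofPred_eq, hm] at hT hT'
    exact toSet_injOn hT.1 hT'.1 he
  · intro T hT
    obtain ⟨L, h1, rfl⟩ := exists_toSet T
    simp only [coe_filter, mem_univ, true_and, Set.mem_ofPred_eq, card_toSet h1] at hT
    exact ⟨L, by simpa [hm] using ⟨h1, hT⟩, rfl⟩

theorem need_le {S T : List Bool} (h : S.length = T.length) {a b m e : ℕ} :
    need S T a b m ≤ e ↔ m ≤ e ∧
      ∀ k < S.length, a + (S.take (k + 1)).count true ≤ b + (T.take (k + 1)).count true + e := by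
  induction S generalizing T a b m with
  | nil => simp [need_nil]
  | cons s S ih =>
    obtain _ | ⟨t, T⟩ := T
    · simp at h
    rw [need_cons, ih (by simpa using h), max_le_iff, and_assoc]
    refine and_congr_right fun _ => ?_
    have key : ∀ k, (a + ((s :: S).take (k + 1)).count true ≤
        b + ((t :: T).take (k + 1)).count true + e ↔
        (if s then a + 1 else a) + (S.take k).count true ≤
          (if t then b + 1 else b) + (T.take k).count true + e) := by
      intro k
      rw [List.take_succ_cons, List.take_succ_cons]
      cases s <;> cases t <;> simp <;> omega
    simp only [key, List.length_cons]
    constructor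
    · rintro ⟨h1, h2⟩ k hk
      cases k with
      | zero => simp; omega
      | succ k => exact h2 k (by omega)
    · intro h2
      refine ⟨?_, fun k hk => h2 (k + 1) (by omega)⟩
      have := h2 0 (by omega)
      simp at this
      omega

theorem need_le_count {S T : List Bool} (h : S.length = T.length) :
    need S T 0 0 0 ≤ S.count true := by
  rw [need_le h]
  refine ⟨by omega, fun k _ => ?_⟩
  have := (List.take_sublist (k + 1) S).count_le true
  omega

theorem compat_toSet {n : ℕ} {S T : List Bool} (hS : S.length = n) (hT : T.length = n) {d e : ℕ}
    (he : d + S.count true = T.count true + e) :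
    Compat d (toSet n S) (toSet n T) ↔ need S T 0 0 0 ≤ e := by
  rw [need_le (hS.trans hT.symm)]
  simp only [Compat, upCard_toSet hS, upCard_toSet hT]
  have hs : ∀ k, S.count true = (S.take k).count true + (S.drop k).count true := fun k => by
    rw [← List.count_append, List.take_append_drop]
  have ht : ∀ k, T.count true = (T.take k).count true + (T.drop k).count true := fun k => by
    rw [← List.count_append, List.take_append_drop]
  constructor
  · refine fun h => ⟨by omega, fun k hk => ?_⟩
    have := h (k + 1)
    have := hs (k + 1)
    have := ht (k + 1)
    omega
  · rintro ⟨-, h⟩ b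
    have h1 := hs b
    have h2 := ht b
    rcases Nat.eq_zero_or_pos b with rfl | hb
    · simp at h1 h2 ⊢; omega
    by_cases hbn : b ≤ n
    · have := h (b - 1) (by omega)
      rw [Nat.sub_add_cancel hb] at this
      omega
    · rw [List.drop_eq_nil_of_le (by omega : T.length ≤ b)]
      simp

end Bridge

section Bridge

theorem digitsLE_mul {m q r : ℕ} {es : List ℕ} (hq : q < 8) :
    digitsLE (8 * m) es (8 * r + q) = digitsLE m es r := by
  induction es generalizing m with
  | nil => rfl
  | cons e es ih =>
    have h : (8 * r + q) / (8 * m) = r / m := by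
      rw [← Nat.div_div_eq_div_mul]
      congr 1
      omega
    rw [digitsLE, digitsLE, h, mul_assoc, ih]

theorem digitsLE_cons {e q r : ℕ} {es : List ℕ} (hq : q < 8) :
    digitsLE 1 (e :: es) (8 * r + q) = (decide (q ≤ e) && digitsLE 1 es r) := by
  rw [digitsLE, ← digitsLE_mul (m := 1) (r := r) hq]
  congr 3
  rw [Nat.div_one]
  omega

/-- The thresholds on the offsets of the columns `P` placed after a column of size `s'`. -/
def Fits (i : ℕ) : ℕ → List (ℕ × ℕ) → List ℕ → Prop
  | s', [], thr => s' ≤ i ∧ thr = []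
  | s', p :: P, thr => s' ≤ i ∧
      ∃ E thr', p.2 + s' = p.1 + E ∧ thr = min i E :: thr' ∧ Fits i p.1 P thr'

theorem sum_map_flatMap {α β : Type*} (l : List α) (f : α → List β) (g : β → ℕ) :
    ((l.flatMap f).map g).sum = (l.map fun a => ((f a).map g).sum).sum := by
  induction l with
  | nil => rfl
  | cons a l ih => simp [ih]

theorem addCol_lt {t : List ℕ} {T : List Bool} (hT : T.length = t.length) {k : ℕ}
    (h : ∀ x ∈ t, x < k) : ∀ x ∈ addCol t T, x < k + 1 := fun x hx =>
  Nat.lt_succ_of_le (addCol_le (k := k - 1) hT (fun y hy => by have := h y hy; omega) x hx |>.trans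
    (by
      cases t with
      | nil =>
        obtain rfl := List.length_eq_zero_iff.1 hT
        simp [addCol_nil] at hx
      | cons y t => have := h y (by simp); omega))

theorem sum_chainList {n i : ℕ} (hi : i < 8) (F : Finset (Fin n) → (Fin n → ℕ) → ℕ)
    {P : List (ℕ × ℕ)} {s' r : ℕ} {S : List Bool} {t es₀ thr : List ℕ} (hP : Fits i s' P thr)
    (hS : S.length = n) (hS' : S.count true = s') (hn : t.length = n) (ht : t.IsChain (· ≥ ·))
    (hb : ∀ x ∈ t, x + P.length < 100) :
    ((chainList (P.map Prod.fst) r S t).map fun x =>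
      if digitsLE 1 (thr.reverse ++ es₀) x.1 then F (toSet n x.2.1) (toFun n x.2.2) else 0).sum =
      if digitsLE 1 es₀ r then run P (toSet n S) (toFun n t) F else 0 := by
  classical
  induction P generalizing s' r S t es₀ thr with
  | nil =>
    obtain ⟨-, rfl⟩ := hP
    simp only [chainList, run, List.map_cons, List.map_nil, List.sum_cons, List.sum_nil,
      List.reverse_nil, List.nil_append, add_zero]
    congr
  | cons p P ih =>
    obtain ⟨hs, E, thr, hE, rfl, hfit⟩ := hP
    rw [List.map_cons, chainList, sum_map_flatMap, run_cons]
    have hstep : ∀ T ∈ stripList t 100 p.1,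
        ((chainList (P.map Prod.fst) (8 * r + need S T 0 0 0) T (addCol t T)).map fun x =>
          if digitsLE 1 ((min i E :: thr).reverse ++ es₀) x.1 then
            F (toSet n x.2.1) (toFun n x.2.2) else 0).sum =
        (fun U : Finset (Fin n) => if digitsLE 1 es₀ r = true ∧ Compat p.2 (toSet n S) U then
          run P U (toFun n t + ind U) F else 0) (toSet n T) := by
      intro T hT
      have hT' := length_of_mem_stripList hT
      rw [hn] at hT'
      have hTt : T.length = t.length := by rw [hT', hn]
      have hc : (100 :: t).IsChain (· ≥ ·) := by
        cases t with
        | nil => simp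
        | cons y t =>
          refine List.isChain_cons_cons.2 ⟨?_, ht⟩
          have := hb y (by simp)
          omega
      obtain ⟨-, hcT, hch₀⟩ := (mem_stripList hc).1 hT
      have hch : (addCol t T).IsChain (· ≥ ·) := hch₀.tail
      have hneed : need S T 0 0 0 ≤ i :=
        (need_le_count (hS.trans hT'.symm)).trans (hS' ▸ hs)
      rw [List.reverse_cons, List.append_assoc, List.singleton_append,
        ih (es₀ := min i E :: es₀) hfit hT' hcT (by rw [length_addCol hTt, hn]) hch ?_,
        digitsLE_cons (by omega), toFun_addCol hTt]
      · have hcomp : Compat p.2 (toSet n S) (toSet n T) ↔ need S T 0 0 0 ≤ min i E := by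
          rw [compat_toSet hS hT' (e := E) (by rw [hS', hcT, hE])]
          omega
        simp only [hcomp]
        congr 1
        simp [and_comm]
      · intro x hx
        have := addCol_lt (k := 100 - (P.length + 1)) hTt (fun y hy => by
          have := hb y hy
          simp only [List.length_cons] at this
          omega) x hx
        have hlen : P.length + 1 < 100 := by
          cases t with
          | nil =>
            obtain rfl := List.length_eq_zero_iff.1 hTt
            simp [addCol_nil] at hx
          | cons y t => have := hb y (by simp); simp at this; omega
        omega
    rw [List.map_congr_left hstep, sum_stripList hn ht (fun x hx => by have := hb x hx; omega) p.1
      fun U => if digitsLE 1 es₀ r = true ∧ Compat p.2 (toSet n S) U then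
        run P U (toFun n t + ind U) F else 0]
    by_cases hd : digitsLE 1 es₀ r = true
    · simp only [hd, true_and, if_true]
      rw [← sum_filter, filter_filter]
      refine sum_congr ?_ fun _ _ => rfl
      ext T
      simp only [mem_filter]
      tauto
    · simp [hd]

theorem need_replicate_false (n : ℕ) {T : List Bool} (h : T.length = n) :
    need (List.replicate n false) T 0 0 0 = 0 := by
  have := need_le_count (S := List.replicate n false) (T := T) (by simp [h])
  have h0 : (List.replicate n false).count true = 0 := List.count_eq_zero.2 fun h => by
    simpa using List.eq_of_mem_replicate h
  omega

theorem toFun_replicate (n m : ℕ) : toFun n (List.replicate m 0) = 0 := by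
  funext c
  simp [toFun, List.getElem?_replicate]
  split_ifs <;> simp

theorem sum_chainList_first {n i : ℕ} (hi : i < 8) (F : Finset (Fin n) → (Fin n → ℕ) → ℕ)
    {p : ℕ × ℕ} {P : List (ℕ × ℕ)} {thr : List ℕ} (hp : p.1 ≤ p.2) (hP : Fits i p.1 P thr)
    (hl : P.length < 98) :
    (((chainList ((p :: P).map Prod.fst) 0 (List.replicate n false) (List.replicate n 0)).filter
      fun x => digitsLE 1 thr.reverse x.1).map fun x => F (toSet n x.2.1) (toFun n x.2.2)).sum =
      run (p :: P) ∅ 0 F := by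
  classical
  have hfil : ∀ l : List (ℕ × List Bool × List ℕ),
      ((l.filter fun x => digitsLE 1 thr.reverse x.1).map
        fun x => F (toSet n x.2.1) (toFun n x.2.2)).sum =
      (l.map fun x => if digitsLE 1 (thr.reverse ++ []) x.1 then
        F (toSet n x.2.1) (toFun n x.2.2) else 0).sum := by
    intro l
    induction l with
    | nil => rfl
    | cons x l ih =>
      rw [List.append_nil] at ih ⊢
      by_cases h : digitsLE 1 thr.reverse x.1 = true
      · simp only [List.filter_cons, h, if_true, List.map_cons, List.sum_cons, ih]
      · simpa [List.filter_cons, h] using ih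
  rw [hfil, List.map_cons, chainList, sum_map_flatMap, run_cons]
  have hlen : (List.replicate n 0).length = n := List.length_replicate
  have hch : ((List.replicate n 0) : List ℕ).IsChain (· ≥ ·) := by
    rw [← antitone_toFun hlen, toFun_replicate]
    exact antitone_const
  have hz : ∀ x ∈ List.replicate n 0, x = 0 := fun x hx => List.eq_of_mem_replicate hx
  have hstep : ∀ T ∈ stripList (List.replicate n 0) 100 p.1,
      ((chainList (P.map Prod.fst) (8 * 0 + need (List.replicate n false) T 0 0 0) T
        (addCol (List.replicate n 0) T)).map fun x =>
          if digitsLE 1 (thr.reverse ++ []) x.1 then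
            F (toSet n x.2.1) (toFun n x.2.2) else 0).sum =
        (fun U : Finset (Fin n) => run P U (toFun n (List.replicate n 0) + ind U) F)
          (toSet n T) := by
    intro T hT
    have hTt := length_of_mem_stripList hT
    have hT' := hTt.trans hlen
    have hc : (100 :: List.replicate n 0).IsChain (· ≥ ·) := by
      generalize List.replicate n 0 = u at hch hz
      cases u with
      | nil => simp
      | cons y u => exact List.isChain_cons_cons.2 ⟨by have := hz y (by simp); omega, hch⟩
    obtain ⟨-, hcT, hch₀⟩ := (mem_stripList hc).1 hT
    have hch' : (addCol (List.replicate n 0) T).IsChain (· ≥ ·) := hch₀.tail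
    rw [need_replicate_false n hT', sum_chainList hi F hP hT' hcT
      (by rw [length_addCol hTt, hlen]) hch' ?_, toFun_addCol hTt]
    · simp [digitsLE]
    · intro x hx
      have := addCol_le hTt (k := 0) (fun y hy => (hz y hy).le) x hx
      omega
  rw [List.map_congr_left hstep, sum_stripList hlen hch (fun x hx => by rw [hz x hx]; omega) p.1
    fun U => run P U (toFun n (List.replicate n 0) + ind U) F]
  refine sum_congr ?_ fun _ _ => by rw [toFun_replicate]
  ext T
  simp only [mem_filter, toFun_replicate]
  constructor
  · rintro ⟨h1, h2, h3⟩
    exact ⟨h1, h2, compat_of_card_le (h2 ▸ hp), h3⟩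
  · rintro ⟨h1, h2, -, h3⟩
    exact ⟨h1, h2, h3⟩

theorem toFun_injOn {n : ℕ} {t t' : List ℕ} (h : t.length = n) (h' : t'.length = n)
    (he : toFun n t = toFun n t') : t = t' := by
  refine List.ext_getElem (h.trans h'.symm) fun k h1 h2 => ?_
  have := congrFun he ⟨k, h ▸ h1⟩
  simpa only [toFun, List.getD_eq_getElem _ _ h1, List.getD_eq_getElem _ _ h2] using this

theorem length_cnj (t : List ℕ) (n j : ℕ) : (cnj t n j).length = n := by
  rw [cnj_eq]; simp

theorem toFun_cnj {n : ℕ} {t : List ℕ} (h : t.length = n) :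
    toFun n (cnj t n 0) = conj (toFun n t) := by
  funext j
  have h1 : j.val < (cnj t n 0).length := by rw [length_cnj]; exact j.2
  rw [toFun, List.getD_eq_getElem _ _ h1]
  simp only [cnj_eq, List.getElem_map, List.getElem_range, zero_add]
  have h2 : ∀ (m : ℕ) (u : List ℕ), u.length = m → u.countP (fun x => decide (j.val < x)) =
      ∑ c ∈ range m, if j.val < u.getD c 0 then 1 else 0 := by
    intro m u hu
    induction u generalizing m with
    | nil => subst hu; simp
    | cons x u ih =>
      subst hu
      rw [List.length_cons, sum_range_succ', List.countP_cons, ih _ rfl]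
      simp
  rw [h2 n t h, conj, below, card_filter]
  exact (Fin.sum_univ_eq_sum_range (fun c => if j.val < t.getD c 0 then 1 else 0) n).symm

theorem toFun_eq_conj_iff {n : ℕ} {t u : List ℕ} (h : t.length = n) (hu : u.length = n) :
    toFun n u = conj (toFun n t) ↔ u = cnj t n 0 := by
  rw [← toFun_cnj h]
  exact ⟨toFun_injOn hu (length_cnj _ _ _), fun h => h ▸ rfl⟩

end Bridge

section Weights

variable {n : ℕ}

theorem run_mono_of_final {L : List (ℕ × ℕ)} : ∀ {S : Finset (Fin n)} {a : Fin n → ℕ}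
    {F G : Finset (Fin n) → (Fin n → ℕ) → ℕ}, Antitone a →
    (∀ S' t, Antitone t → (∀ c, t c ≤ a c + L.length) →
      ∑ c, t c = ∑ c, a c + (L.map Prod.fst).sum →
      S'.card = (L.map Prod.fst).getLastD S.card →
      ((∃ p ∈ L, n ≤ p.1) → ∀ c, a c + 1 ≤ t c) → (∀ c, a c ≤ t c) → F S' t ≤ G S' t) →
    run L S a F ≤ run L S a G := by
  classical
  induction L with
  | nil => exact fun ha h => h _ _ ha (fun c => le_rfl) rfl rfl (by simp) fun c => le_rfl
  | cons p L ih =>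
    intro S a F G ha h
    rw [run_cons, run_cons]
    refine sum_le_sum fun T hT => ?_
    obtain ⟨-, hc, -, hA⟩ := mem_filter.mp hT
    have hind : ∀ c, ind T c ≤ 1 := fun c => by unfold ind; split_ifs <;> omega
    refine ih hA fun S' t ht h1 h2 h3 h4 h5 => h S' t ht ?_ ?_ ?_ ?_ ?_
    · intro c
      have := h1 c
      have := hind c
      simp only [Pi.add_apply, List.length_cons] at *
      omega
    · rw [h2, List.map_cons, List.sum_cons, ← hc]
      have : ∑ c, ind T c = T.card := by simp [ind]
      simp only [Pi.add_apply, sum_add_distrib, this]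
      omega
    · rw [h3, List.map_cons, List.getLastD_cons, hc]
    · rintro ⟨q, hq, hqn⟩ c
      rcases List.mem_cons.1 hq with rfl | hq
      · have hT : T = univ := eq_univ_of_card T (le_antisymm (card_le_univ T)
          (by rw [hc, Fintype.card_fin]; exact hqn))
        have := h5 c
        simpa [ind, hT] using this
      · have := h4 ⟨q, hq, hqn⟩ c
        simp only [Pi.add_apply] at this
        omega
    · intro c
      have := h5 c
      simp only [Pi.add_apply] at this
      omega

theorem run_zero_right (L : List (ℕ × ℕ)) (S : Finset (Fin n)) (a : Fin n → ℕ) :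
    run L S a (fun _ _ => (0 : ℕ)) = 0 := by
  classical
  induction L generalizing S a with
  | nil => rfl
  | cons p L ih => rw [run_cons]; exact sum_eq_zero fun T _ => ih _ _

theorem le_run_singleton {p : ℕ × ℕ} {S : Finset (Fin n)} {a : Fin n → ℕ}
    (F : Finset (Fin n) → (Fin n → ℕ) → ℕ) {T : Finset (Fin n)} (h1 : T.card = p.1)
    (h2 : Compat p.2 S T) (h3 : Antitone (a + ind T)) :
    F T (a + ind T) ≤ run [p] S a F := by
  classical
  rw [run_cons]
  exact single_le_sum (f := fun T => run [] T (a + ind T) F) (fun _ _ => Nat.zero_le _)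
    (mem_filter.mpr ⟨mem_univ _, h1, h2, h3⟩)

theorem run_singleton_zero {p : ℕ × ℕ} (hp : p.1 = 0) (S : Finset (Fin n)) {a : Fin n → ℕ}
    (ha : Antitone a) (F : Finset (Fin n) → (Fin n → ℕ) → ℕ) : run [p] S a F = F ∅ a := by
  classical
  have h0 : a + ind (∅ : Finset (Fin n)) = a := by funext c; simp [ind]
  rw [run_cons, sum_eq_single_of_mem ∅]
  · rw [h0]; rfl
  · exact mem_filter.mpr ⟨mem_univ _, hp.symm, compat_of_card_le (by simp), by rwa [h0]⟩
  · intro T hT hne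
    exact absurd (card_eq_zero.1 ((mem_filter.mp hT).2.1.trans hp)) hne

theorem conj_antitone (t : Fin n → ℕ) : Antitone (conj t) := fun _ _ h =>
  card_le_card (below_mono t h)

theorem conj_add_single (t : Fin n → ℕ) {b b' : Fin n} (h : b'.val = t b) :
    conj (t + ind {b}) = conj t + ind {b'} := by
  funext j
  have hb : ind {b'} j = if j = b' then 1 else 0 := by simp [ind]
  simp only [Pi.add_apply, hb, conj]
  split_ifs with hj
  · subst hj
    have : below (t + ind {b}) j = insert b (below t j) := by
      ext c
      simp only [mem_below, mem_insert, Pi.add_apply, ind, mem_singleton]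
      split_ifs with hc
      · subst hc; simp; omega
      · simp [hc]
    rw [this, card_insert_of_notMem]
    simp [mem_below, h]
  · have : below (t + ind {b}) j = below t j := by
      ext c
      simp only [mem_below, Pi.add_apply, ind, mem_singleton]
      split_ifs with hc
      · subst hc
        have : j.val ≠ b'.val := fun h => hj (Fin.ext h)
        omega
      · simp
    rw [this]
    rfl

theorem sum_conj {t : Fin n → ℕ} (h : ∀ c, t c ≤ n) : ∑ j, conj t j = ∑ c, t c := by
  simp only [conj, below, card_filter]
  rw [sum_comm]
  refine sum_congr rfl fun c _ => ?_
  rw [← card_filter]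
  rw [Fin.card_filter_val_lt]
  exact min_eq_right (h c)

theorem conj_eq_zero {t : Fin n → ℕ} {j : Fin n} (h : ∀ c, t c ≤ j) : conj t j = 0 := by
  rw [conj, below_eq_empty h, card_empty]

theorem antitone_add_first {a : Fin n → ℕ} (ha : Antitone a) {z : Fin n} (hz : z.val = 0) :
    Antitone (a + ind {z}) := by
  refine antitone_of_succ fun k k' hk => ?_
  have := ha (show k ≤ k' from Fin.le_def.2 (by omega))
  have : ¬ k' = z := fun h => by rw [h] at hk; omega
  simp only [Pi.add_apply, ind, mem_singleton, if_neg this]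
  omega

theorem antitone_add_length {t : Fin n → ℕ} (ht : Antitone t) {z b : Fin n} (hz : z.val = 0)
    (hb : b.val = conj t z) : t b = 0 ∧ Antitone (t + ind {b}) := by
  have h := fun c : Fin n => mem_iff_of_isLowerSet (isLowerSet_below ht z) (x := c)
  simp only [mem_below, hz] at h
  rw [conj, hz] at hb
  have hb0 : t b = 0 := by
    by_contra hne
    have := (h b).1 (Nat.pos_of_ne_zero hne)
    omega
  refine ⟨hb0, antitone_of_succ fun k k' hk => ?_⟩
  have h1 := ht (show k ≤ k' from Fin.le_def.2 (by omega))
  simp only [Pi.add_apply, ind, mem_singleton]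
  split_ifs with h2 h3
  · omega
  · subst h2
    have := (h k).2 (by omega)
    omega
  · omega
  · omega

end Weights

section Extend

variable {n : ℕ}

/-- The number of pairs of words with conjugate weights, for two lists of columns. -/
noncomputable def twins (n : ℕ) (B B' : List (ℕ × ℕ)) : ℕ :=
  run (n := n) B ∅ 0 fun _ t => run (n := n) B' ∅ 0 fun _ u => if u = conj t then 1 else 0

/-- The number of pairs of words with conjugate weights, after adding one letter to each. -/
noncomputable def twinsSucc (n : ℕ) (B B' : List (ℕ × ℕ)) (e e' : ℕ) : ℕ :=
  run (n := n) B ∅ 0 fun S t => run [(1, e)] S t fun _ t' =>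
    run (n := n) B' ∅ 0 fun S' u => run [(1, e')] S' u fun _ u' => if u' = conj t' then 1 else 0

theorem compat_first {d : ℕ} {S : Finset (Fin n)} {z : Fin n} (hz : z.val = 0)
    (h : 1 ≤ S.card + d) : Compat d S {z} := by
  intro b
  rcases Nat.eq_zero_or_pos b with rfl | hb
  · simpa [upCard_zero] using h
  · have : upCard ({z} : Finset (Fin n)) b = 0 := by
      rw [upCard, card_eq_zero, filter_eq_empty_iff]
      intro x hx
      rw [mem_singleton.1 hx]
      omega
    omega

theorem twins_le_of_left {B B' : List (ℕ × ℕ)} {e e' : ℕ} (hB : B'.length < n) (he : 1 ≤ e)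
    (hd : 1 ≤ (B'.map Prod.fst).getLastD 0 + e') : twins n B B' ≤ twinsSucc n B B' e e' := by
  have hz : (⟨0, by omega⟩ : Fin n).val = 0 := rfl
  generalize (⟨0, by omega⟩ : Fin n) = z at hz
  refine run_mono_of_final antitone_const fun S t ht _ _ _ _ _ => ?_
  by_cases hc : conj t z < n
  · obtain ⟨b, hb⟩ : ∃ b : Fin n, b.val = conj t z := ⟨⟨_, hc⟩, rfl⟩
    obtain ⟨hb0, hA⟩ := antitone_add_length ht hz hb
    refine le_trans ?_ (le_run_singleton _ (T := {b}) (card_singleton b)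
      (compat_of_card_le (by simpa using he)) hA)
    refine run_mono_of_final antitone_const fun S' u hu _ _ h3 _ _ => ?_
    split_ifs with huc
    · refine le_trans ?_ (le_run_singleton _ (T := {z}) (card_singleton z)
        (compat_first hz ?_) (antitone_add_first hu hz))
      · rw [conj_add_single t (b' := z) (by rw [hb0, hz]), huc, if_pos rfl]
      · rw [h3]; simpa using hd
    · exact Nat.zero_le _
  · refine le_trans (run_mono_of_final (G := fun _ _ => 0) antitone_const
      fun S' u hu h1 _ _ _ _ => ?_) ((run_zero_right _ _ _).le.trans (Nat.zero_le _))
    rw [if_neg]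
    rintro rfl
    have := h1 z
    simp only [Pi.zero_apply, zero_add] at this
    omega

theorem twins_le_of_right {B B' : List (ℕ × ℕ)} {e e' : ℕ} (hB : B.length < n) (he : 1 ≤ e')
    (hd : 1 ≤ (B.map Prod.fst).getLastD 0 + e) : twins n B B' ≤ twinsSucc n B B' e e' := by
  have hz : (⟨0, by omega⟩ : Fin n).val = 0 := rfl
  generalize (⟨0, by omega⟩ : Fin n) = z at hz
  refine run_mono_of_final antitone_const fun S t ht h1 _ h3 _ _ => ?_
  have hlt : t z < n := by
    have := h1 z
    simp only [Pi.zero_apply, zero_add] at this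
    omega
  obtain ⟨b, hb⟩ : ∃ b : Fin n, b.val = t z := ⟨⟨_, hlt⟩, rfl⟩
  refine le_trans ?_ (le_run_singleton _ (T := {z}) (card_singleton z)
    (compat_first hz (by rw [h3]; simpa using hd)) (antitone_add_first ht hz))
  refine run_mono_of_final antitone_const fun S' u hu _ _ _ _ _ => ?_
  split_ifs with huc
  · have hcj := conj_add_single t hb
    refine le_trans ?_ (le_run_singleton _ (T := {b}) (card_singleton b)
      (compat_of_card_le (by simpa using he)) ?_)
    · rw [hcj, huc, if_pos rfl]
    · rw [huc, ← hcj]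
      exact conj_antitone _
  · exact Nat.zero_le _

/-- The first `i` columns of a specification with `i + 1` columns. -/
def body (i : ℕ) (k h : ℕ → ℕ) : List (ℕ × ℕ) :=
  cols (fun j => (k (i - 1 - j) - h (i - 1 - j),
    if i - 1 - j = 0 then k 0 else h (i - 1 - j - 1) - h (i - 1 - j))) i

theorem body_congr {i : ℕ} {k k' h : ℕ → ℕ} (hk : ∀ c < i, k c = k' c) :
    body i k h = body i k' h := by
  refine cols_congr fun j hj => ?_
  rw [hk 0 (by omega), hk (i - 1 - j) (by omega)]

theorem length_body (i : ℕ) (k h : ℕ → ℕ) : (body i k h).length = i := length_cols _ _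

theorem cols_spec {i : ℕ} (hi : 1 ≤ i) (k h : ℕ → ℕ) :
    cols (spec (n := i + 1) (fun c => k c) (fun c => h c)) (i + 1) =
      body i k h ++ [(k i - h i, h (i - 1) - h i)] := by
  rw [add_comm i 1, cols_add]
  congr 1
  · refine cols_congr fun j hj => ?_
    rw [spec, dif_pos (by omega)]
    have h1 : 1 + i - 1 - (1 + j) = i - 1 - j := by omega
    simp only [h1]
    split_ifs with h0
    · rw [h0]
    · rfl
  · change [spec _ _ 0] = _
    rw [spec, dif_pos (by omega), if_neg (by simp; omega)]
    simp

theorem pairs_eq_twins {i : ℕ} (hi : 1 ≤ i) {k h f : ℕ → ℕ} (hk : k i = 0) :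
    pairs (n := i + 1) (fun c => k c) (fun c => h c) (fun c => f c) =
      twins (i + 1) (body i k h) (body i k f) := by
  rw [pairs, cols_spec hi, run_append, twins]
  refine run_congr antitone_const fun S t ht => ?_
  rw [run_singleton_zero (by simp [hk]) _ ht, cnt, cols_spec hi, run_append]
  refine run_congr antitone_const fun S u hu => ?_
  rw [run_singleton_zero (by simp [hk]) _ hu]

theorem pairs_eq_twinsSucc {i : ℕ} (hi : 1 ≤ i) {k h f : ℕ → ℕ} (hk : k i = 1) (hh : h i = 0)
    (hf : f i = 0) : pairs (n := i + 1) (fun c => k c) (fun c => h c) (fun c => f c) =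
      twinsSucc (i + 1) (body i k h) (body i k f) (h (i - 1)) (f (i - 1)) := by
  rw [pairs, cols_spec hi, run_append, twinsSucc, hk, hh]
  refine run_congr antitone_const fun S t ht => ?_
  refine run_congr ht fun S t ht => ?_
  rw [cnt, cols_spec hi, run_append, hk, hf]
  rfl

end Extend

section FiniteCheck

theorem cols_reindex {β : Type*} (g : ℕ → β) (K : ℕ) :
    cols (fun j => g (K - 1 - j)) K = (List.range K).map g := by
  induction K generalizing g with
  | zero => rfl
  | succ K ih =>
    rw [cols, List.range_succ_eq_map, List.map_cons, List.map_map, ← ih (g ∘ Nat.succ)]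
    congr 1
    · congr 1; omega
    · refine cols_congr fun j hj => ?_
      simp only [Function.comp]
      congr 1
      omega

/-- The length and the offset of the column `c`. -/
def colAt (k h : ℕ → ℕ) (c : ℕ) : ℕ × ℕ := (k c - h c, if c = 0 then k 0 else h (c - 1) - h c)

theorem body_eq (i : ℕ) (k h : ℕ → ℕ) : body i k h = (List.range i).map (colAt k h) :=
  cols_reindex (colAt k h) i

theorem map_fst_body (i : ℕ) (k h : ℕ → ℕ) :
    (body i k h).map Prod.fst = (List.range i).map fun c => k c - h c := by
  rw [body_eq, List.map_map]
  rfl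

theorem mem_sizesOf {k i s : ℕ} {l : List ℕ} (h1 : l.length = k) (h2 : ∀ x ∈ l, x ≤ i)
    (h3 : l.sum = s) : l ∈ sizesOf k i s := by
  induction l generalizing k s with
  | nil => subst h1 h3; simp [sizesOf]
  | cons x l ih =>
    subst h1
    rw [List.sum_cons] at h3
    rw [List.length_cons, sizesOf, List.mem_flatMap]
    refine ⟨x, List.mem_range.2 (Nat.lt_succ_of_le (h2 x (by simp))), ?_⟩
    have : x.ble s = true := Nat.ble_eq_true_of_le (by omega)
    rw [this, cond_true]
    exact List.mem_map_of_mem (ih rfl (fun y hy => h2 y (by simp [hy])) (by omega))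

theorem fits_body {i : ℕ} {k h : ℕ → ℕ} (hk : Antitone k) (hh : Antitone h) (hle : h ≤ k) (m : ℕ) :
    ∀ c, (∀ a ≤ c + m, k a - h a ≤ i) →
      Fits i (k c - h c) ((List.range' (c + 1) m).map (colAt k h))
        ((List.range' c m).map fun a => min i (k a - k (a + 1))) := by
  induction m with
  | zero => exact fun c hc => ⟨hc c (by omega), rfl⟩
  | succ m ih =>
    intro c hc
    refine ⟨hc c (by omega), k c - k (c + 1), _, ?_, rfl, ih (c + 1) fun a ha => hc a (by omega)⟩
    have h1 : k (c + 1) ≤ k c := hk (Nat.le_succ c)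
    have h2 : h (c + 1) ≤ h c := hh (Nat.le_succ c)
    have h3 : h c ≤ k c := hle c
    have h4 : h (c + 1) ≤ k (c + 1) := hle (c + 1)
    simp only [colAt, Nat.add_sub_cancel, if_neg (Nat.succ_ne_zero c)]
    omega

theorem tailLarge_range {i : ℕ} {k : ℕ → ℕ} (hk : Antitone k) (hl : ∀ a < i, i + 1 ≤ k a + a)
    (K : ℕ) : ∀ σ, K < i → 1 ≤ σ → k K ≤ σ ∨ i + 1 ≤ σ →
      TailLarge i K σ ((List.range K).map fun a => min i (k a - k (a + 1))).reverse := by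
  induction K with
  | zero => exact fun _ _ _ _ => rfl
  | succ K ih =>
    intro σ hK h1 h2
    have h3 := hl K (by omega)
    have h4 := hk (Nat.le_succ K)
    simp only [Nat.succ_eq_add_one] at h4
    refine ⟨min i (k K - k (K + 1)), ((List.range K).map fun a => min i (k a - k (a + 1))).reverse,
      by simp [List.range_succ], min_le_left _ _, by omega, ih _ (by omega) (by omega) (by omega)⟩

theorem count_of_mem_stripList {t : List ℕ} {p s : ℕ} {T : List Bool}
    (h : T ∈ stripList t p s) : T.count true = s := by
  induction t generalizing p s T with
  | nil =>
    rw [stripList] at h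
    split_ifs at h with hs
    · simp [List.mem_singleton.1 h, hs]
    · simp at h
  | cons x t ih =>
    rw [stripList, List.mem_append, List.mem_map] at h
    rcases h with ⟨u, hu, rfl⟩ | h
    · simpa using ih hu
    · split_ifs at h with hs
      · obtain ⟨u, hu, rfl⟩ := List.mem_map.1 h
        have := ih hu
        rw [List.count_cons_self]
        omega
      · simp at h

theorem props_of_mem_chainList {L : List ℕ} : ∀ {r : ℕ} {S : List Bool} {t : List ℕ}
    {x : ℕ × List Bool × List ℕ}, t.IsChain (· ≥ ·) → (∀ y ∈ t, y + L.length < 100) →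
    S.length = t.length → x ∈ chainList L r S t →
    x.2.1.length = t.length ∧ x.2.1.count true = L.getLastD (S.count true) ∧
      x.2.2.IsChain (· ≥ ·) := by
  induction L with
  | nil =>
    intro r S t x ht _ hS hx
    obtain rfl := List.mem_singleton.1 hx
    exact ⟨hS, rfl, ht⟩
  | cons s L ih =>
    intro r S t x ht hb hS hx
    rw [chainList, List.mem_flatMap] at hx
    obtain ⟨T, hT, hx⟩ := hx
    have hTt := length_of_mem_stripList hT
    have hc : (100 :: t).IsChain (· ≥ ·) := by
      cases t with
      | nil => simp
      | cons y t => exact List.isChain_cons_cons.2 ⟨by have := hb y (by simp); omega, ht⟩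
    obtain ⟨-, hcT, hch⟩ := (mem_stripList hc).1 hT
    have := ih hch.tail (fun y hy => ?_) (by rw [List.tail_cons, length_addCol hTt, hTt]) hx
    · rw [List.tail_cons, length_addCol hTt, hcT] at this
      rwa [List.getLastD_cons]
    · cases t with
      | nil =>
        obtain rfl := List.length_eq_zero_iff.1 hTt
        simp [addCol_nil] at hy
      | cons z t =>
        have hz := hb z (by simp)
        simp only [List.length_cons] at hz
        have := addCol_lt (k := 100 - (L.length + 1)) hTt (fun w hw => by
          have := hb w hw
          simp only [List.length_cons] at this
          omega) y hy
        omega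

theorem sum_exts {n d : ℕ} {S : List Bool} {t : List ℕ} (hS : S.length = n)
    (hc : S.count true = d) (hd : 1 ≤ d) (hn : t.length = n) (ht : t.IsChain (· ≥ ·))
    (hb : ∀ x ∈ t, x < 100) (F : (Fin n → ℕ) → ℕ) :
    ((exts d S t).map fun u => F (toFun n u)).sum =
      run [(1, 0)] (toSet n S) (toFun n t) fun _ t' => F t' := by
  classical
  have hfil : ∀ l : List (List Bool),
      (((l.filter fun T => decide (need S T 0 0 0 + 1 ≤ d)).map (addCol t)).map
        fun u => F (toFun n u)).sum =
      (l.map fun T => if need S T 0 0 0 + 1 ≤ d then F (toFun n (addCol t T)) else 0).sum := by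
    intro l
    induction l with
    | nil => rfl
    | cons T l ih =>
      rw [List.map_cons, List.sum_cons, ← ih, List.filter_cons]
      by_cases h : need S T 0 0 0 + 1 ≤ d <;> simp [h]
  rw [exts, hfil, run_cons]
  have hstep : ∀ T ∈ stripList t 100 1,
      (if need S T 0 0 0 + 1 ≤ d then F (toFun n (addCol t T)) else 0) =
      (fun U : Finset (Fin n) => if Compat 0 (toSet n S) U then F (toFun n t + ind U) else 0)
        (toSet n T) := by
    intro T hT
    have hTt := length_of_mem_stripList hT
    have hcT := count_of_mem_stripList hT
    simp only [compat_toSet hS (hTt.trans hn) (d := 0) (e := d - 1) (by omega), toFun_addCol hTt]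
    congr 1
    exact propext (by omega)
  rw [List.map_congr_left hstep, sum_stripList hn ht hb 1
    fun U => if Compat 0 (toSet n S) U then F (toFun n t + ind U) else 0, ← sum_filter,
    filter_filter]
  refine sum_congr ?_ fun _ _ => rfl
  ext T
  simp only [mem_filter]
  tauto

theorem sum_map_comm {α β : Type*} (l : List α) (m : List β) (f : α → β → ℕ) :
    (l.map fun x => (m.map fun y => f x y).sum).sum =
      (m.map fun y => (l.map fun x => f x y).sum).sum := by
  induction l with
  | nil => simp
  | cons x l ih => simp [ih, List.sum_map_add]

theorem twins_eq_zero_of_size {n : ℕ} {B B' : List (ℕ × ℕ)} (hB : B.length < n)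
    (hB' : B'.length < n) (h : (∃ p ∈ B, n ≤ p.1) ∨ ∃ p ∈ B', n ≤ p.1) : twins n B B' = 0 := by
  obtain ⟨m, rfl⟩ : ∃ m, n = m + 1 := ⟨n - 1, by omega⟩
  refine Nat.le_zero.1 ((run_mono_of_final (G := fun _ _ => 0) antitone_const
    fun S t ht h1 _ _ h4 _ => ?_).trans (run_zero_right _ _ _).le)
  refine (run_mono_of_final (G := fun _ _ => 0) antitone_const
    fun S' u hu h1' _ _ h4' _ => ?_).trans (run_zero_right _ _ _).le
  rw [if_neg]
  rintro rfl
  simp only [Nat.zero_eq, zero_add] at h1 h4 h1' h4'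
  rcases h with h | h
  · have h2 : conj t 0 = m + 1 := by
      have : below t (0 : Fin (m + 1)).val = univ := eq_univ_of_forall fun c => mem_below.2 (h4 h c)
      rw [conj, this, card_univ, Fintype.card_fin]
    have := h1' 0
    omega
  · have := h4' h (Fin.last m)
    rw [conj_eq_zero fun c => (h1 c).trans (by simp; omega)] at this
    omega

theorem twins_eq_zero_of_sum {n : ℕ} {B B' : List (ℕ × ℕ)} (hB : B.length < n)
    (h : (B.map Prod.fst).sum ≠ (B'.map Prod.fst).sum) : twins n B B' = 0 := by
  refine Nat.le_zero.1 ((run_mono_of_final (G := fun _ _ => 0) antitone_const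
    fun S t ht h1 h2 _ _ _ => ?_).trans (run_zero_right _ _ _).le)
  refine (run_mono_of_final (G := fun _ _ => 0) antitone_const
    fun S' u hu h1' h2' _ _ _ => ?_).trans (run_zero_right _ _ _).le
  rw [if_neg]
  rintro rfl
  simp only [Nat.zero_eq, zero_add, sum_const_zero] at h1 h2 h2'
  rw [sum_conj fun c => (h1 c).trans hB.le] at h2'
  omega

theorem twins_le_of_check {i d : ℕ} (hd2 : 2 ≤ d) (hdi : d ≤ i) (hi4 : i ≤ 4)
    (hcheck : checkLast i d = true) {k h f : ℕ → ℕ} (hk : Antitone k)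
    (hl : ∀ a < i, i + 1 ≤ k a + a) (hkd : k (i - 1) = d) (hh : Antitone h) (hf : Antitone f)
    (hhk : h ≤ k) (hfk : f ≤ k) (hh0 : h (i - 1) = 0) (hf0 : f (i - 1) = 0) :
    twins (i + 1) (body i k h) (body i k f) ≤
      twinsSucc (i + 1) (body i k h) (body i k f) 0 0 := by
  have hn : ∀ g, (body i k g).length < i + 1 := fun g => by rw [length_body]; omega
  by_cases hsz : (∃ p ∈ body i k h, i + 1 ≤ p.1) ∨ ∃ p ∈ body i k f, i + 1 ≤ p.1
  · rw [twins_eq_zero_of_size (hn h) (hn f) hsz]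
    exact Nat.zero_le _
  by_cases hsum : ((body i k h).map Prod.fst).sum = ((body i k f).map Prod.fst).sum
  swap
  · rw [twins_eq_zero_of_sum (hn h) hsum]
    exact Nat.zero_le _
  rw [not_or] at hsz
  obtain ⟨j, rfl⟩ : ∃ j, i = j + 1 := ⟨i - 1, by omega⟩
  rw [Nat.add_sub_cancel] at *
  have hsize : ∀ g : ℕ → ℕ, (¬ ∃ p ∈ body (j + 1) k g, j + 1 + 1 ≤ p.1) →
      ∀ a ≤ j, k a - g a ≤ j + 1 := by
    intro g hg a ha
    by_contra hcon
    exact hg ⟨colAt k g a, by rw [body_eq]; exact List.mem_map_of_mem (List.mem_range.2 (by omega)),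
      by simp only [colAt]; omega⟩
  have hsh := hsize h hsz.1
  have hsf := hsize f hsz.2
  set thr : List ℕ := (List.range j).map fun a => min (j + 1) (k a - k (a + 1)) with hthr
  have hbody : ∀ g : ℕ → ℕ, body (j + 1) k g =
      colAt k g 0 :: (List.range' 1 j).map (colAt k g) := by
    intro g
    rw [body_eq, List.range_eq_range', List.range'_succ]
    rfl
  have hfst : ∀ g : ℕ → ℕ, g j = 0 → (body (j + 1) k g).map Prod.fst =
      ((List.range j).map fun c => k c - g c) ++ [d] := by
    intro g hg
    rw [map_fst_body, List.range_succ, List.map_append, List.map_singleton, hkd, hg, Nat.sub_zero]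
  have hrun : ∀ g : ℕ → ℕ, Antitone g → g ≤ k → g j = 0 → (∀ a ≤ j, k a - g a ≤ j + 1) →
      ∀ F : Finset (Fin (j + 2)) → (Fin (j + 2) → ℕ) → ℕ,
      ((chainsIn (j + 1) d thr.reverse ((List.range j).map fun c => k c - g c)).map
        fun x => F (toSet (j + 2) x.2.1) (toFun (j + 2) x.2.2)).sum =
        run (body (j + 1) k g) ∅ 0 F := by
    intro g hg hgk hg0 hgs F
    have := sum_chainList_first (n := j + 2) (i := j + 1) (by omega) F (p := colAt k g 0)
      (P := (List.range' 1 j).map (colAt k g)) (thr := thr) (by simp [colAt]) ?_ (by simp; omega)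
    · rw [← hbody, hfst g hg0] at this
      exact this
    · have := fits_body (i := j + 1) hk hg hgk j 0 (by simpa using hgs)
      rw [hthr, List.range_eq_range']
      exact this
  have hprops : ∀ g : ℕ → ℕ,
      ∀ x ∈ chainsIn (j + 1) d thr.reverse ((List.range j).map fun c => k c - g c),
      x.2.1.length = j + 2 ∧ x.2.1.count true = d ∧ x.2.2.IsChain (· ≥ ·) ∧
        x.2.2.length = j + 2 ∧ ∀ y ∈ x.2.2, y < 100 := by
    intro g x hx
    have hx' := List.mem_of_mem_filter hx
    have hz : ∀ y ∈ List.replicate (j + 1 + 1) 0, y = 0 := fun y hy => List.eq_of_mem_replicate hy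
    obtain ⟨h1, h2⟩ := bounded_of_mem_chainList (k := 0) (fun y hy => (hz y hy).le) hx'
    have hch : (List.replicate (j + 1 + 1) 0).IsChain (· ≥ ·) := by
      rw [← antitone_toFun (List.length_replicate (n := j + 1 + 1)), toFun_replicate]
      exact antitone_const
    obtain ⟨h3, h4, h5⟩ := props_of_mem_chainList hch
      (fun y hy => by rw [hz y hy]; simp; omega) (by simp) hx'
    refine ⟨by simpa using h3, by simpa using h4, h5, by simpa using h1, fun y hy => ?_⟩
    have := h2 y hy
    simp at this
    omega
  set X := chainsIn (j + 1) d thr.reverse ((List.range j).map fun c => k c - h c) with hX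
  set Y := chainsIn (j + 1) d thr.reverse ((List.range j).map fun c => k c - f c) with hY
  have hL : twins (j + 2) (body (j + 1) k h) (body (j + 1) k f) =
      (X.map fun x => (Y.map fun y =>
        if y.2.2 = cnj x.2.2 (j + 1 + 1) 0 then 1 else 0).sum).sum := by
    rw [twins, ← hrun h hh hhk hh0 hsh]
    refine congrArg List.sum (List.map_congr_left fun x hx => ?_)
    rw [← hrun f hf hfk hf0 hsf]
    refine congrArg List.sum (List.map_congr_left fun y hy => ?_)
    simp only [toFun_eq_conj_iff (hprops h x hx).2.2.2.1 (hprops f y hy).2.2.2.1]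
  have hR : twinsSucc (j + 2) (body (j + 1) k h) (body (j + 1) k f) 0 0 =
      (X.map fun x => (Y.map fun y =>
      ((exts d x.2.1 x.2.2).map fun u => ((exts d y.2.1 y.2.2).map fun v =>
        if v = cnj u (j + 1 + 1) 0 then 1 else 0).sum).sum).sum).sum := by
    rw [twinsSucc, ← hrun h hh hhk hh0 hsh]
    refine congrArg List.sum (List.map_congr_left fun x hx => ?_)
    obtain ⟨x1, x2, x3, x4, x5⟩ := hprops h x hx
    rw [← sum_exts x1 x2 (by omega) x4 x3 x5 fun t' => run (n := j + 2) (body (j + 1) k f) ∅ 0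
      fun S' u => run [(1, 0)] S' u fun _ u' => if u' = conj t' then 1 else 0, sum_map_comm]
    refine congrArg List.sum (List.map_congr_left fun u hu => ?_)
    have hu' := (bounded_of_mem_exts hu (k := 99) fun y hy => by have := x5 y hy; omega).1.trans x4
    rw [← hrun f hf hfk hf0 hsf]
    refine congrArg List.sum (List.map_congr_left fun y hy => ?_)
    obtain ⟨y1, y2, y3, y4, y5⟩ := hprops f y hy
    rw [← sum_exts y1 y2 (by omega) y4 y3 y5 fun u' => if u' = conj (toFun (j + 2) u) then 1 else 0]
    refine congrArg List.sum (List.map_congr_left fun v hv => ?_)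
    have hv' := (bounded_of_mem_exts hv (k := 99) fun y hy => by have := y5 y hy; omega).1.trans y4
    simp only [toFun_eq_conj_iff hu' hv']
  rw [hL, hR]
  have hsum' : ((List.range j).map fun c => k c - h c).sum =
      ((List.range j).map fun c => k c - f c).sum := by
    rw [hfst h hh0, hfst f hf0, List.sum_append, List.sum_append] at hsum
    omega
  have hmem : ∀ g : ℕ → ℕ, (∀ a ≤ j, k a - g a ≤ j + 1) →
      ∀ x ∈ (List.range j).map fun c => k c - g c, x ≤ j + 1 := by
    intro g hg x hx
    obtain ⟨a, ha, rfl⟩ := List.mem_map.1 hx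
    exact hg a (List.mem_range.1 ha).le
  have hcs := allB_iff.1 hcheck ((List.range j).map fun c => k c - h c).sum (by
    rw [List.mem_range]
    have := List.sum_le_card_nsmul _ _ (hmem h hsh)
    simp at this ⊢
    omega)
  rw [strict_eq] at hcs
  exact sum_chainsIn_le (by omega) (by omega) hcs
    (mem_sizesOf (by simp) (hmem h hsh) rfl) (mem_sizesOf (by simp) (hmem f hsf) hsum'.symm)
    (tailLarge_range hk hl j d (by omega) (by omega) (by omega))

theorem checkLast_eq_true {i d : ℕ} (h1 : 2 ≤ d) (h2 : d ≤ i) (h3 : i ≤ 4) :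
    checkLast i d = true := by
  interval_cases i <;> interval_cases d
  · exact checkLast_two_two
  · exact checkLast_three_two
  · exact checkLast_three_three
  · exact checkLast_four_two
  · exact checkLast_four_three
  · exact checkLast_four_four

/-- Adding a cell to the first row of a partition of type 1 and width at most 4 does not decrease
the numbers of pairs of words. -/
theorem pairs_le_pairs {i : ℕ} (h1 : 1 ≤ i) (hi : i ≤ 4) {k h f : ℕ → ℕ} (hk : Antitone k)
    (hki : k i = 0) (hl : ∀ a < i, i + 1 ≤ k a + a) (hh : Antitone h) (hf : Antitone f)
    (hhk : h ≤ k) (hfk : f ≤ k) :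
    pairs (n := i + 1) (fun c => k c) (fun c => h c) (fun c => f c) ≤
      pairs (n := i + 1) (fun c => k c + if c.val = i then 1 else 0) (fun c => h c)
        (fun c => f c) := by
  have hhi : h i = 0 := Nat.le_zero.1 (hki ▸ hhk i)
  have hfi : f i = 0 := Nat.le_zero.1 (hki ▸ hfk i)
  rw [pairs_eq_twins h1 hki]
  have := pairs_eq_twinsSucc h1 (k := fun c => k c + if c = i then 1 else 0) (h := h) (f := f)
    (by simp [hki]) hhi hfi
  rw [this, body_congr (k := fun c => k c + if c = i then 1 else 0) (k' := k)
      (fun c hc => by simp [hc.ne]),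
    body_congr (k := fun c => k c + if c = i then 1 else 0) (k' := k)
      (fun c hc => by simp [hc.ne])]
  have hd := hl (i - 1) (by omega)
  have hlast : ∀ g : ℕ → ℕ, g ≤ k →
      1 ≤ ((body i k g).map Prod.fst).getLastD 0 + g (i - 1) := by
    intro g hg
    obtain ⟨j, rfl⟩ : ∃ j, i = j + 1 := ⟨i - 1, by omega⟩
    rw [map_fst_body, List.range_succ, List.map_append, List.map_singleton, List.getLastD_concat,
      Nat.add_sub_cancel]
    have := hg j
    simp at hd
    omega
  by_cases hA : 1 ≤ h (i - 1)
  · exact twins_le_of_left (by rw [length_body]; omega) hA (hlast f hfk)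
  by_cases hB : 1 ≤ f (i - 1)
  · exact twins_le_of_right (by rw [length_body]; omega) hB (hlast h hhk)
  have hh0 : h (i - 1) = 0 := by omega
  have hf0 : f (i - 1) = 0 := by omega
  rw [hh0, hf0]
  by_cases hdi : k (i - 1) ≤ i
  · exact twins_le_of_check (by omega) hdi hi (checkLast_eq_true (by omega) hdi hi) hk hl rfl hh hf
      hhk hfk hh0 hf0
  · rw [twins_eq_zero_of_size (by rw [length_body]; omega) (by rw [length_body]; omega)
      (Or.inl ⟨colAt k h (i - 1), ?_, ?_⟩)]
    · exact Nat.zero_le _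
    · rw [body_eq]; exact List.mem_map_of_mem (List.mem_range.2 (by omega))
    · simp only [colAt]; omega

end FiniteCheck

section Split

variable {n : ℕ}

theorem run_head_change {p q : ℕ × ℕ} (h : p.1 = q.1) (hp : p.1 ≤ p.2) (hq : q.1 ≤ q.2)
    (L : List (ℕ × ℕ)) (S S' : Finset (Fin n)) (a : Fin n → ℕ)
    (F : Finset (Fin n) → (Fin n → ℕ) → ℕ) : run (p :: L) S a F = run (q :: L) S' a F := by
  classical
  rw [run_cons, run_cons]
  refine sum_congr (filter_congr fun T _ => ?_) fun _ _ => rfl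
  rw [h]
  exact and_congr_right fun hT => and_congr_left fun _ =>
    ⟨fun _ => compat_of_card_le (hT.le.trans hq),
      fun _ => compat_of_card_le (hT.le.trans (h.symm.le.trans hp))⟩

theorem run_eq_zero_of_lt {L : List (ℕ × ℕ)} (h : ∃ p ∈ L, n < p.1) (S : Finset (Fin n))
    (a : Fin n → ℕ) (F : Finset (Fin n) → (Fin n → ℕ) → ℕ) : run L S a F = 0 := by
  classical
  induction L generalizing S a with
  | nil => simp at h
  | cons p L ih =>
    rw [run_cons]
    refine sum_eq_zero fun T hT => ?_
    obtain ⟨q, hq, hn⟩ := h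
    rcases List.mem_cons.1 hq with rfl | hq
    · have h1 := (mem_filter.mp hT).2.1
      have h2 := card_le_univ T
      rw [Fintype.card_fin] at h2
      omega
    · exact ih ⟨q, hq, hn⟩ _ _

/-- A row with `R` cells in the last `R` columns forces the first letter to occur at least `R`
times. -/
theorem run_eq_zero_of_row {n : ℕ} {g s : ℕ → ℕ} (hg : Antitone g) {m : ℕ}
    {F : Finset (Fin (n + 1)) → (Fin (n + 1) → ℕ) → ℕ} (R : ℕ) (hq : ∀ j < R, m < g j ∧ g j ≤ m + s j) : ∀ (r : ℕ) (S : Finset (Fin (n + 1)))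
    (a : Fin (n + 1) → ℕ), (∀ b : Fin (n + 1), g R ≤ upCard S b + m → r ≤ a b) → r ≤ a 0 →
    (∀ S t, r + R ≤ t 0 → F S t = 0) → run (cols (fun j => (s j, g j - g (j + 1))) R) S a F = 0 := by
  classical
  induction R with
  | zero => exact fun r S a _ h0 hF => hF S a h0
  | succ R ih =>
    intro r S a ha h0 hF
    rw [cols, run_cons]
    refine sum_eq_zero fun T hT => ?_
    obtain ⟨-, hc, hcomp, hA⟩ := mem_filter.mp hT
    simp only at hc hcomp
    obtain ⟨q1, q2⟩ := hq R (by omega)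
    have hgR : g (R + 1) ≤ g R := hg (Nat.le_succ R)
    have key : ∀ b : Fin (n + 1), g R ≤ upCard T b + m → r + 1 ≤ (a + ind T) b := by
      intro b hb
      -- the largest letter satisfying the bound belongs to the column
      have hne : (univ.filter fun x : Fin (n + 1) => g R ≤ upCard T x + m).Nonempty :=
        ⟨b, by simpa using hb⟩
      set x := (univ.filter fun x : Fin (n + 1) => g R ≤ upCard T x + m).max' hne with hx
      have hx1 : g R ≤ upCard T x + m := (mem_filter.1 (max'_mem _ hne)).2
      have hbx : b ≤ x := le_max' _ _ (by simpa using hb)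
      have hxT : x ∈ T := by
        by_contra hxT
        have h1 := upCard_val T x
        rw [ind, if_neg hxT, add_zero] at h1
        have h2 : 0 < upCard T (x.val + 1) := by omega
        obtain ⟨y, hy⟩ := card_pos.1 h2
        have hxy : x.val + 1 ≤ y.val := (mem_filter.1 hy).2
        rw [h1] at hx1
        have hlt : x.val + 1 < n + 1 := lt_of_le_of_lt hxy y.isLt
        have h3 : (⟨x.val + 1, hlt⟩ : Fin (n + 1)) ≤ x :=
          le_max' _ (⟨x.val + 1, hlt⟩ : Fin (n + 1)) (mem_filter.2 ⟨mem_univ _, hx1⟩)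
        have := Fin.le_def.1 h3
        simp at this
      have h4 := hcomp x
      have h5 := ha x (by omega)
      have h6 := hA hbx
      simp only [Pi.add_apply, ind, if_pos hxT] at h6 ⊢
      omega
    refine ih (fun j hj => hq j (by omega)) (r + 1) T _ key (key 0 ?_) fun S t ht => hF S t (by omega)
    rw [Fin.val_zero, upCard_zero]
    omega

end Split

section Complement

theorem conjP_zero {f : ℕ → ℕ} (hf : IsPartition f) : conjP f 0 = plen f := by
  obtain ⟨N, hN⟩ := hf.2
  have hmem : f (plen f) = 0 := Nat.sInf_mem (s := {n | f n = 0}) ⟨N, hN⟩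
  refine conjP_eq_of hf fun r => ⟨fun h => ?_, fun h => ?_⟩
  · by_contra hcon
    exact absurd (Nat.sInf_le (s := {n | f n = 0}) (show f r = 0 by omega)) (not_le.2 h)
  · by_contra hcon
    have := hf.1 (not_lt.1 hcon)
    omega

theorem isPartition_complP {f : ℕ → ℕ} (hf : IsPartition f) (m : ℕ) : IsPartition (complP m f) := by
  refine ⟨antitone_nat_of_succ_le fun i => ?_, m, by simp [complP]⟩
  have := hf.1 (show m - 1 - (i + 1) ≤ m - 1 - i by omega)
  unfold complP
  split_ifs <;> omega

theorem conjP_complP {f : ℕ → ℕ} (hf : IsPartition f) {m : ℕ} (hm : plen f ≤ m) (j : ℕ) :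
    conjP (complP m f) j = if j < m then m - conjP f (m - 1 - j) else 0 := by
  refine conjP_eq_of (isPartition_complP hf m) fun r => ?_
  have h1 : ∀ x, conjP f x ≤ m := fun x =>
    ((conjP_antitone hf (Nat.zero_le x)).trans_eq (conjP_zero hf)).trans hm
  have h2 := lt_conjP_iff hf (r := m - 1 - r) (j := m - 1 - j)
  have h3 := h1 (m - 1 - j)
  unfold complP
  split_ifs with hj hr hr
  · constructor
    · intro h
      by_contra hcon
      have := h2.2 (by omega)
      omega
    · intro h
      by_contra hcon
      have := h2.1 (by omega)
      omega
  · omega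
  · omega
  · omega

theorem subP_iff_conjP {f g : ℕ → ℕ} (hf : IsPartition f) (hg : IsPartition g) :
    subP f g ↔ ∀ j, conjP f j ≤ conjP g j := by
  refine ⟨conjP_le_conjP hf hg, fun h r => ?_⟩
  by_contra hcon
  push Not at hcon
  have h1 := (lt_conjP_iff hf).2 hcon
  have h2 := (lt_conjP_iff hg).1 (h1.trans_le (h _))
  omega

/-- The column heights of the part of `lam` facing the partition removed from the square. -/
noncomputable def facing (lam : ℕ → ℕ) (m c : ℕ) : ℕ := m - conjP lam (m - 1 - c)

theorem facing_antitone {lam : ℕ → ℕ} (hl : IsPartition lam) (m : ℕ) : Antitone (facing lam m) :=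
  antitone_nat_of_succ_le fun c => by
    have := conjP_antitone hl (show m - 1 - (c + 1) ≤ m - 1 - c by omega)
    unfold facing
    omega

variable {nu lam : ℕ → ℕ}

/-- The columns of `lam` to the right of the square. -/
noncomputable def outer (lam : ℕ → ℕ) (m : ℕ) : List (ℕ × ℕ) :=
  cols (fun j => (conjP lam (m + j), conjP lam (m + j) - conjP lam (m + j + 1))) (lam 0)

/-- The first `K` columns of the part of `lam` below the square. -/
noncomputable def lower (lam : ℕ → ℕ) (m K : ℕ) : List (ℕ × ℕ) :=
  cols (fun j => (conjP lam j - m, conjP lam j - conjP lam (j + 1))) K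

theorem LRcoeff_eq_zero (hn : IsPartition nu) (hl : IsPartition lam) {n m : ℕ} (h0 : nu 0 < n)
    (hm : n + plen nu ≤ m) (h : ¬ (subP (complP m nu) lam ∧ conjP lam m ≤ n ∧
      conjP lam (m - n) ≤ m)) : LRcoeff lam (complP m nu) (conjP nu) = 0 := by
  rw [LRcoeff]
  split_ifs with hsub
  swap
  · rfl
  have hcomp := conjP_complP hn (m := m) (by omega)
  obtain ⟨n, rfl⟩ : ∃ n', n = n' + 1 := ⟨n - 1, by omega⟩
  rw [card_LRTableau (n := n + 1) hl (isPartition_complP hn m) (J := m + lam 0) (by omega)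
    fun k hk => conjP_eq_zero hn (by omega)]
  by_cases h1 : conjP lam m ≤ n + 1
  · have h2 : m < conjP lam (m - (n + 1)) := by
      by_contra h2
      exact h ⟨hsub, h1, by omega⟩
    obtain ⟨K, hK⟩ : ∃ K, m + lam 0 = (m - (n + 1) + 1) + K := ⟨m + lam 0 - (m - (n + 1) + 1), by omega⟩
    rw [hK, cols_add, cnt, run_append]
    refine Nat.le_zero.1 ((run_mono (G := fun _ _ => 0) antitone_const fun S t ht => ?_).trans
      (run_zero_right _ _ _).le)
    refine (run_eq_zero_of_row (conjP_antitone hl) (m := m) _ (fun j hj => ?_) 0 S t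
      (fun _ _ => Nat.zero_le _) (Nat.zero_le _) fun S t ht => ?_).le
    · have := conjP_antitone hl (show j ≤ m - (n + 1) by omega)
      refine ⟨by omega, ?_⟩
      have h3 : conjP (complP m nu) j ≤ m := by rw [hcomp]; split_ifs <;> omega
      omega
    · rw [if_neg]
      rintro rfl
      simp only [Fin.val_zero, conjP_zero hn] at ht
      omega
  · obtain ⟨K, hK⟩ : ∃ K, m + lam 0 = (m + 1) + K := by
      refine ⟨lam 0 - 1, ?_⟩
      have := (lt_conjP_iff hl (r := 0) (j := m)).1 (by omega)
      omega
    rw [hK, cols_add]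
    refine run_eq_zero_of_lt ⟨_, List.mem_append_right _ (List.mem_cons_self ..), ?_⟩ _ _ _
    simp only [hcomp, lt_irrefl, if_false]
    omega

theorem LRcoeff_eq_run (hn : IsPartition nu) (hl : IsPartition lam) {n m : ℕ} (h0 : nu 0 ≤ n)
    (hn0 : 1 ≤ n) (hm : n + plen nu ≤ m) (h1 : subP (complP m nu) lam) (h2 : conjP lam m ≤ n)
    (h3 : conjP lam (m - n) ≤ m) : LRcoeff lam (complP m nu) (conjP nu) =
      run (n := n) (outer lam m) ∅ 0 fun _ t => run (lower lam m (m - n)) ∅ t fun _ u =>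
        cnt (n := n) (cols (spec (fun c : Fin n => conjP nu c) fun c => facing lam m c) n) ∅ u
          fun c => conjP nu c := by
  have hcomp := conjP_complP hn (m := m) (by omega)
  have hanti := conjP_antitone hl
  have hkap : Antitone fun c : Fin n => conjP nu c := fun c c' h => conjP_antitone hn h
  rw [LRcoeff, if_pos h1, card_LRTableau (n := n) hl (isPartition_complP hn m) (J := m + lam 0)
    (by omega) fun k hk => conjP_eq_zero hn (by omega), cols_add, cnt_append]
  have hlow : Free (lower lam m (m - n)) := by
    obtain h | ⟨K, hK⟩ : m - n = 0 ∨ ∃ K, m - n = K + 1 :=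
      (Nat.eq_zero_or_eq_succ_pred _).imp_right fun h => ⟨_, h⟩
    · rw [lower, h]; trivial
    · rw [lower, hK]
      change conjP lam K - m ≤ conjP lam K - conjP lam (K + 1)
      rw [← hK]
      omega
  have houter : cols (fun j => (conjP lam (m + j) - conjP (complP m nu) (m + j),
      conjP lam (m + j) - conjP lam (m + j + 1))) (lam 0) = outer lam m :=
    cols_congr fun j _ => by simp [hcomp]
  rw [houter]
  refine run_congr antitone_const fun S t ht => ?_
  have hfac := free_spec (fun c : Fin n => conjP nu c) fun c => facing lam m c
  have hsub := (subP_iff_conjP (isPartition_complP hn m) hl).1 h1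
  -- replace the first of the columns facing the removed partition
  have key : cnt (cols (fun j => (conjP lam j - conjP (complP m nu) j,
      conjP lam j - conjP lam (j + 1))) m) S t (fun c : Fin n => conjP nu c) =
      cnt (cols (spec (fun c : Fin n => conjP nu c) fun c => facing lam m c) n ++
        lower lam m (m - n)) ∅ t fun c => conjP nu c := by
    obtain ⟨n, rfl⟩ : ∃ n', n = n' + 1 := ⟨n - 1, by omega⟩
    have hsplit := cols_add (fun j => (conjP lam j - conjP (complP m nu) j,
      conjP lam j - conjP lam (j + 1))) (m - (n + 1)) (n + 1)
    rw [show m - (n + 1) + (n + 1) = m by omega] at hsplit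
    have hlower : cols (fun j => (conjP lam j - conjP (complP m nu) j,
        conjP lam j - conjP lam (j + 1))) (m - (n + 1)) = lower lam m (m - (n + 1)) := by
      refine cols_congr fun j hj => ?_
      rw [hcomp, if_pos (by omega), conjP_eq_zero hn (by omega), Nat.sub_zero]
    have hsize : ∀ c : Fin (n + 1), conjP lam (m - 1 - c) - conjP (complP m nu) (m - 1 - c) =
        conjP nu c - facing lam m c := by
      intro c
      have := hsub (m - 1 - c)
      have h4 := hanti (show m - (n + 1) ≤ m - 1 - c by omega)
      rw [hcomp, if_pos (by omega), show m - 1 - (m - 1 - c.val) = c by omega] at this ⊢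
      rw [facing]
      have h5 : conjP nu c ≤ conjP nu 0 := conjP_antitone hn (Nat.zero_le _)
      rw [conjP_zero hn] at h5
      omega
    rw [hsplit, hlower, cols, cols, List.cons_append, List.cons_append, cnt, cnt]
    have htail : cols (fun j => (conjP lam (m - (n + 1) + j) -
        conjP (complP m nu) (m - (n + 1) + j), conjP lam (m - (n + 1) + j) -
          conjP lam (m - (n + 1) + j + 1))) n =
        cols (spec (fun c : Fin (n + 1) => conjP nu c) fun c => facing lam m c) n := by
      refine cols_congr fun j hj => ?_
      have hs := hsize ⟨n - j, by omega⟩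
      have hf := spec_fst (fun c : Fin (n + 1) => conjP nu c) (fun c => facing lam m c)
        ⟨n - j, by omega⟩
      have hg := spec_snd_succ (fun c : Fin (n + 1) => conjP nu c) (fun c => facing lam m c)
        (c₀ := ⟨n - j - 1, by omega⟩) (c := ⟨n - j, by omega⟩) (by simp; omega)
      simp only [show n + 1 - 1 - (n - j) = j by omega,
        show m - 1 - (n - j) = m - (n + 1) + j by omega] at hs hf hg
      refine Prod.ext (hs.trans hf.symm) (Eq.trans ?_ hg.symm)
      have h4 := hanti (show m - (n + 1) ≤ m - (n + 1) + j by omega)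
      have h5 := hanti (show m - (n + 1) + j ≤ m - (n + 1) + j + 1 by omega)
      rw [facing, facing, show m - 1 - (n - j - 1) = m - (n + 1) + j + 1 by omega,
        show m - 1 - (n - j) = m - (n + 1) + j by omega]
      simp only
      omega
    rw [htail]
    have hs := hsize 0
    have hf := spec_fst (fun c : Fin (n + 1) => conjP nu c) (fun c => facing lam m c) 0
    simp only [Fin.val_zero, Nat.sub_zero, Nat.add_sub_cancel] at hs hf
    refine run_head_change ?_ ?_ hfac _ _ _ _ _
    · rw [hf, ← hs, show m - (n + 1) + n = m - 1 by omega]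
    · have := hsub (m - 1)
      rw [hcomp, if_pos (by omega), show m - 1 - (m - 1) = 0 by omega, conjP_zero hn] at this
      simp only [show m - (n + 1) + n = m - 1 by omega, hcomp, show m - 1 + 1 = m by omega,
        show m - 1 - (m - 1) = 0 by omega, conjP_zero hn, if_pos (show m - 1 < m by omega)]
      omega
  rw [show (cols (fun j => (conjP lam j - conjP (complP m nu) j,
    conjP lam j - conjP lam (j + 1))) m) = _ from rfl, key, cnt_append_comm hfac hlow ht hkap,
    cnt_append]
  exact run_congr ht fun S u _ => cnt_free_eq hfac _ _ _ _

end Complement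

section AddRow

variable {nu : ℕ → ℕ}

theorem isPartition_addRow1 (hn : IsPartition nu) : IsPartition (addRow1 nu) := by
  refine ⟨antitone_nat_of_succ_le fun j => ?_, ?_⟩
  · have := hn.1 (Nat.le_succ j)
    simp only [Nat.succ_eq_add_one] at this
    unfold addRow1
    split_ifs <;> (simp_all; try omega)
  · obtain ⟨N, hN⟩ := hn.2
    refine ⟨N + 1, ?_⟩
    have := hn.1 (Nat.le_succ N)
    simp only [Nat.succ_eq_add_one] at this
    simp [addRow1]
    omega

theorem conjP_addRow1 (hn : IsPartition nu) (c : ℕ) :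
    conjP (addRow1 nu) c = conjP nu c + if c = nu 0 then 1 else 0 := by
  refine conjP_eq_of (isPartition_addRow1 hn) fun r => ?_
  have h := lt_conjP_iff hn (r := r) (j := c)
  unfold addRow1
  split_ifs with h1 h2 h2
  · subst h1
    simp [conjP_eq_zero hn le_rfl, h2]
  · subst h1
    simp only [conjP_eq_zero hn le_rfl]
    have := hn.1 (Nat.zero_le r)
    omega
  · subst h2
    omega
  · exact h

theorem plen_addRow1 (hn : IsPartition nu) (h0 : nu 0 ≠ 0) : plen (addRow1 nu) = plen nu := by
  rw [← conjP_zero hn, ← conjP_zero (isPartition_addRow1 hn), conjP_addRow1 hn, if_neg h0.symm,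
    add_zero]

theorem le_conjP_of_type1 (h : Type1 nu) {a : ℕ} (ha : a < nu 0) : nu 0 + 1 ≤ conjP nu a + a := by
  by_contra hcon
  have h1 := (lt_conjP_iff h.1 (r := conjP nu a) (j := a)).not.1 (lt_irrefl _)
  have h2 := h.2 (nu 0 - a)
  have h3 := h.1.1 (show conjP nu a ≤ nu 0 - a by omega)
  rw [betaShape] at h2
  split_ifs at h2 <;> omega

/-- A nonempty partition of type 1 and width at most 4 is covered by the partition obtained by
adding a cell to its first row. -/
theorem covers_addRow1 (h : Type1 nu) (h0 : nu 0 ≠ 0) (h4 : nu 0 ≤ 4) : Covers (addRow1 nu) nu := by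
  intro m hm lam hl
  have hn := h.1
  have hmu := isPartition_addRow1 hn
  have hlen := plen_addRow1 hn h0
  have hrow : addRow1 nu 0 = nu 0 + 1 := by simp [addRow1]
  rw [hrow, hlen] at hm
  by_cases hcase : subP (complP m nu) lam ∧ conjP lam m ≤ nu 0 + 1 ∧
      conjP lam (m - (nu 0 + 1)) ≤ m
  swap
  · rw [LRcoeff_eq_zero hn hl (Nat.lt_succ_self _) hm hcase]
    exact Nat.zero_le _
  obtain ⟨c1, c2, c3⟩ := hcase
  have hsub : subP (complP m (addRow1 nu)) lam := by
    refine fun r => le_trans ?_ (c1 r)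
    unfold complP addRow1
    split_ifs with h1 h2
    · rw [h2]; omega
    · exact le_rfl
    · exact le_rfl
  rw [LRcoeff_eq_run (n := nu 0 + 1) hn hl (Nat.le_succ _) (Nat.succ_pos _) hm c1 c2 c3,
    LRcoeff_eq_run (n := nu 0 + 1) hmu hl hrow.le (Nat.succ_pos _) (by rw [hlen]; exact hm) hsub c2
      c3]
  refine run_mono antitone_const fun S t ht => run_mono ht fun S' u hu => ?_
  have hkap := conjP_antitone hn
  have hkap' := conjP_antitone hmu
  by_cases hle : u ≤ fun c : Fin (nu 0 + 1) => conjP nu c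
  swap
  · rw [cnt_eq_zero_of_not_le hle]
    exact Nat.zero_le _
  have hle' : u ≤ fun c : Fin (nu 0 + 1) => conjP (addRow1 nu) c := fun c =>
    (hle c).trans ((Nat.le_add_right _ _).trans_eq (conjP_addRow1 hn c).symm)
  rw [cnt_spec_eq_pairs (fun c c' hc => hkap hc) hu hle,
    cnt_spec_eq_pairs (fun c c' hc => hkap' hc) hu hle']
  have hsubc := (subP_iff_conjP (isPartition_complP hn m) hl).1 c1
  have := pairs_le_pairs (Nat.pos_of_ne_zero h0) h4 (k := conjP nu) (h := facing lam m)
    (f := fun c => if hc : c < nu 0 + 1 then u ⟨c, hc⟩ else 0) hkap (conjP_eq_zero hn le_rfl)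
    (fun a ha => le_conjP_of_type1 h ha) (facing_antitone hl m) ?_ ?_ ?_
  · simpa only [conjP_addRow1 hn, Fin.is_lt, dite_true, Fin.eta] using this
  · intro c c' hc
    simp only
    split_ifs with h1 h2
    · exact hu (Fin.le_def.2 hc)
    · omega
    · exact Nat.zero_le _
    · exact le_rfl
  · intro c
    by_cases hc : c < m
    · have h1 := hsubc (m - 1 - c)
      rw [conjP_complP hn (by omega), if_pos (by omega), show m - 1 - (m - 1 - c) = c by omega] at h1
      have h2 : conjP nu c ≤ conjP nu 0 := hkap (Nat.zero_le c)
      rw [conjP_zero hn] at h2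
      change m - conjP lam (m - 1 - c) ≤ conjP nu c
      omega
    · have h1 := hsubc 0
      rw [conjP_complP hn (by omega), if_pos (by omega), conjP_eq_zero hn (by omega)] at h1
      change m - conjP lam (m - 1 - c) ≤ conjP nu c
      rw [show m - 1 - c = 0 by omega]
      omega
  · intro c
    simp only
    split_ifs with h1
    · exact hle ⟨c, h1⟩
    · exact Nat.zero_le _

end AddRow

section Depth

theorem exists_depth {w : ℕ} (hw : 1 ≤ w) (hw4 : w ≤ 4) {p : ℕ → ℕ} (hp : Antitone p)
    (hpw : p w = 0) (hl : ∀ a < w, w + 1 ≤ p a + a) :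
    ∃ k, 1 ≤ k ∧ k ≤ w ∧ ∀ b < k, p (p b - p k) ≤ p 0 - k + b := by
  have h0 : w + 1 ≤ p 0 := hl 0 hw
  have hz : ∀ a, w ≤ a → p a = 0 := fun a ha => Nat.le_zero.1 (hpw ▸ hp ha)
  by_cases h1 : p 1 + 1 ≤ p 0
  · refine ⟨1, le_rfl, hw, fun b hb => ?_⟩
    obtain rfl : b = 0 := by omega
    have := hp (show 1 ≤ p 0 - p 1 by omega)
    omega
  have hw1 : w ≠ 1 := fun h => h1 (by have := hz 1 h.le; omega)
  by_cases h2 : p 2 + 2 ≤ p 0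
  · refine ⟨2, by omega, by omega, fun b hb => ?_⟩
    have h01 := hp (show 0 ≤ 1 by omega)
    interval_cases b
    · have := hp (show 2 ≤ p 0 - p 2 by omega)
      omega
    · have := hp (show 2 ≤ p 1 - p 2 by omega)
      omega
  have hw2 : w ≠ 2 := fun h => h2 (by have := hz 2 h.le; omega)
  have h12 := hp (show 1 ≤ 2 by omega)
  by_cases h3 : p 3 + 3 ≤ p 0
  · refine ⟨3, by omega, by omega, fun b hb => ?_⟩
    have h01 := hp (show 0 ≤ 1 by omega)
    interval_cases b
    · have := hp (show 3 ≤ p 0 - p 3 by omega)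
      omega
    · have := hp (show 3 ≤ p 1 - p 3 by omega)
      omega
    · by_cases h4 : p 2 = p 0
      · have := hp (show 3 ≤ p 2 - p 3 by omega)
        omega
      · have := hp (show 2 ≤ p 2 - p 3 by omega)
        omega
  have hw3 : w ≠ 3 := fun h => h3 (by have := hz 3 h.le; omega)
  obtain rfl : w = 4 := by omega
  refine ⟨4, by omega, le_rfl, fun b hb => ?_⟩
  rw [hpw, Nat.sub_zero]
  have h23 := hp (show 2 ≤ 3 by omega)
  by_cases h4 : 4 ≤ p b
  · rw [hz _ h4]
    exact Nat.zero_le _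
  · interval_cases b
    · omega
    · omega
    · omega
    · have := hp (show 3 ≤ p 3 by omega)
      omega

end Depth

section Glue

variable {n : ℕ}

theorem run_eq_of_fst_eq_zero {L : List (ℕ × ℕ)}
    (h : ∀ p ∈ L, p.1 = 0) (S : Finset (Fin n)) {a : Fin n → ℕ} (ha : Antitone a)
    (F : (Fin n → ℕ) → ℕ) : run L S a (fun _ t => F t) = F a := by
  induction L generalizing S with
  | nil => rfl
  | cons p L ih =>
    have h1 := run_append [p] L S a fun _ t => F t
    rw [List.singleton_append] at h1
    rw [h1, run_singleton_zero (h p List.mem_cons_self) S ha]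
    exact ih (fun q hq => h q (List.mem_cons_of_mem _ hq)) ∅

theorem eq_zero_of_plen_le {f : ℕ → ℕ} (hf : IsPartition f) {r : ℕ} (h : plen f ≤ r) : f r = 0 := by
  have := (lt_conjP_iff hf (r := r) (j := 0)).not
  rw [conjP_zero hf] at this
  omega

theorem plen_le_plen {f g : ℕ → ℕ} (hf : IsPartition f) (hg : IsPartition g) (h : subP f g) :
    plen f ≤ plen g := by
  rw [← conjP_zero hf, ← conjP_zero hg]
  exact conjP_le_conjP hf hg h 0

theorem card_below_of_isPartition {ga : ℕ → ℕ} (hg : IsPartition ga) (hgn : ga n = 0) (j : ℕ) :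
    (below (fun c : Fin n => ga c) j).card = conjP ga j := by
  have hle : conjP ga j ≤ n := by
    by_contra hcon
    have := (lt_conjP_iff hg).1 (not_le.1 hcon)
    omega
  have : below (fun c : Fin n => ga c) j = univ.filter fun c : Fin n => c.val < conjP ga j := by
    ext c
    simp [below, lt_conjP_iff hg]
  rw [this, Fin.card_filter_val_lt, min_eq_right hle]

/-- The complement of `rho` in a square, with `ga` placed to its right. -/
theorem LRcoeff_complP_add {nu rho ga : ℕ → ℕ} (hn : IsPartition nu) {m : ℕ} (h0 : nu 0 ≤ n)
    (hn0 : 1 ≤ n) (hm : n + plen nu ≤ m) (hr : IsPartition rho) (hrn : subP rho nu)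
    (hg : IsPartition ga) (hgn : ga n = 0) :
    IsPartition (fun r => complP m rho r + ga r) ∧
    LRcoeff (fun r => complP m rho r + ga r) (complP m nu) (conjP nu) =
      cnt (cols (spec (fun c : Fin n => conjP nu c) fun c => conjP rho c) n) ∅
        (fun c : Fin n => ga c) fun c => conjP nu c := by
  have hplen := plen_le_plen hr hn hrn
  have hcr := isPartition_complP hr m
  have hl : IsPartition fun r => complP m rho r + ga r := by
    refine ⟨fun x y h => add_le_add (hcr.1 h) (hg.1 h), max n m, ?_⟩
    have h1 := hg.1 (le_max_left n m)
    simp only [complP, if_neg (not_lt.2 (le_max_right n m))]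
    omega
  refine ⟨hl, ?_⟩
  have hgz : ∀ r, n ≤ r → ga r = 0 := fun r h => Nat.le_zero.1 (hgn ▸ hg.1 h)
  have hrz : ∀ r, r < n → complP m rho r = m := fun r h => by
    rw [complP, if_pos (by omega), eq_zero_of_plen_le hr (by omega), Nat.sub_zero]
  have hle : ∀ r, complP m rho r ≤ m := fun r => by unfold complP; split_ifs <;> omega
  have hc : ∀ x, conjP rho x ≤ plen rho := fun x =>
    (conjP_antitone hr (Nat.zero_le x)).trans_eq (conjP_zero hr)
  have hin : ∀ j < m, conjP (fun r => complP m rho r + ga r) j = m - conjP rho (m - 1 - j) := by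
    refine fun j hj => conjP_eq_of hl fun r => ?_
    have h1 := lt_conjP_iff hcr (r := r) (j := j)
    rw [conjP_complP hr (by omega), if_pos hj] at h1
    rw [h1]
    by_cases hrn : r < n
    · rw [hrz r hrn]; omega
    · rw [hgz r (by omega), add_zero]
  have hout : ∀ j, conjP (fun r => complP m rho r + ga r) (m + j) = conjP ga j := by
    refine fun j => conjP_eq_of hl fun r => ?_
    rw [lt_conjP_iff hg]
    by_cases hrn : r < n
    · rw [hrz r hrn]; omega
    · have := hle r
      rw [hgz r (by omega)]; omega
  have hgle : ∀ j, conjP ga j ≤ n := fun j => by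
    by_contra hcon
    have := (lt_conjP_iff hg).1 (not_le.1 hcon)
    omega
  have hsub : subP (complP m nu) fun r => complP m rho r + ga r := by
    intro r
    have := hrn (m - 1 - r)
    simp only [complP]
    split_ifs <;> omega
  rw [LRcoeff_eq_run hn hl h0 hn0 hm hsub ((hout 0).trans_le (hgle 0))
    (by rw [hin _ (by omega)]; omega)]
  have hga : Antitone fun c : Fin n => ga c := fun x y h => hg.1 h
  have houter : outer (fun r => complP m rho r + ga r) m =
      cols (straight fun c : Fin n => ga c) (complP m rho 0 + ga 0) := by
    refine cols_congr fun j _ => ?_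
    rw [straight, card_below_of_isPartition hg hgn, card_below_of_isPartition hg hgn, hout,
      add_assoc, hout]
  rw [houter, run_straight_zero hga fun c => (hg.1 (Nat.zero_le _)).trans (Nat.le_add_left _ _),
    run_eq_of_fst_eq_zero _ _ hga]
  · congr 3
    funext c
    have := hc c
    rw [facing, hin _ (by omega), show m - 1 - (m - 1 - c.val) = c by omega]
    omega
  · have : ∀ K, K ≤ m - n → ∀ p ∈ lower (fun r => complP m rho r + ga r) m K, p.1 = 0 := by
      intro K
      induction K with
      | zero => intro _ p hp; simp [lower, cols] at hp
      | succ K ih =>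
        intro hK p hp
        rw [lower, cols, List.mem_cons] at hp
        rcases hp with rfl | hp
        · change conjP _ K - m = 0
          rw [hin _ (by omega)]
          omega
        · exact ih (by omega) p hp
    exact this _ le_rfl

end Glue

section Strip

variable {n : ℕ}

theorem cnt_replicate_ne_zero {N : ℕ} {S : Finset (Fin n)} {t κ : Fin n → ℕ} (ht : Antitone t)
    (hκ : Antitone κ) (hle : t ≤ κ) (hN : ∑ c, κ c = ∑ c, t c + N) :
    cnt (List.replicate N (1, 1)) S t κ ≠ 0 := by
  induction N generalizing S t with
  | zero =>
    have : t = κ := funext fun c =>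
      (sum_eq_sum_iff_of_le fun c _ => hle c).1 hN.symm c (mem_univ c)
    subst this
    simp [cnt, run]
  | succ N ih =>
    have hex : ∃ x, ∃ h : x < n, t ⟨x, h⟩ < κ ⟨x, h⟩ := by
      by_contra hcon
      push Not at hcon
      have := sum_le_sum fun (c : Fin n) (_ : c ∈ univ) => hcon c.val c.isLt
      simp only [Fin.eta] at this
      omega
    classical
    obtain ⟨hx, hlt⟩ := Nat.find_spec hex
    obtain ⟨z, hz⟩ : ∃ z : Fin n, z = ⟨Nat.find hex, hx⟩ := ⟨_, rfl⟩
    have hmin : ∀ c : Fin n, c < z → t c = κ c := fun c hc => by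
      rw [hz, Fin.lt_def] at hc
      have := Nat.find_min hex hc
      push Not at this
      exact le_antisymm (hle c) (this c.isLt)
    rw [← hz] at hlt
    have hanti : Antitone (t + ind {z}) := antitone_of_succ fun x y hxy => by
      have h1 := ht (show x ≤ y from Fin.le_def.2 (by omega))
      simp only [Pi.add_apply, ind, mem_singleton]
      by_cases hy : y = z
      · subst hy
        have h2 := hmin x (Fin.lt_def.2 (by omega))
        have h3 := hκ (show x ≤ y from Fin.le_def.2 (by omega))
        split_ifs <;> omega
      · split_ifs <;> omega
    have hs : ∑ c, (t + ind {z}) c = ∑ c, t c + 1 := by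
      simp [sum_add_distrib, ind]
    have h1 := ih (S := {z}) hanti (fun c => by
      have := hle c
      simp only [Pi.add_apply, ind, mem_singleton]
      split_ifs with hc
      · subst hc; omega
      · omega) (by omega)
    have h2 := le_run_singleton (p := (1, 1)) (S := S) (a := t)
      (fun S t => cnt (List.replicate N (1, 1)) S t κ) (card_singleton z)
      (compat_of_card_le (by simp)) hanti
    rw [← cnt_append, List.singleton_append, ← List.replicate_succ] at h2
    omega

/-- A dominant word ending below `κ` can be moved upwards to one ending at `κ`. -/
theorem exists_cnt_ne_zero {f : ℕ → ℕ × ℕ} {K : ℕ} (hf : Free (cols f K)) {a t κ : Fin n → ℕ}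
    (ha : Antitone a) (ht : Antitone t) (hκ : Antitone κ) (hle : t ≤ κ)
    {T : ℕ → Finset (Fin n)} (hT : IsWord f K ∅ a t T) :
    ∃ g : Fin n → ℕ, Antitone g ∧ a ≤ g ∧ cnt (cols f K) ∅ g κ ≠ 0 := by
  obtain ⟨N, hN⟩ : ∃ N, ∑ c, κ c = ∑ c, t c + N :=
    Nat.exists_eq_add_of_le (sum_le_sum fun c _ => hle c)
  have hL : Free (List.replicate N (1, 1)) := by cases N <;> simp [Free, List.replicate_succ]
  have hpos : cnt (cols f K ++ List.replicate N (1, 1)) ∅ a κ ≠ 0 := by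
    have h1 : cnt (cols f K) ∅ a t ≠ 0 := by
      rw [cnt_eq_card]
      have := finite_word f K ∅ a t
      have : Nonempty {T : ℕ → Finset (Fin n) // IsWord f K ∅ a t T} := ⟨⟨T, hT⟩⟩
      exact Nat.card_pos.ne'
    rw [cnt_append]
    have h2 : cnt (cols f K) ∅ a t ≤
        run (cols f K) ∅ a fun S u => cnt (List.replicate N (1, 1)) S u κ := by
      refine run_mono ha fun S u _ => ?_
      split_ifs with h
      · subst h
        exact Nat.one_le_iff_ne_zero.2 (cnt_replicate_ne_zero ht hκ hle hN)
      · exact Nat.zero_le _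
    omega
  by_contra hcon
  push Not at hcon
  refine hpos ?_
  rw [cnt_append_comm hf hL ha hκ, cnt_append, ← Nat.le_zero, ← run_zero_right (n := n) (List.replicate N (1, 1)) ∅ a]
  refine run_mono_of_final ha fun S g hg _ _ _ _ hag => ?_
  rw [cnt_free_eq hf S ∅]
  exact (hcon g hg hag).le

end Strip

section Staircase

variable {n d k r : ℕ} {κ η : ℕ → ℕ}

/-- The column of the strip word in column `c`. -/
def stripCol (n d : ℕ) (κ η : ℕ → ℕ) (j : ℕ) : Finset (Fin n) :=
  if j < n then univ.filter fun x => d ≤ x.val ∧ x.val < d + (κ (n - 1 - j) - η (n - 1 - j)) else ∅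

theorem mem_stripCol {j : ℕ} {x : Fin n} : x ∈ stripCol n d κ η j ↔
    j < n ∧ d ≤ x.val ∧ x.val < d + (κ (n - 1 - j) - η (n - 1 - j)) := by
  unfold stripCol
  split_ifs with h <;> simp [h]

theorem card_stripCol {j : ℕ} (hj : j < n) (h : d + (κ (n - 1 - j) - η (n - 1 - j)) ≤ n) :
    (stripCol n d κ η j).card = κ (n - 1 - j) - η (n - 1 - j) := by
  have : stripCol n d κ η j =
      (Ico d (d + (κ (n - 1 - j) - η (n - 1 - j)))).attachFin fun x hx => by
        rw [mem_Ico] at hx; omega := by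
    ext x
    simp [mem_stripCol, hj]
  rw [this, card_attachFin, Nat.card_Ico]
  omega

/-- There is a chain from some weight agreeing with `κ` outside of `[d, d + k)` to `κ`. -/
theorem exists_strip (hκ : Antitone κ) (hr : κ d = r) (hkr : k ≤ r) (hdn : d + k ≤ n)
    (hη : ∀ c, η c = if c < d then κ c else min (κ c) (r - k))
    (hs : ∀ b < k, κ (d + (κ (d + b) - κ (d + k))) ≤ r - k + b) :
    ∃ g : Fin n → ℕ, Antitone g ∧ (∀ c : Fin n, c.val < d ∨ d + k ≤ c.val → κ c ≤ g c) ∧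
      cnt (cols (spec (fun c : Fin n => κ c) fun c => η c) n) ∅ g (fun c => κ c) ≠ 0 := by
  have hκ' : Antitone fun c : Fin n => κ c := fun x y h => hκ h
  have hk : ∀ c, d ≤ c → κ c - η c ≤ k := fun c hc => by
    have := hκ hc
    rw [hη, if_neg (by omega)]
    omega
  have hk0 : ∀ c < d, κ c - η c = 0 := fun c hc => by
    rw [hη, if_pos hc]; omega
  obtain ⟨a, hadef⟩ : ∃ a : Fin n → ℕ, a = fun c : Fin n =>
    if d ≤ c.val ∧ c.val < d + k then κ (d + k) else κ c := ⟨_, rfl⟩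
  -- the number of letters `x` used by the strip word
  have hcount : ∀ (j : ℕ) (x : Fin n),
      ((Ico j n).filter fun q => x ∈ stripCol n d κ η q).card ≤
        if d ≤ x.val ∧ x.val < d + k then κ x - κ (d + k) else 0 := by
    intro j x
    split_ifs with hx
    · obtain ⟨b, hb⟩ : ∃ b, x.val = d + b := ⟨x.val - d, by omega⟩
      have h1 := hs b (by omega)
      rw [hb]
      have h2 : (Ico d (d + (κ (d + b) - κ (d + k)))).card = κ (d + b) - κ (d + k) := by simp
      rw [← h2]
      refine card_le_card_of_injOn (fun q => n - 1 - q) (fun q hq => ?_) fun p hp q hq hpq => ?_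
      · simp only [coe_filter, Set.mem_ofPred_eq, mem_Ico, mem_stripCol] at hq
        simp only [coe_Ico, Set.mem_Ico]
        obtain ⟨-, hq1, -, hq2⟩ := hq
        have hcd : d ≤ n - 1 - q := by
          by_contra hcon
          rw [hk0 _ (not_le.1 hcon)] at hq2
          omega
        refine ⟨hcd, ?_⟩
        by_contra hcon
        have h3 := hκ (not_lt.1 hcon)
        rw [hη, if_neg (by omega)] at hq2
        omega
      · simp only [coe_filter, Set.mem_ofPred_eq, mem_Ico] at hp hq
        simp only at hpq
        omega
    · rw [Nat.le_zero, card_eq_zero, filter_eq_empty_iff]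
      intro q _ hq
      rw [mem_stripCol] at hq
      by_cases hcd : d ≤ n - 1 - q
      · have := hk _ hcd
        omega
      · have := hk0 _ (not_le.1 hcd)
        omega
  have hle : ∀ j, a + ∑ q ∈ Ico j n, ind (stripCol n d κ η q) ≤ fun c : Fin n => κ c := by
    intro j x
    have := hcount j x
    rw [Pi.add_apply, ind_sum_eq_card, hadef]
    simp only
    split_ifs at this ⊢ with hx
    · have := hκ hx.2.le
      omega
    · omega
  have hanti : ∀ j, Antitone (a + ∑ q ∈ Ico j n, ind (stripCol n d κ η q)) := by
    intro j
    refine antitone_of_succ fun x y hxy => ?_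
    have h1 := hle j y
    have h2 := hcount j y
    have h0 : κ y ≤ κ x := hκ (by omega)
    simp only [Pi.add_apply, ind_sum_eq_card] at h1 ⊢
    by_cases hx : d ≤ x.val ∧ x.val < d + k
    · by_cases hy : y.val < d + k
      · have h3 : ((Ico j n).filter fun q => y ∈ stripCol n d κ η q).card ≤
            ((Ico j n).filter fun q => x ∈ stripCol n d κ η q).card := by
          refine card_le_card (monotone_filter_right _ fun q _ hq => ?_)
          rw [mem_stripCol] at hq ⊢
          omega
        have h4 : a x = a y := by
          rw [hadef]
          simp only
          rw [if_pos hx, if_pos (by omega)]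
        omega
      · rw [if_neg (by omega)] at h2
        have h4 : a x = a y := by
          rw [hadef]
          simp only
          rw [if_pos hx, if_neg (by omega), show y.val = d + k by omega]
        omega
    · have h4 : a x = κ x := by
        rw [hadef]
        simp only
        rw [if_neg hx]
      omega
  have ha : Antitone a := by
    have := hanti n
    simpa using this
  have hword : IsWord (spec (fun c : Fin n => κ c) fun c => η c) n ∅ a
      (a + ∑ q ∈ Ico 0 n, ind (stripCol n d κ η q)) (stripCol n d κ η) := by
    have hcol : ∀ j < n, ∃ c : Fin n, j = n - 1 - c.val := fun j hj =>
      ⟨⟨n - 1 - j, by omega⟩, by simp; omega⟩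
    have hcard : ∀ c : Fin n, (stripCol n d κ η (n - 1 - c)).card = κ c - η c := by
      intro c
      rw [card_stripCol (by omega), show n - 1 - (n - 1 - c.val) = c by omega]
      rw [show n - 1 - (n - 1 - c.val) = c by omega]
      by_cases hc : d ≤ c
      · have := hk c hc; omega
      · have := hk0 c (by omega); omega
    refine ⟨fun j hj => ?_, fun j hj => ?_, fun j hj => ?_, fun j _ => hanti j, ?_⟩
    · rw [stripCol, if_neg (by omega)]
    · obtain ⟨c, rfl⟩ := hcol j hj
      rw [hcard, spec_fst]
    · obtain ⟨c, rfl⟩ := hcol j hj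
      by_cases hc0 : c.val = 0
      · rw [spec_snd_zero _ _ _ hc0]
        exact compat_of_card_le (by rw [hcard]; omega)
      · rw [spec_snd_succ _ _ (c₀ := ⟨c.val - 1, by omega⟩) (by simp; omega)]
        rcases lt_trichotomy c.val d with hc | hc | hc
        · exact compat_of_card_le (by rw [hcard, hk0 _ hc]; omega)
        · refine compat_of_card_le ?_
          have h1 := hκ (show c.val - 1 ≤ d by omega)
          have h2 := hk c hc.ge
          rw [hcard]
          rw [hη c, if_neg (by omega), hη, if_pos (by simp; omega)] at *
          simp only [hc, hr] at *
          omega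
        · intro b
          refine (card_le_card ?_).trans (Nat.le_add_right _ _)
          refine filter_subset_filter _ fun x hx => ?_
          rw [mem_stripCol] at hx ⊢
          rw [show n - 1 - (n - 1 - c.val) = c by omega] at hx
          rw [show n - 1 - (n - 1 - c.val + 1) = c - 1 by omega]
          refine ⟨by omega, hx.2.1, hx.2.2.trans_le ?_⟩
          have h1 := hκ (show c.val - 1 ≤ c.val by omega)
          rw [hη, hη, if_neg (by omega), if_neg (by omega)]
          omega
    · rw [← Finset.range_eq_Ico]
  obtain ⟨g, hg1, hg2, hg3⟩ :=
    exists_cnt_ne_zero (free_spec _ _) ha (hanti 0) hκ' (hle 0) hword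
  refine ⟨g, hg1, fun c hc => ?_, hg3⟩
  have := hg2 c
  rw [hadef] at this
  simp only at this
  rw [if_neg (by omega)] at this
  exact this

/-- No word is long enough to fill a column of length `k + 1` with `k` letters. -/
theorem cnt_eq_zero_of_strip {κ' : ℕ → ℕ} (hd : d < n) {g : Fin n → ℕ}
    (hg : ∀ c : Fin n, c.val < d ∨ d + k ≤ c.val → κ' c ≤ g c) (hdk : k < κ' d - η d) :
    cnt (cols (spec (fun c : Fin n => κ' c) fun c => η c) n) ∅ g (fun c => κ' c) = 0 := by
  rw [cnt_eq_card, Nat.card_eq_zero]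
  refine Or.inl ⟨fun ⟨T, hT⟩ => ?_⟩
  have h1 := hT.card (n - 1 - d) (by omega)
  have h2 := spec_fst (fun c : Fin n => κ' c) (fun c => η c) ⟨d, hd⟩
  rw [h1.trans h2 |>.symm] at hdk
  refine absurd hdk (not_lt.2 ?_)
  have h3 : (T (n - 1 - d)).card ≤ (Ico d (d + k)).card := by
    refine card_le_card_of_injOn Fin.val (fun x hx => ?_) Fin.val_injective.injOn
    rw [coe_Ico, Set.mem_Ico]
    by_contra hcon
    have h4 := hg x (by omega)
    have h5 := congrFun hT.total x
    rw [Pi.add_apply, ind_sum_eq_card] at h5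
    have h6 : 0 < ((range n).filter fun q => x ∈ T q).card :=
      card_pos.2 ⟨n - 1 - d, mem_filter.2 ⟨mem_range.2 (by omega), hx⟩⟩
    omega
  simpa using h3

end Staircase

section Corner

variable {nu mu : ℕ → ℕ}

theorem psize_eq_sum {f : ℕ → ℕ} (hf : IsPartition f) {N : ℕ} (hN : plen f ≤ N) :
    psize f = ∑ i ∈ range N, f i := by
  rw [psize]
  refine sum_subset (range_mono hN) fun x _ hx => eq_zero_of_plen_le hf ?_
  simpa using hx

theorem exists_add_cell (hn : IsPartition nu) (hmu : IsPartition mu) (hsub : subP nu mu)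
    (hsz : psize mu = psize nu + 1) : ∃ r, ∀ x, mu x = nu x + if x = r then 1 else 0 := by
  have hp := plen_le_plen hn hmu hsub
  rw [psize_eq_sum hn hp, psize_eq_sum hmu le_rfl] at hsz
  obtain ⟨r, hr, hlt⟩ : ∃ r ∈ range (plen mu), nu r < mu r :=
    exists_lt_of_sum_lt (by omega)
  have h1 : ∑ i ∈ range (plen mu), (nu i + if i = r then 1 else 0) =
      ∑ i ∈ range (plen mu), mu i := by
    rw [sum_add_distrib, sum_ite_eq', if_pos hr]
    exact hsz.symm
  have h2 := (sum_eq_sum_iff_of_le fun i _ => ?_).1 h1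
  · refine ⟨r, fun x => ?_⟩
    by_cases hx : x < plen mu
    · exact (h2 x (mem_range.2 hx)).symm
    · rw [eq_zero_of_plen_le hmu (by omega), eq_zero_of_plen_le hn (by omega), if_neg]
      rintro rfl
      exact hx (mem_range.1 hr)
  · have := hsub i
    split_ifs with h
    · subst h; omega
    · omega

theorem conjP_add_cell (hn : IsPartition nu) (hmu : IsPartition mu) {r : ℕ}
    (h : ∀ x, mu x = nu x + if x = r then 1 else 0) (hr : conjP nu (nu r) = r) (c : ℕ) :
    conjP mu c = conjP nu c + if c = nu r then 1 else 0 := by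
  refine conjP_eq_of hmu fun x => ?_
  have h1 := lt_conjP_iff hn (r := x) (j := c)
  rw [h]
  split_ifs with hc hx hx
  · subst hx hc; omega
  · rw [hc] at h1 ⊢; omega
  · subst hx
    constructor <;> intro h2 <;> omega
  · omega

/-- The partition `nu` with the rows below the first `s` cut off at width `d`. -/
def truncBelow (nu : ℕ → ℕ) (s d x : ℕ) : ℕ := if x < s then nu x else min (nu x) d

theorem isPartition_truncBelow (hn : IsPartition nu) (s d : ℕ) :
    IsPartition (truncBelow nu s d) := by
  refine ⟨antitone_nat_of_succ_le fun x => ?_, ?_⟩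
  · have := hn.1 (Nat.le_succ x)
    unfold truncBelow
    split_ifs <;> (simp only [Nat.succ_eq_add_one] at this; omega)
  · obtain ⟨N, hN⟩ := hn.2
    refine ⟨N, ?_⟩
    unfold truncBelow
    split_ifs <;> omega

theorem conjP_truncBelow (hn : IsPartition nu) (s d c : ℕ) : conjP (truncBelow nu s d) c =
    if c < d then conjP nu c else min (conjP nu c) s := by
  refine conjP_eq_of (isPartition_truncBelow hn s d) fun x => ?_
  have := lt_conjP_iff hn (r := x) (j := c)
  unfold truncBelow
  split_ifs <;> omega

/-- A partition of type 1 and width at most 4 is not covered by a partition obtained by adding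
a cell below its first row. -/
theorem not_covers_add_cell (h1 : Type1 nu) (h4 : nu 0 ≤ 4)
    (hmu : IsPartition mu) {r : ℕ} (hr0 : r ≠ 0)
    (h : ∀ x, mu x = nu x + if x = r then 1 else 0) : ¬ Covers mu nu := by
  have hn := h1.1
  have hlt : nu r < nu (r - 1) := by
    have := hmu.1 (Nat.sub_le r 1)
    rw [h, h, if_pos rfl, if_neg (by omega)] at this
    omega
  have hcr : conjP nu (nu r) = r := by
    refine conjP_eq_of hn fun x => ⟨fun hx => ?_, fun hx => ?_⟩
    · exact hlt.trans_le (hn.1 (by omega))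
    · by_contra hcon
      have := hn.1 (not_lt.1 hcon)
      omega
  have hmu0 : mu 0 = nu 0 := by rw [h, if_neg (Ne.symm hr0), add_zero]
  have hsub : subP nu mu := fun x => by rw [h]; exact Nat.le_add_right _ _
  have hplen := plen_le_plen hn hmu hsub
  have hconj := conjP_add_cell hn hmu h hcr
  obtain ⟨n, hnn⟩ : ∃ n, n = nu 0 := ⟨_, rfl⟩
  obtain ⟨d, hd⟩ : ∃ d, d = nu r := ⟨_, rfl⟩
  rw [← hd] at hlt hcr hconj
  have hdn : d < n := by
    have := hn.1 (Nat.zero_le (r - 1))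
    omega
  have hκ := conjP_antitone hn
  have hty : ∀ a < n, n + 1 ≤ conjP nu a + a := fun a ha => by
    rw [hnn] at ha ⊢; exact le_conjP_of_type1 h1 ha
  obtain ⟨k, hk1, hk2, hk3⟩ := exists_depth (w := n - d) (by omega) (by omega)
    (p := fun a => conjP nu (d + a)) (fun x y hxy => hκ (by omega))
    (conjP_eq_zero hn (by omega)) fun a ha => by
      have := hty (d + a) (by omega)
      omega
  simp only [add_zero, hcr] at hk3
  have hkr : k ≤ r := by
    have := hty d hdn
    omega
  obtain ⟨g, hg1, hg2, hg3⟩ := exists_strip (n := n) hκ hcr hkr (by omega)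
    (conjP_truncBelow hn (r - k) d) hk3
  obtain ⟨ga, hga⟩ : ∃ ga : ℕ → ℕ, ga = fun c => if hc : c < n then g ⟨c, hc⟩ else 0 := ⟨_, rfl⟩
  have hgn : ga n = 0 := by rw [hga]; simp
  have hgg : (fun c : Fin n => ga c) = g := by rw [hga]; funext c; simp
  have hgp : IsPartition ga := by
    refine ⟨antitone_nat_of_succ_le fun c => ?_, n, hgn⟩
    rw [hga]
    simp only
    split_ifs with hc hc'
    · exact hg1 (Fin.le_def.2 (Nat.le_succ c))
    · omega
    · exact Nat.zero_le _
    · exact le_rfl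
  have hrho := isPartition_truncBelow hn (r - k) d
  have hrn : subP (truncBelow nu (r - k) d) nu := fun x => by
    unfold truncBelow; split_ifs <;> omega
  intro hcov
  obtain ⟨hl, hc1⟩ := LRcoeff_complP_add (n := n) (m := n + plen mu) hn (by omega) (by omega)
    (by omega) hrho hrn hgp hgn
  obtain ⟨-, hc2⟩ := LRcoeff_complP_add (n := n) (m := n + plen mu) hmu (by omega) (by omega)
    (by omega) hrho (fun x => (hrn x).trans (hsub x)) hgp hgn
  have hzero := cnt_eq_zero_of_strip (k := k) (η := conjP (truncBelow nu (r - k) d))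
    (κ' := conjP mu) hdn (g := g) (fun c hc => by
      rw [hconj, if_neg (by omega), add_zero]
      exact hg2 c hc) (by
      rw [hconj, if_pos rfl, conjP_truncBelow hn, if_neg (lt_irrefl d), hcr]
      omega)
  have hfin := hcov (n + plen mu) (by omega) _ hl
  rw [hc1, hc2, hgg, hzero] at hfin
  omega

end Corner

end ColumnWord

/-- for a nonempty type-1 partition `ν` of width `ν₁ ≤ 4` and a partition
`μ ⊇ ν` with `|μ| = |ν| + 1`, `μ` covers `ν` if and only if `μ = ν + (1)`. -/
theorem type1_width_le_four (nu mu : ℕ → ℕ)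
    (h1 : Type1 nu) (hne : nu 0 ≠ 0) (h4 : nu 0 ≤ 4)
    (hmu : IsPartition mu) (hsub : subP nu mu) (hsz : psize mu = psize nu + 1) :
    Covers mu nu ↔ mu = addRow1 nu := by
  constructor
  · intro hcov
    obtain ⟨r, hr⟩ := ColumnWord.exists_add_cell h1.1 hmu hsub hsz
    by_cases hr0 : r = 0
    · subst hr0
      funext x
      rw [hr, addRow1]
      split_ifs with hx
      · rw [hx]
      · rfl
    · exact absurd hcov (ColumnWord.not_covers_add_cell h1 h4 hmu hr0 hr)
  · rintro rfl
    exact ColumnWord.covers_addRow1 h1 hne h4
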